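/- Under hypotheses (H1)–(H4), for p ∈ [1,∞] the following are equivalent: (a) there exists a positive constant C such that (∫_{V₁^{c,d}} |f̂(x, φ(x))|² dx)^{1/2} ≤ C ‖f‖_{L^p(ℝ⁴)} for all Schwartz functions f on ℝ⁴; (b) (α₁+α₂+4m)/(2(α₁+α₂+2m)) ≤ 1/p ≤ 1. -/

import Mathlib

open MeasureTheory Real Set
open scoped ENNReal

noncomputable section

/-- Nonisotropic dilation `t ∙ x = (t^{α₁} x₁, t^{α₂} x₂)` (for `t > 0`). -/
def dil (α₁ α₂ t : ℝ) (x : Fin 2 → ℝ) : Fin 2 → ℝ :=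
  ![t ^ α₁ * x 0, t ^ α₂ * x 1]

/-- The region `V^{a,b} = { t ∙ (1,s) : s ∈ (a,b), t > 0 }`. -/
def Vab (α₁ α₂ a b : ℝ) : Set (Fin 2 → ℝ) :=
  {x | ∃ s t : ℝ, a < s ∧ s < b ∧ 0 < t ∧ x = dil α₁ α₂ t ![1, s]}

/-- The region `V₁^{c,d} = { t ∙ (1,s) : s ∈ (c,d), 0 < t < 1 }`. -/
def V1 (α₁ α₂ c d : ℝ) : Set (Fin 2 → ℝ) :=
  {x | ∃ s t : ℝ, c < s ∧ s < d ∧ 0 < t ∧ t < 1 ∧ x = dil α₁ α₂ t ![1, s]}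

/-- Membership in the unit circle `S¹ ⊂ ℝ²`. -/
def onS1 (ζ : Fin 2 → ℝ) : Prop := ζ 0 ^ 2 + ζ 1 ^ 2 = 1

/-- The standard inner product on `ℝ²`. -/
def dot2 (u v : Fin 2 → ℝ) : ℝ := u 0 * v 0 + u 1 * v 1

/-- Hessian matrix of second partial derivatives of `f` at `x`. -/
def Hess (f : (Fin 2 → ℝ) → ℝ) (x : Fin 2 → ℝ) : Matrix (Fin 2) (Fin 2) ℝ :=
  Matrix.of fun i j => fderiv ℝ (fun y => fderiv ℝ f y (Pi.single j 1)) x (Pi.single i 1)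

/-- The form `Q_x(ζ) = det (ζ₁ Hess φ₁(x) + ζ₂ Hess φ₂(x))`. -/
def Qform (φ : (Fin 2 → ℝ) → Fin 2 → ℝ) (x ζ : Fin 2 → ℝ) : ℝ :=
  (ζ 0 • Hess (fun y => φ y 0) x + ζ 1 • Hess (fun y => φ y 1) x).det

/-- `x` is an elliptic point for `φ`: `min_{ζ ∈ S¹} |Q_x(ζ)| > 0`. -/
def Elliptic (φ : (Fin 2 → ℝ) → Fin 2 → ℝ) (x : Fin 2 → ℝ) : Prop :=
  ∃ ε : ℝ, 0 < ε ∧ ∀ ζ : Fin 2 → ℝ, onS1 ζ → ε ≤ |Qform φ x ζ|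

/-- The symmetric matrix `K(x)` associated with the quadratic form `Q_x`,
i.e. the matrix with entries `k₁₁ = det Hess φ₁`, `k₂₂ = det Hess φ₂`,
`k₁₂ = k₂₁ = ½(∂₁₁φ₁ ∂₂₂φ₂ + ∂₂₂φ₁ ∂₁₁φ₂ − 2 ∂₁₂φ₁ ∂₁₂φ₂)`, which satisfies
`Q_x(ζ) = ⟨K(x)ζ, ζ⟩`. -/
def Kmat (φ : (Fin 2 → ℝ) → Fin 2 → ℝ) (x : Fin 2 → ℝ) : Matrix (Fin 2) (Fin 2) ℝ :=
  Matrix.of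
    ![![(Hess (fun y => φ y 0) x).det,
        ((Hess (fun y => φ y 0) x) 0 0 * (Hess (fun y => φ y 1) x) 1 1
          + (Hess (fun y => φ y 0) x) 1 1 * (Hess (fun y => φ y 1) x) 0 0
          - 2 * (Hess (fun y => φ y 0) x) 0 1 * (Hess (fun y => φ y 1) x) 0 1) / 2],
      ![((Hess (fun y => φ y 0) x) 0 0 * (Hess (fun y => φ y 1) x) 1 1
          + (Hess (fun y => φ y 0) x) 1 1 * (Hess (fun y => φ y 1) x) 0 0
          - 2 * (Hess (fun y => φ y 0) x) 0 1 * (Hess (fun y => φ y 1) x) 0 1) / 2,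
        (Hess (fun y => φ y 1) x).det]]

/-- The function `G(ζ,s) = ⟨φ(1,s), ζ⟩`. -/
def Gfun (φ : (Fin 2 → ℝ) → Fin 2 → ℝ) (ζ : Fin 2 → ℝ) (s : ℝ) : ℝ :=
  dot2 (φ ![1, s]) ζ

/-- The standard inner product on `ℝ⁴`. -/
def dot4 (u v : Fin 4 → ℝ) : ℝ := u 0 * v 0 + u 1 * v 1 + u 2 * v 2 + u 3 * v 3

/-- The graph map `x ↦ (x, φ(x)) ∈ ℝ⁴`. -/
def graphMap (φ : (Fin 2 → ℝ) → Fin 2 → ℝ) (x : Fin 2 → ℝ) : Fin 4 → ℝ :=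
  ![x 0, x 1, φ x 0, φ x 1]

/-- The Fourier transform on `ℝ⁴`, `ĝ(ξ) = ∫ e^{-i⟨x,ξ⟩} g(x) dx`. -/
def ftrans (g : (Fin 4 → ℝ) → ℂ) (ξ : Fin 4 → ℝ) : ℂ :=
  ∫ x : Fin 4 → ℝ, Complex.exp (-Complex.I * (dot4 x ξ : ℂ)) * g x

/-- The Fourier transform of the measure `μ`,
`μ̂(ξ) = ∫_{V₁^{c,d}} e^{-i⟨(x,φ(x)),ξ⟩} dx`. -/
def muHat (α₁ α₂ c d : ℝ) (φ : (Fin 2 → ℝ) → Fin 2 → ℝ) (ξ : Fin 4 → ℝ) : ℂ :=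
  ∫ x in V1 α₁ α₂ c d, Complex.exp (-Complex.I * (dot4 (graphMap φ x) ξ : ℂ))

/-- Convolution with the measure `μ`: `(μ ∗ g)(y) = ∫_{V₁^{c,d}} g(y − (x, φ(x))) dx`. -/
def muConv (α₁ α₂ c d : ℝ) (φ : (Fin 2 → ℝ) → Fin 2 → ℝ) (g : (Fin 4 → ℝ) → ℂ)
    (y : Fin 4 → ℝ) : ℂ :=
  ∫ x in V1 α₁ α₂ c d, g (y - graphMap φ x)


/-- The function `H(ζ,s)` of Remark 2.4 / Statement 19, built from `G(ζ,s) = ⟨φ(1,s),ζ⟩`. -/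
def Hfun (α₁ α₂ m : ℝ) (φ : (Fin 2 → ℝ) → Fin 2 → ℝ) (ζ : Fin 2 → ℝ) (s : ℝ) : ℝ :=
  m * (m - α₁) * Gfun φ ζ s * deriv (deriv (Gfun φ ζ)) s
    + α₂ * (α₁ - α₂) * s * deriv (Gfun φ ζ) s * deriv (deriv (Gfun φ ζ)) s
    - (m - α₂) ^ 2 * (deriv (Gfun φ ζ) s) ^ 2

/-- The first-derivative oscillatory integral estimate with monotone derivative. -/
lemma vdc_first {u v μ : ℝ} (huv : u ≤ v) (hμ : 0 < μ) {f f' f'' : ℝ → ℝ}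
    (h0 : ∀ x ∈ Icc u v, HasDerivAt f (f' x) x)
    (h1 : ∀ x ∈ Icc u v, HasDerivAt f' (f'' x) x)
    (h2 : ContinuousOn f'' (Icc u v))
    (hpos : ∀ x ∈ Icc u v, 0 ≤ f'' x) (hlow : ∀ x ∈ Icc u v, μ ≤ |f' x|) :
    ‖∫ x in u..v, Complex.exp (Complex.I * (f x : ℂ))‖ ≤ 4 * μ⁻¹ := by
  have hne : ∀ x ∈ Icc u v, f' x ≠ 0 := fun x hx h => by
    have := hlow x hx
    rw [h, abs_zero] at this
    linarith
  have hI : uIcc u v = Icc u v := uIcc_of_le huv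
  have hc0 : ContinuousOn f (Icc u v) := fun x hx => (h0 x hx).continuousAt.continuousWithinAt
  have hc1 : ContinuousOn f' (Icc u v) := fun x hx => (h1 x hx).continuousAt.continuousWithinAt
  have hinv : ∀ x ∈ Icc u v, HasDerivAt (fun x => (f' x)⁻¹) (-f'' x / f' x ^ 2) x :=
    fun x hx => (h1 x hx).inv (hne x hx)
  have hE : ∀ x ∈ Icc u v, HasDerivAt (fun x => Complex.exp (Complex.I * (f x : ℂ)))
      (Complex.exp (Complex.I * (f x : ℂ)) * (Complex.I * (f' x : ℂ))) x := fun x hx =>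
    (((h0 x hx).ofReal_comp).const_mul Complex.I).cexp
  have hcE : ContinuousOn (fun x => Complex.exp (Complex.I * (f x : ℂ))) (Icc u v) :=
    fun x hx => (hE x hx).continuousAt.continuousWithinAt
  have hcinv' : ContinuousOn (fun x => -f'' x / f' x ^ 2) (Icc u v) :=
    h2.neg.div (hc1.pow 2) fun x hx => pow_ne_zero 2 (hne x hx)
  have hibp := intervalIntegral.integral_mul_deriv_eq_deriv_mul
    (u := fun x => (((f' x)⁻¹ : ℝ) : ℂ)) (u' := fun x => ((-f'' x / f' x ^ 2 : ℝ) : ℂ))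
    (v := fun x => Complex.exp (Complex.I * (f x : ℂ)))
    (v' := fun x => Complex.exp (Complex.I * (f x : ℂ)) * (Complex.I * (f' x : ℂ)))
    (a := u) (b := v)
    (fun x hx => (hinv x (hI ▸ hx)).ofReal_comp) (fun x hx => hE x (hI ▸ hx))
    (ContinuousOn.intervalIntegrable (by
      rw [hI]; exact Complex.continuous_ofReal.comp_continuousOn hcinv'))
    (ContinuousOn.intervalIntegrable (by
      rw [hI]
      exact hcE.mul (continuousOn_const.mul (Complex.continuous_ofReal.comp_continuousOn hc1))))
  have hL : ∫ x in u..v, (((f' x)⁻¹ : ℝ) : ℂ) *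
      (Complex.exp (Complex.I * (f x : ℂ)) * (Complex.I * (f' x : ℂ)))
      = Complex.I * ∫ x in u..v, Complex.exp (Complex.I * (f x : ℂ)) := by
    rw [← intervalIntegral.integral_const_mul]
    apply intervalIntegral.integral_congr
    intro x hx
    have : (f' x : ℂ) ≠ 0 := by exact_mod_cast hne x (hI ▸ hx)
    push_cast
    field_simp
  have hnE : ∀ x, ‖Complex.exp (Complex.I * (f x : ℂ))‖ = 1 := fun x => by
    rw [mul_comm, Complex.norm_exp_ofReal_mul_I]
  have hb : ∀ x ∈ Icc u v, |(f' x)⁻¹| ≤ μ⁻¹ := fun x hx => by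
    rw [abs_inv]; exact inv_anti₀ hμ (hlow x hx)
  have hu := hb u ⟨le_rfl, huv⟩
  have hv := hb v ⟨huv, le_rfl⟩
  have hR : ‖∫ x in u..v, ((-f'' x / f' x ^ 2 : ℝ) : ℂ) * Complex.exp (Complex.I * (f x : ℂ))‖
      ≤ 2 * μ⁻¹ := by
    calc _ ≤ ∫ x in u..v, -(-f'' x / f' x ^ 2) := by
            apply intervalIntegral.norm_integral_le_of_norm_le huv
            · refine Filter.Eventually.of_forall fun x hx => ?_
              have hx' : x ∈ Icc u v := Ioc_subset_Icc_self hx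
              rw [norm_mul, hnE, mul_one, Complex.norm_real, Real.norm_eq_abs, abs_of_nonpos]
              have := div_nonneg (hpos x hx') (sq_nonneg (f' x))
              rw [neg_div]; linarith
            · exact ContinuousOn.intervalIntegrable (by rw [hI]; exact hcinv'.neg)
      _ = (f' u)⁻¹ - (f' v)⁻¹ := by
            rw [intervalIntegral.integral_neg,
              intervalIntegral.integral_eq_sub_of_hasDerivAt (fun x hx => hinv x (hI ▸ hx))
                (ContinuousOn.intervalIntegrable (by rw [hI]; exact hcinv'))]
            ring
      _ ≤ 2 * μ⁻¹ := by
            have := le_abs_self (f' u)⁻¹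
            have := neg_abs_le (f' v)⁻¹
            linarith
  have hmain : ‖Complex.I * ∫ x in u..v, Complex.exp (Complex.I * (f x : ℂ))‖ ≤ 4 * μ⁻¹ := by
    rw [← hL, hibp]
    refine (norm_sub_le _ _).trans ?_
    have : ‖(((f' v)⁻¹ : ℝ) : ℂ) * Complex.exp (Complex.I * (f v : ℂ))
        - (((f' u)⁻¹ : ℝ) : ℂ) * Complex.exp (Complex.I * (f u : ℂ))‖ ≤ 2 * μ⁻¹ := by
      refine (norm_sub_le _ _).trans ?_
      rw [norm_mul, norm_mul, hnE, hnE, Complex.norm_real, Complex.norm_real, Real.norm_eq_abs,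
        Real.norm_eq_abs]
      linarith
    linarith
  simpa using hmain

lemma vdc_zero {u v μ : ℝ} (huv : u ≤ v) {g g' : ℝ → ℝ}
    (h : ∀ x ∈ Icc u v, HasDerivAt g (g' x) x) (hlow : ∀ x ∈ Icc u v, μ ≤ g' x) :
    ∃ z ∈ Icc u v, (∀ x ∈ Ioc z v, μ * (x - z) ≤ g x) ∧
      ∀ x ∈ Ico u z, g x ≤ -(μ * (z - x)) := by
  have hcont : ContinuousOn g (Icc u v) := fun x hx => (h x hx).continuousAt.continuousWithinAt
  have hmv : ∀ x ∈ Icc u v, ∀ y ∈ Icc u v, x ≤ y → μ * (y - x) ≤ g y - g x := by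
    intro x hx y hy hxy
    refine (convex_Icc u v).mul_sub_le_image_sub_of_le_deriv hcont ?_ ?_ x hx y hy hxy
    · intro z hz
      exact (h z (interior_subset hz)).differentiableAt.differentiableWithinAt
    · intro z hz
      rw [(h z (interior_subset hz)).deriv]
      exact hlow z (interior_subset hz)
  have hex : ∃ z ∈ Icc u v, (z < v → 0 ≤ g z) ∧ (u < z → g z ≤ 0) := by
    rcases le_or_gt 0 (g u) with hu | hu
    · exact ⟨u, ⟨le_rfl, huv⟩, fun _ => hu, fun h => absurd h (lt_irrefl _)⟩
    · rcases le_or_gt (g v) 0 with hv | hv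
      · exact ⟨v, ⟨huv, le_rfl⟩, fun h => absurd h (lt_irrefl _), fun _ => hv⟩
      · obtain ⟨z, hz, hz0⟩ := intermediate_value_Icc huv hcont ⟨hu.le, hv.le⟩
        exact ⟨z, hz, fun _ => hz0.ge, fun _ => hz0.le⟩
  obtain ⟨z, hz, hz1, hz2⟩ := hex
  refine ⟨z, hz, fun x hx => ?_, fun x hx => ?_⟩
  · have := hmv z hz x ⟨hz.1.trans hx.1.le, hx.2⟩ hx.1.le
    have := hz1 (hx.1.trans_le hx.2)
    linarith
  · have := hmv x ⟨hx.1, hx.2.le.trans hz.2⟩ z hz hx.2.le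
    have := hz2 (hx.1.trans_lt hx.2)
    linarith

/-- The bound in the van der Corput lemma of order `N` with constant `C`. For `N = 1` the second
derivative is required to be nonnegative. -/
def VdcBound (N : ℕ) (C : ℝ) : Prop :=
  ∀ (u v μ : ℝ) (f : ℕ → ℝ → ℝ), u ≤ v → 0 < μ →
    (∀ i, ∀ x ∈ Icc u v, HasDerivAt (f i) (f (i + 1) x) x) →
    (N = 1 → ∀ x ∈ Icc u v, 0 ≤ f 2 x) → (∀ x ∈ Icc u v, μ ≤ |f N x|) →
    ‖∫ x in u..v, Complex.exp (Complex.I * (f 0 x : ℂ))‖ ≤ C * μ ^ (-(1 / N : ℝ))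

lemma norm_integral_exp_neg (u v : ℝ) (f : ℝ → ℝ) :
    ‖∫ x in u..v, Complex.exp (Complex.I * ((-f x : ℝ) : ℂ))‖
      = ‖∫ x in u..v, Complex.exp (Complex.I * (f x : ℂ))‖ := by
  rw [← RCLike.norm_conj, ← intervalIntegral.intervalIntegral_conj]
  congr 2
  ext x
  rw [← Complex.exp_conj]
  simp

lemma vdcBound_one : VdcBound 1 4 := by
  intro u v μ f huv hμ hf h2 hlow
  have := vdc_first huv hμ (hf 0) (hf 1)
    (fun x hx => (hf 2 x hx).continuousAt.continuousWithinAt) (h2 rfl) hlow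
  simpa [Real.rpow_neg_one] using this

lemma VdcBound.succ {N : ℕ} (hN : 1 ≤ N) {C : ℝ} (hC : 0 ≤ C) (h : VdcBound N C) :
    VdcBound (N + 1) (2 * C + 2) := by
  have key : ∀ (u v μ : ℝ) (f : ℕ → ℝ → ℝ), u ≤ v → 0 < μ →
      (∀ i, ∀ x ∈ Icc u v, HasDerivAt (f i) (f (i + 1) x) x) →
      (∀ x ∈ Icc u v, μ ≤ f (N + 1) x) →
      ‖∫ x in u..v, Complex.exp (Complex.I * (f 0 x : ℂ))‖
        ≤ (2 * C + 2) * μ ^ (-(1 / (N + 1 : ℕ) : ℝ)) := by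
    intro u v μ f huv hμ hf hlow
    obtain ⟨z, hz, hr, hl⟩ := vdc_zero huv (hf N) hlow
    set δ : ℝ := μ ^ ((N : ℝ) / (N + 1)) with hδ
    have hδ0 : 0 < δ := Real.rpow_pos_of_pos hμ _
    have hN0 : (0 : ℝ) < N := by exact_mod_cast hN
    have hδC : δ ^ (-(1 / N : ℝ)) = μ ^ (-(1 / (N + 1 : ℕ) : ℝ)) := by
      rw [hδ, ← Real.rpow_mul hμ.le]
      congr 1
      push_cast
      field_simp
    have hδμ : δ / μ = μ ^ (-(1 / (N + 1 : ℕ) : ℝ)) := by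
      rw [hδ, ← Real.rpow_sub_one hμ.ne']
      congr 1
      push_cast
      field_simp
      ring
    have hsign : ∀ x ∈ Icc u v, N = 1 → 0 ≤ f 2 x := by
      rintro x hx rfl
      exact hμ.le.trans (hlow x hx)
    set B := μ ^ (-(1 / (N + 1 : ℕ) : ℝ)) with hB
    have hB0 : 0 < B := Real.rpow_pos_of_pos hμ _
    have hdm : 0 < δ / μ := by positivity
    have hcE : ContinuousOn (fun x => Complex.exp (Complex.I * (f 0 x : ℂ))) (Icc u v) :=
      fun x hx => ((((hf 0 x hx).ofReal_comp).const_mul Complex.I).cexp).continuousAt.continuousWithinAt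
    have hintg : ∀ a ∈ Icc u v, ∀ b ∈ Icc u v, IntervalIntegrable
        (fun x => Complex.exp (Complex.I * (f 0 x : ℂ))) volume a b := fun a ha b hb =>
      (hcE.mono (uIcc_subset_Icc ha hb)).intervalIntegrable
    set p := max u (z - δ / μ) with hp
    set q := min v (z + δ / μ) with hq
    have hpm : p ∈ Icc u v := ⟨le_max_left _ _, max_le huv (by linarith [hz.2])⟩
    have hqm : q ∈ Icc u v := ⟨le_min huv (by linarith [hz.1]), min_le_left _ _⟩
    have hpz : p ≤ z := max_le hz.1 (by linarith)
    have hqz : z ≤ q := le_min hz.2 (by linarith)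
    have h1 : ‖∫ x in u..p, Complex.exp (Complex.I * (f 0 x : ℂ))‖ ≤ C * B := by
      rcases le_total (z - δ / μ) u with hc | hc
      · rw [hp, max_eq_left hc, intervalIntegral.integral_same, norm_zero]
        positivity
      · rw [← hδC]
        have hsub : Icc u p ⊆ Icc u v := Icc_subset_Icc_right hpm.2
        refine h u p δ f hpm.1 hδ0 (fun i x hx => hf i x (hsub hx))
          (fun h1 x hx => hsign x (hsub hx) h1) (fun x hx => ?_)
        have hxp : x ≤ z - δ / μ := by have := hx.2; rwa [hp, max_eq_right hc] at this
        have := hl x ⟨hx.1, by linarith⟩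
        have h3 : δ ≤ μ * (z - x) := by
          rw [← div_le_iff₀' hμ]; linarith
        rw [abs_of_nonpos (by linarith)]
        linarith
    have h2 : ‖∫ x in q..v, Complex.exp (Complex.I * (f 0 x : ℂ))‖ ≤ C * B := by
      rcases le_total v (z + δ / μ) with hc | hc
      · rw [hq, min_eq_left hc, intervalIntegral.integral_same, norm_zero]
        positivity
      · rw [← hδC]
        have hsub : Icc q v ⊆ Icc u v := Icc_subset_Icc_left hqm.1
        refine h q v δ f hqm.2 hδ0 (fun i x hx => hf i x (hsub hx))
          (fun h1 x hx => hsign x (hsub hx) h1) (fun x hx => ?_)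
        have hxp : z + δ / μ ≤ x := by have := hx.1; rwa [hq, min_eq_right hc] at this
        have := hr x ⟨by linarith, hx.2⟩
        have h3 : δ ≤ μ * (x - z) := by
          rw [← div_le_iff₀' hμ]; linarith
        rw [abs_of_nonneg (by linarith)]
        linarith
    have h3 : ‖∫ x in p..q, Complex.exp (Complex.I * (f 0 x : ℂ))‖ ≤ 2 * B := by
      have := intervalIntegral.norm_integral_le_of_norm_le_const (a := p) (b := q) (C := 1)
        (f := fun x => Complex.exp (Complex.I * (f 0 x : ℂ))) (fun x _ => by
          rw [mul_comm, Complex.norm_exp_ofReal_mul_I])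
      refine this.trans ?_
      rw [abs_of_nonneg (by linarith), one_mul, ← hδμ]
      have : q ≤ z + δ / μ := min_le_right _ _
      have : z - δ / μ ≤ p := le_max_right _ _
      linarith
    have hu : u ∈ Icc u v := ⟨le_rfl, huv⟩
    have hv : v ∈ Icc u v := ⟨huv, le_rfl⟩
    rw [← intervalIntegral.integral_add_adjacent_intervals (hintg u hu q hqm) (hintg q hqm v hv),
      ← intervalIntegral.integral_add_adjacent_intervals (hintg u hu p hpm) (hintg p hpm q hqm)]
    refine (norm_add_le _ _).trans ?_
    have := norm_add_le (∫ x in u..p, Complex.exp (Complex.I * (f 0 x : ℂ)))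
      (∫ x in p..q, Complex.exp (Complex.I * (f 0 x : ℂ)))
    linarith
  intro u v μ f huv hμ hf _ hlow
  have hcont : ContinuousOn (f (N + 1)) (Icc u v) :=
    fun x hx => (hf (N + 1) x hx).continuousAt.continuousWithinAt
  have hne : ∀ x ∈ Icc u v, f (N + 1) x ≠ 0 := fun x hx h0 => by
    have := hlow x hx
    rw [h0, abs_zero] at this
    linarith
  have hu : u ∈ Icc u v := ⟨le_rfl, huv⟩
  rcases lt_or_gt_of_ne (hne u hu) with hneg | hpos
  · have hall : ∀ x ∈ Icc u v, f (N + 1) x < 0 := by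
      intro x hx
      by_contra hx0
      push Not at hx0
      obtain ⟨y, hy, hy0⟩ := intermediate_value_Icc hx.1
        (hcont.mono (Icc_subset_Icc_right hx.2)) ⟨hneg.le, hx0⟩
      exact hne y ⟨hy.1, hy.2.trans hx.2⟩ hy0
    rw [← norm_integral_exp_neg]
    refine key u v μ (fun i x => -f i x) huv hμ (fun i x hx => (hf i x hx).neg) (fun x hx => ?_)
    have := hlow x hx
    rwa [abs_of_neg (hall x hx)] at this
  · have hall : ∀ x ∈ Icc u v, 0 < f (N + 1) x := by
      intro x hx
      by_contra hx0
      push Not at hx0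
      obtain ⟨y, hy, hy0⟩ := intermediate_value_Icc' hx.1
        (hcont.mono (Icc_subset_Icc_right hx.2)) ⟨hx0, hpos.le⟩
      exact hne y ⟨hy.1, hy.2.trans hx.2⟩ hy0
    refine key u v μ f huv hμ hf (fun x hx => ?_)
    have := hlow x hx
    rwa [abs_of_pos (hall x hx)] at this

lemma exists_vdcBound {N : ℕ} (hN : 1 ≤ N) : ∃ C, 0 ≤ C ∧ VdcBound N C := by
  induction N, hN using Nat.le_induction with
  | base => exact ⟨4, by norm_num, vdcBound_one⟩
  | succ n hn ih =>
    obtain ⟨C, hC, h⟩ := ih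
    exact ⟨2 * C + 2, by positivity, h.succ hn hC⟩

/-- The van der Corput lemma on a bounded interval that need not be closed. -/
lemma exists_vdc_ordConnected {N : ℕ} (hN : 2 ≤ N) : ∃ C, 0 ≤ C ∧
    ∀ (S : Set ℝ) (μ : ℝ) (f : ℕ → ℝ → ℝ), S.OrdConnected → Bornology.IsBounded S → 0 < μ →
      (∀ i, ∀ x ∈ S, HasDerivAt (f i) (f (i + 1) x) x) → (∀ x ∈ S, μ ≤ |f N x|) →
      ‖∫ x in S, Complex.exp (Complex.I * (f 0 x : ℂ))‖ ≤ C * μ ^ (-(1 / N : ℝ)) := by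
  obtain ⟨C, hC, h⟩ := exists_vdcBound (N := N) (by omega)
  refine ⟨C, hC, fun S μ f hS hb hμ hf hlow => ?_⟩
  rcases S.eq_empty_or_nonempty with rfl | hne
  · simpa using mul_nonneg hC (Real.rpow_nonneg hμ.le _)
  have hSm : MeasurableSet S := hS.measurableSet
  set F : ℝ → ℂ := S.indicator fun x => Complex.exp (Complex.I * (f 0 x : ℂ)) with hF
  have hsub : S ⊆ Icc (sInf S) (sSup S) :=
    fun x hx => ⟨csInf_le hb.bddBelow hx, le_csSup hb.bddAbove hx⟩
  have hFi : Integrable F := by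
    rw [hF, integrable_indicator_iff hSm]
    refine IntegrableOn.of_bound (lt_of_le_of_lt (measure_mono hsub) (by simp)) ?_ 1 ?_
    · have : ContinuousOn (fun x => Complex.exp (Complex.I * (f 0 x : ℂ))) S := fun x hx =>
        ((((hf 0 x hx).ofReal_comp).const_mul Complex.I).cexp).continuousAt.continuousWithinAt
      exact this.aestronglyMeasurable hSm
    · exact Filter.Eventually.of_forall fun x => by rw [mul_comm, Complex.norm_exp_ofReal_mul_I]
  have hle : ∀ u ∈ S, ∀ v ∈ S, u ≤ v → ‖∫ x in u..v, F x‖ ≤ C * μ ^ (-(1 / N : ℝ)) := by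
    intro u hu v hv huv
    have hs : Icc u v ⊆ S := hS.out hu hv
    have : ∫ x in u..v, F x = ∫ x in u..v, Complex.exp (Complex.I * (f 0 x : ℂ)) := by
      apply intervalIntegral.integral_congr
      intro x hx
      rw [uIcc_of_le huv] at hx
      exact indicator_of_mem (hs hx) _
    rw [this]
    exact h u v μ f huv hμ (fun i x hx => hf i x (hs hx)) (fun h1 => by omega)
      (fun x hx => hlow x (hs hx))
  have hle' : ∀ u ∈ S, ∀ v ∈ S, ‖∫ x in u..v, F x‖ ≤ C * μ ^ (-(1 / N : ℝ)) := by
    intro u hu v hv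
    rcases le_total u v with huv | huv
    · exact hle u hu v hv huv
    · rw [intervalIntegral.integral_symm, norm_neg]
      exact hle v hv u hu huv
  have hcont : Continuous fun w : ℝ × ℝ => ‖∫ x in w.1..w.2, F x‖ := by
    have h0 : Continuous fun y : ℝ => ∫ x in (0:ℝ)..y, F x :=
      intervalIntegral.continuous_primitive (fun a b => hFi.intervalIntegrable) 0
    have : (fun w : ℝ × ℝ => ‖∫ x in w.1..w.2, F x‖)
        = fun w => ‖(∫ x in (0:ℝ)..w.2, F x) - ∫ x in (0:ℝ)..w.1, F x‖ := by
      ext w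
      rw [intervalIntegral.integral_interval_sub_left hFi.intervalIntegrable
        hFi.intervalIntegrable]
    rw [this]
    fun_prop
  have hcl : (sInf S, sSup S) ∈ closure (S ×ˢ S) := by
    rw [closure_prod_eq]
    exact ⟨csInf_mem_closure hne hb.bddBelow, csSup_mem_closure hne hb.bddAbove⟩
  have hfin : ‖∫ x in sInf S..sSup S, F x‖ ≤ C * μ ^ (-(1 / N : ℝ)) :=
    closure_minimal (s := S ×ˢ S)
      (t := {w : ℝ × ℝ | ‖∫ x in w.1..w.2, F x‖ ≤ C * μ ^ (-(1 / N : ℝ))})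
      (fun w hw => hle' w.1 hw.1 w.2 hw.2) (isClosed_le hcont continuous_const) hcl
  rw [intervalIntegral.integral_of_le ((hsub hne.some_mem).1.trans (hsub hne.some_mem).2),
    ← integral_Icc_eq_integral_Ioc, hF, setIntegral_indicator hSm,
    inter_eq_self_of_subset_right hsub] at hfin
  exact hfin

lemma lintegral_ofReal_norm_fin_two {f : ℝ → ℝ} (hf : ∀ y, 0 < y → 0 ≤ f y) (h0 : 0 ≤ f 0)
    (hi : IntegrableOn (fun y => y * f y) (Ioi 0)) :
    ∫⁻ x : Fin 2 → ℝ, ENNReal.ofReal (f ‖x‖) = ENNReal.ofReal (8 * ∫ y in Ioi (0 : ℝ), y * f y) := by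
  have hintg : Integrable (fun x : Fin 2 → ℝ => f ‖x‖) := by
    rw [integrable_fun_norm_addHaar volume]
    simpa using hi
  have hnn : ∀ y, 0 ≤ y → 0 ≤ f y := fun y hy => hy.eq_or_lt.elim (fun h => h ▸ h0) (hf y)
  rw [← ofReal_integral_eq_lintegral_ofReal hintg
    (Filter.Eventually.of_forall fun x => hnn _ (norm_nonneg _)), integral_fun_norm_addHaar volume]
  congr 1
  have : volume.real (Metric.ball (0 : Fin 2 → ℝ) 1) = 4 := by
    rw [Measure.real, Real.volume_pi_ball _ one_pos]
    norm_num
  simp [this]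
  ring

lemma lintegral_ball_norm_rpow {l : ℝ} (hl : l < 2) : ∃ K : ℝ, 0 ≤ K ∧ ∀ R : ℝ, 0 < R →
    ∫⁻ x : Fin 2 → ℝ, ENNReal.ofReal ((Iic R).indicator (fun r => r ^ (-l)) ‖x‖)
      ≤ ENNReal.ofReal (K * R ^ (2 - l)) := by
  refine ⟨8 / (2 - l), div_nonneg (by norm_num) (by linarith), fun R hR => ?_⟩
  have e : ∀ y ∈ Ioi (0 : ℝ), y * (Iic R).indicator (fun r => r ^ (-l)) y
      = (Iic R).indicator (fun r => r ^ (1 - l)) y := by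
    intro y hy
    by_cases h : y ∈ Iic R
    · rw [indicator_of_mem h, indicator_of_mem h, sub_eq_add_neg, Real.rpow_add hy, Real.rpow_one]
    · simp [indicator_of_notMem h]
  have hI : IntegrableOn (fun r : ℝ => r ^ (1 - l)) (Ioc 0 R) := by
    have := intervalIntegral.intervalIntegrable_rpow' (a := 0) (b := R) (r := 1 - l) (by linarith)
    rw [intervalIntegrable_iff_integrableOn_Ioc_of_le hR.le] at this
    exact this
  rw [lintegral_ofReal_norm_fin_two]
  · apply ENNReal.ofReal_le_ofReal
    rw [setIntegral_congr_fun measurableSet_Ioi e, setIntegral_indicator measurableSet_Iic,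
      Ioi_inter_Iic, ← intervalIntegral.integral_of_le hR.le,
      integral_rpow (Or.inl (by linarith)), Real.zero_rpow (by linarith)]
    have : 1 - l + 1 = 2 - l := by ring
    rw [this]
    apply le_of_eq
    ring
  · intro y hy
    exact indicator_apply_nonneg fun _ => Real.rpow_nonneg hy.le _
  · exact indicator_apply_nonneg fun _ => Real.rpow_nonneg le_rfl _
  · rw [integrableOn_congr_fun e measurableSet_Ioi, IntegrableOn,
      integrable_indicator_iff measurableSet_Iic, IntegrableOn, Measure.restrict_restrict measurableSet_Iic, inter_comm, Ioi_inter_Iic]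
    exact hI

lemma lintegral_compl_ball_norm_rpow : ∀ R : ℝ, 0 < R →
    ∫⁻ x : Fin 2 → ℝ, ENNReal.ofReal ((Ioi R).indicator (fun r => r ^ (-4 : ℝ)) ‖x‖)
      ≤ ENNReal.ofReal (4 * R ^ (-2 : ℝ)) := by
  intro R hR
  have e : ∀ y ∈ Ioi (0 : ℝ), y * (Ioi R).indicator (fun r => r ^ (-4 : ℝ)) y
      = (Ioi R).indicator (fun r => r ^ (-3 : ℝ)) y := by
    intro y hy
    by_cases h : y ∈ Ioi R
    · rw [indicator_of_mem h, indicator_of_mem h, show (-3 : ℝ) = 1 + -4 by norm_num,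
        Real.rpow_add hy, Real.rpow_one]
    · simp [indicator_of_notMem h]
  have hs : Ioi (0 : ℝ) ∩ Ioi R = Ioi R := by
    rw [Ioi_inter_Ioi, max_eq_right hR.le]
  rw [lintegral_ofReal_norm_fin_two]
  · apply ENNReal.ofReal_le_ofReal
    rw [setIntegral_congr_fun measurableSet_Ioi e, setIntegral_indicator measurableSet_Ioi, hs,
      integral_Ioi_rpow_of_lt (by norm_num) hR]
    apply le_of_eq
    norm_num
    ring
  · intro y hy
    exact indicator_apply_nonneg fun _ => by positivity
  · exact indicator_apply_nonneg fun _ => by positivity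
  · rw [integrableOn_congr_fun e measurableSet_Ioi, IntegrableOn,
      integrable_indicator_iff measurableSet_Ioi, IntegrableOn, Measure.restrict_restrict measurableSet_Ioi, inter_comm, hs]
    exact integrableOn_Ioi_rpow_of_lt (by norm_num) hR

lemma hls_inner {p : ℝ} (hp1 : 1 < p) (hp2 : p < 2) : ∃ K : ℝ, 0 ≤ K ∧
    ∀ (F : (Fin 2 → ℝ) → ℝ≥0∞) (P t : ℝ), Measurable F → 0 < P → 0 < t →
      ∫⁻ z, F z ^ p = ENNReal.ofReal P → ∀ y,
      ∫⁻ z in {z | F z ≤ ENNReal.ofReal t}, F z * ENNReal.ofReal (‖y - z‖ ^ (-(4 * (1 - 1 / p))))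
        ≤ ENNReal.ofReal (K * (P ^ (2 / p - 1) * t ^ (p - 1))) := by
  have hp0 : 0 < p := by linarith
  have hl : 4 * (1 - 1 / p) < 2 := by
    have : 1 / 2 < 1 / p := one_div_lt_one_div_of_lt hp0 hp2
    linarith
  obtain ⟨K1, hK1, h1⟩ := lintegral_ball_norm_rpow hl
  set l := 4 * (1 - 1 / p) with hldef
  set q := p / (p - 1) with hq
  have hpq : p.HolderConjugate q := Real.HolderConjugate.conjExponent hp1
  refine ⟨K1 + 4 ^ (1 / q), by positivity, fun F P t hF hP ht hFP y => ?_⟩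
  set R := P ^ (1 / 2 : ℝ) * t ^ (-(p / 2)) with hR
  have hR0 : 0 < R := by positivity
  have hk : Measurable fun z : Fin 2 → ℝ => ‖y - z‖ := by fun_prop
  have hsplit : ∫⁻ z in {z | F z ≤ ENNReal.ofReal t}, F z * ENNReal.ofReal (‖y - z‖ ^ (-l))
      ≤ ∫⁻ z, (ENNReal.ofReal t * ENNReal.ofReal ((Iic R).indicator (fun r => r ^ (-l)) ‖y - z‖)
        + F z * ENNReal.ofReal ((Ioi R).indicator (fun r => r ^ (-l)) ‖y - z‖)) := by
    rw [← lintegral_indicator (measurableSet_le hF measurable_const)]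
    refine lintegral_mono fun z => ?_
    by_cases hz : F z ≤ ENNReal.ofReal t
    · rw [indicator_of_mem (show z ∈ {z | F z ≤ ENNReal.ofReal t} from hz)]
      rcases le_or_gt ‖y - z‖ R with h | h
      · rw [indicator_of_mem (show ‖y - z‖ ∈ Iic R from h)]
        exact le_add_right (mul_le_mul_left hz _)
      · rw [indicator_of_mem (show ‖y - z‖ ∈ Ioi R from h)]
        exact le_add_left le_rfl
    · rw [indicator_of_notMem (show z ∉ {z | F z ≤ ENNReal.ofReal t} from hz)]
      exact zero_le
  have hm : ∀ S : Set ℝ, MeasurableSet S → Measurable fun z : Fin 2 → ℝ =>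
      ENNReal.ofReal (S.indicator (fun r => r ^ (-l)) ‖z‖) := fun S hS =>
    (((Measurable.pow_const measurable_id (-l)).indicator hS).comp measurable_norm).ennreal_ofReal
  have hm' : ∀ S : Set ℝ, MeasurableSet S → Measurable fun z : Fin 2 → ℝ =>
      ENNReal.ofReal (S.indicator (fun r => r ^ (-l)) ‖y - z‖) := fun S hS =>
    (hm S hS).comp (measurable_const.sub measurable_id)
  refine hsplit.trans ?_
  rw [lintegral_add_left ((hm' _ measurableSet_Iic).const_mul _),
    lintegral_const_mul _ (hm' _ measurableSet_Iic)]
  have hA : ∫⁻ z, ENNReal.ofReal ((Iic R).indicator (fun r => r ^ (-l)) ‖y - z‖)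
      ≤ ENNReal.ofReal (K1 * R ^ (2 - l)) := by
    rw [lintegral_sub_left_eq_self
      (fun z : Fin 2 → ℝ => ENNReal.ofReal ((Iic R).indicator (fun r => r ^ (-l)) ‖z‖)) y]
    exact h1 R hR0
  have hB : ∫⁻ z, F z * ENNReal.ofReal ((Ioi R).indicator (fun r => r ^ (-l)) ‖y - z‖)
      ≤ ENNReal.ofReal P ^ (1 / p) * ENNReal.ofReal (4 * R ^ (-2 : ℝ)) ^ (1 / q) := by
    refine (ENNReal.lintegral_mul_le_Lp_mul_Lq volume hpq hF.aemeasurable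
      (hm' _ measurableSet_Ioi).aemeasurable).trans ?_
    rw [hFP]
    refine mul_le_mul_right (ENNReal.rpow_le_rpow ?_ hpq.symm.one_div_nonneg) _
    refine le_trans (le_of_eq ?_) (lintegral_compl_ball_norm_rpow R hR0)
    rw [← lintegral_sub_left_eq_self
      (fun z : Fin 2 → ℝ => ENNReal.ofReal ((Ioi R).indicator (fun r => r ^ (-4 : ℝ)) ‖z‖)) y]
    refine lintegral_congr fun z => ?_
    by_cases h : ‖y - z‖ ∈ Ioi R
    · rw [indicator_of_mem h, indicator_of_mem h, ENNReal.ofReal_rpow_of_nonneg (by positivity)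
        hpq.symm.nonneg, ← Real.rpow_mul (norm_nonneg _)]
      congr 2
      rw [hq, hldef]
      have : p - 1 ≠ 0 := by linarith
      field_simp
    · rw [indicator_of_notMem h, indicator_of_notMem h, ENNReal.ofReal_zero,
        ENNReal.zero_rpow_of_pos hpq.symm.pos]
  have hq1 : 1 / q = 1 - 1 / p := by
    have : p - 1 ≠ 0 := by linarith
    rw [hq]
    field_simp
  refine (add_le_add (mul_le_mul_right hA _) hB).trans ?_
  rw [ENNReal.ofReal_rpow_of_nonneg hP.le (by positivity),
    ENNReal.ofReal_rpow_of_nonneg (by positivity) hpq.symm.one_div_nonneg,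
    ← ENNReal.ofReal_mul ht.le, ← ENNReal.ofReal_mul (by positivity),
    ← ENNReal.ofReal_add (by positivity) (by positivity)]
  apply ENNReal.ofReal_le_ofReal
  apply le_of_eq
  have e1 : t * R ^ (2 - l) = P ^ (2 / p - 1) * t ^ (p - 1) := by
    rw [hR, Real.mul_rpow (by positivity) (by positivity), ← Real.rpow_mul hP.le,
      ← Real.rpow_mul ht.le, mul_left_comm]
    congr 1
    · congr 1
      rw [hldef]; ring
    · nth_rewrite 1 [← Real.rpow_one t]
      rw [← Real.rpow_add ht]
      congr 1
      rw [hldef]; field_simp; ring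
  have e2 : P ^ (1 / p) * (R ^ (-2 : ℝ)) ^ (1 / q) = P ^ (2 / p - 1) * t ^ (p - 1) := by
    rw [hR, ← Real.rpow_mul (by positivity), Real.mul_rpow (by positivity) (by positivity),
      ← Real.rpow_mul hP.le, ← Real.rpow_mul ht.le, ← mul_assoc, ← Real.rpow_add hP, hq1]
    congr 2
    · field_simp; ring
    · field_simp
  have e3 : P ^ (1 / p) * (4 * R ^ (-2 : ℝ)) ^ (1 / q)
      = 4 ^ (1 / q) * (P ^ (2 / p - 1) * t ^ (p - 1)) := by
    rw [← e2, Real.mul_rpow (by norm_num) (by positivity)]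
    ring
  rw [e3, mul_left_comm, e1]
  ring

lemma ENNReal.mul_ofReal_mul_rpow_sub_one {x : ℝ≥0∞} (h0 : x ≠ 0) (hT : x ≠ ∞) {A p : ℝ}
    (hA : 0 ≤ A) : x * ENNReal.ofReal (A * x.toReal ^ (p - 1)) = ENNReal.ofReal A * x ^ p := by
  have ht := ENNReal.toReal_pos h0 hT
  obtain ⟨t, rfl⟩ : ∃ t, ENNReal.ofReal t = x := ⟨_, ENNReal.ofReal_toReal hT⟩
  have ht' : 0 < t := by
    by_contra h
    exact h0 (ENNReal.ofReal_eq_zero.2 (not_lt.1 h))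
  rw [ENNReal.toReal_ofReal ht'.le, ENNReal.ofReal_rpow_of_pos ht', ← ENNReal.ofReal_mul ht'.le,
    ← ENNReal.ofReal_mul hA]
  congr 1
  rw [Real.rpow_sub_one ht'.ne']
  field_simp

/-- The diagonal Hardy–Littlewood–Sobolev inequality on `ℝ²`. -/
lemma hls_fin_two {p : ℝ} (hp1 : 1 < p) (hp2 : p < 2) : ∃ K : ℝ, 0 < K ∧
    ∀ F : (Fin 2 → ℝ) → ℝ≥0∞, Measurable F →
      ∫⁻ y, ∫⁻ z, F y * F z * ENNReal.ofReal (‖y - z‖ ^ (-(4 * (1 - 1 / p))))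
        ≤ ENNReal.ofReal K * (∫⁻ z, F z ^ p) ^ (2 / p) := by
  obtain ⟨K, hK, h⟩ := hls_inner hp1 hp2
  have hp0 : 0 < p := by linarith
  obtain ⟨k, hk⟩ : ∃ k : (Fin 2 → ℝ) → (Fin 2 → ℝ) → ℝ≥0∞,
    k = fun y z => ENNReal.ofReal (‖y - z‖ ^ (-(4 * (1 - 1 / p)))) := ⟨_, rfl⟩
  have hkm : Measurable (Function.uncurry k) := by
    rw [hk]
    apply Measurable.ennreal_ofReal
    exact ((measurable_fst.sub measurable_snd).norm).pow_const _
  have hks : ∀ y, Measurable (k y) := fun y => hkm.comp measurable_prodMk_left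
  refine ⟨2 * K + 1, by positivity, fun F hF => ?_⟩
  have hkk : ∀ y z, ENNReal.ofReal (‖y - z‖ ^ (-(4 * (1 - 1 / p)))) = k y z := fun y z => by rw [hk]
  simp only [hkk] at h ⊢
  by_cases h0 : ∫⁻ z, F z ^ p = 0
  · have hF0 : F =ᵐ[volume] 0 := by
      rw [lintegral_eq_zero_iff (hF.pow_const p)] at h0
      filter_upwards [h0] with z hz
      simpa [hp0, not_lt.2 hp0.le] using hz
    have : ∫⁻ y, ∫⁻ z, F y * F z * k y z = 0 := by
      rw [lintegral_congr_ae (g := fun _ => 0), lintegral_zero]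
      filter_upwards [hF0] with y hy
      simp [hy]
    rw [this]
    exact zero_le
  by_cases hT : ∫⁻ z, F z ^ p = ∞
  · rw [hT, ENNReal.top_rpow_of_pos (by positivity), ENNReal.mul_top]
    · exact le_top
    · simp; positivity
  obtain ⟨P, hP, hFP⟩ : ∃ P : ℝ, 0 < P ∧ ∫⁻ z, F z ^ p = ENNReal.ofReal P :=
    ⟨_, ENNReal.toReal_pos h0 hT, (ENNReal.ofReal_toReal hT).symm⟩
  have hfin : ∀ᵐ y, F y < ∞ := by
    filter_upwards [ae_lt_top (hF.pow_const p) hT] with y hy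
    exact (ENNReal.rpow_lt_top_iff_of_pos hp0).1 hy
  obtain ⟨W, hW⟩ : ∃ W : (Fin 2 → ℝ) → (Fin 2 → ℝ) → ℝ≥0∞, W = fun y z =>
    {z | F z ≤ F y}.indicator (fun z => F y * F z * k y z) z := ⟨_, rfl⟩
  have hWm : Measurable (Function.uncurry W) := by
    have : Function.uncurry W = {q : (Fin 2 → ℝ) × (Fin 2 → ℝ) | F q.2 ≤ F q.1}.indicator
        (fun q => F q.1 * F q.2 * k q.1 q.2) := by
      ext ⟨y, z⟩
      simp [hW, Function.uncurry, indicator]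
    rw [this]
    refine Measurable.indicator ?_ (measurableSet_le (hF.comp measurable_snd) (hF.comp measurable_fst))
    exact ((hF.comp measurable_fst).mul (hF.comp measurable_snd)).mul hkm
  have hpt : ∀ y z, F y * F z * k y z ≤ W y z + W z y := by
    intro y z
    rcases le_total (F z) (F y) with hyz | hyz
    · refine le_add_right (le_of_eq ?_)
      simp [hW, hyz]
    · refine le_add_left (le_of_eq ?_)
      simp [hW, hyz, hk, norm_sub_rev y z, mul_comm (F y)]
  have hin : ∀ y, F y < ∞ → ∫⁻ z, W y z ≤ ENNReal.ofReal (K * P ^ (2 / p - 1)) * F y ^ p := by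
    intro y hy
    have e : ∫⁻ z, W y z = F y * ∫⁻ z in {z | F z ≤ F y}, F z * k y z := by
      rw [hW, lintegral_indicator (measurableSet_le hF measurable_const),
        ← lintegral_const_mul (F y) (f := fun z => F z * k y z) (hF.mul (hks y))]
      exact lintegral_congr fun z => mul_assoc _ _ _
    rw [e]
    by_cases hy0 : F y = 0
    · simp [hy0]
    have := h F P (F y).toReal hF hP (ENNReal.toReal_pos hy0 hy.ne) hFP y
    rw [ENNReal.ofReal_toReal hy.ne] at this
    refine (mul_le_mul_right this _).trans (le_of_eq ?_)
    rw [← mul_assoc K]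
    exact ENNReal.mul_ofReal_mul_rpow_sub_one hy0 hy.ne (by positivity)
  have hW1 : ∫⁻ y, ∫⁻ z, W y z ≤ ENNReal.ofReal (K * P ^ (2 / p)) := by
    calc ∫⁻ y, ∫⁻ z, W y z ≤ ∫⁻ y, ENNReal.ofReal (K * P ^ (2 / p - 1)) * F y ^ p := by
          refine lintegral_mono_ae ?_
          filter_upwards [hfin] with y hy
          exact hin y hy
      _ = ENNReal.ofReal (K * P ^ (2 / p)) := by
          rw [lintegral_const_mul _ (hF.pow_const p), hFP, ← ENNReal.ofReal_mul (by positivity)]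
          congr 1
          rw [mul_assoc, ← Real.rpow_add_one hP.ne']
          congr 2
          ring
  calc ∫⁻ y, ∫⁻ z, F y * F z * k y z ≤ ∫⁻ y, ∫⁻ z, (W y z + W z y) :=
        lintegral_mono fun y => lintegral_mono fun z => hpt y z
    _ = (∫⁻ y, ∫⁻ z, W y z) + ∫⁻ y, ∫⁻ z, W z y := by
        simp_rw [lintegral_add_left (f := fun z => W _ z) (hWm.comp measurable_prodMk_left)]
        rw [lintegral_add_left hWm.lintegral_prod_right]
    _ = (∫⁻ y, ∫⁻ z, W y z) + ∫⁻ y, ∫⁻ z, W y z := by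
        congr 1
        exact lintegral_lintegral_swap (hWm.comp measurable_swap).aemeasurable
    _ ≤ ENNReal.ofReal (K * P ^ (2 / p)) + ENNReal.ofReal (K * P ^ (2 / p)) :=
        add_le_add hW1 hW1
    _ ≤ _ := by
        rw [hFP, ENNReal.ofReal_rpow_of_pos hP, ← ENNReal.ofReal_add (by positivity) (by positivity),
          ← ENNReal.ofReal_mul (by positivity)]
        apply ENNReal.ofReal_le_ofReal
        have : 0 ≤ P ^ (2 / p) := by positivity
        linarith

lemma tsum_zpow_indicator_le {s : ℝ} (hs : 0 < s) : ∃ C : ℝ, 0 ≤ C ∧ ∀ x : ℝ, 0 < x →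
    ∑' k : ℤ, (if (2 : ℝ) ^ k < x then ENNReal.ofReal (((2 : ℝ) ^ k) ^ s) else 0)
      ≤ ENNReal.ofReal (C * x ^ s) := by
  have h2 : (2 : ℝ) ^ (-s) < 1 := Real.rpow_lt_one_of_one_lt_of_neg (by norm_num) (by linarith)
  refine ⟨(1 - 2 ^ (-s))⁻¹, inv_nonneg.2 (by linarith), fun x hx => ?_⟩
  obtain ⟨K, hK1, hK2⟩ := exists_mem_Ioc_zpow hx one_lt_two
  have hk : ∀ k : ℤ, (2 : ℝ) ^ k < x ↔ k ≤ K := fun k => by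
    constructor
    · intro h
      exact Int.lt_add_one_iff.1 ((zpow_lt_zpow_iff_right₀ one_lt_two).1 (h.trans_le hK2))
    · intro h
      exact (zpow_le_zpow_right₀ (one_le_two) h).trans_lt hK1
  have hinj : Function.Injective fun j : ℕ => K - (j : ℤ) := fun i j h => by
    simpa using h
  have hsupp : Function.support (fun k : ℤ =>
      (if (2 : ℝ) ^ k < x then ENNReal.ofReal (((2 : ℝ) ^ k) ^ s) else 0))
      ⊆ range fun j : ℕ => K - (j : ℤ) := by
    intro k hk'
    have : k ≤ K := by
      by_contra h
      exact hk' (if_neg (by rwa [hk]))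
    exact ⟨(K - k).toNat, by simp [this]⟩
  rw [← hinj.tsum_eq hsupp]
  have e : ∀ j : ℕ, (if (2 : ℝ) ^ (K - (j : ℤ)) < x
      then ENNReal.ofReal (((2 : ℝ) ^ (K - (j : ℤ))) ^ s) else 0)
      = ENNReal.ofReal (((2 : ℝ) ^ K) ^ s) * ENNReal.ofReal (2 ^ (-s)) ^ j := by
    intro j
    rw [if_pos ((hk _).2 (by simp)), ← ENNReal.ofReal_pow (by positivity),
      ← ENNReal.ofReal_mul (by positivity)]
    congr 1
    rw [zpow_sub₀ two_ne_zero, Real.div_rpow (by positivity) (by positivity), zpow_natCast,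
      ← Real.rpow_natCast, ← Real.rpow_natCast, ← Real.rpow_mul zero_le_two,
      ← Real.rpow_mul zero_le_two, div_eq_mul_inv, ← Real.rpow_neg zero_le_two]
    congr 2
    ring
  simp_rw [e]
  rw [ENNReal.tsum_mul_left, ENNReal.tsum_geometric, ← ENNReal.ofReal_one,
    ← ENNReal.ofReal_sub _ (by positivity), ← ENNReal.ofReal_inv_of_pos (by linarith),
    ← ENNReal.ofReal_mul (by positivity)]
  apply ENNReal.ofReal_le_ofReal
  rw [mul_comm]
  have : 0 ≤ (1 - (2 : ℝ) ^ (-s))⁻¹ := inv_nonneg.2 (by linarith)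
  gcongr

/-- A bilinear form with bounded kernel. -/
def kernelForm {X : Type*} [MeasurableSpace X] (μ : Measure X) (K : X × X → ℂ) (g h : X → ℂ) : ℂ :=
  ∫ q, g q.1 * h q.2 * K q ∂(μ.prod μ)

section
variable {X : Type*} [MeasurableSpace X] {μ : Measure X} {K : X × X → ℂ} {A : ℝ}

lemma integrable_kernel (hK : Measurable K) (hA : ∀ q, ‖K q‖ ≤ A) {g h : X → ℂ}
    (hg : Integrable g μ) (hh : Integrable h μ) :
    Integrable (fun q : X × X => g q.1 * h q.2 * K q) (μ.prod μ) :=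
  (hg.mul_prod hh).mul_bdd (c := A) hK.aestronglyMeasurable (Filter.Eventually.of_forall hA)

lemma enorm_kernelForm_le [SFinite μ] (hA : ∀ q, ‖K q‖ ≤ A) {g h : X → ℂ}
    (hg : Measurable g) (hh : Measurable h) :
    ‖kernelForm μ K g h‖ₑ ≤ ENNReal.ofReal A * ((∫⁻ y, ‖g y‖ₑ ∂μ) * ∫⁻ z, ‖h z‖ₑ ∂μ) := by
  refine (enorm_integral_le_lintegral_enorm _).trans ?_
  rw [← lintegral_prod_mul hg.enorm.aemeasurable hh.enorm.aemeasurable,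
    ← lintegral_const_mul _ (by fun_prop)]
  refine lintegral_mono fun q => ?_
  rw [enorm_mul, enorm_mul, mul_comm]
  gcongr
  rw [← ofReal_norm]
  exact ENNReal.ofReal_le_ofReal (hA q)

lemma enorm_kernelForm_le_tsum (hK : Measurable K) (hA : ∀ q, ‖K q‖ ≤ A) {g h : X → ℂ}
    (hgi : Integrable g μ) (hhi : Integrable h μ)
    (S : ℤ → Set X) (hS : ∀ k, MeasurableSet (S k)) (hd : Pairwise (Function.onFun Disjoint S))
    (hc : ∀ y, g y ≠ 0 → ∃ k, y ∈ S k) :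
    ‖kernelForm μ K g h‖ₑ ≤ ∑' k, ‖kernelForm μ K ((S k).indicator g) h‖ₑ := by
  have hintg := integrable_kernel hK hA hgi hhi
  have e : ∀ k, kernelForm μ K ((S k).indicator g) h
      = ∫ q in Prod.fst ⁻¹' (S k), g q.1 * h q.2 * K q ∂(μ.prod μ) := by
    intro k
    rw [← integral_indicator (measurable_fst (hS k))]
    refine integral_congr_ae (Filter.Eventually.of_forall fun q => ?_)
    by_cases hq : q.1 ∈ S k <;> simp [hq, indicator]
  have hs := hasSum_integral_iUnion (μ := μ.prod μ) (s := fun k => Prod.fst ⁻¹' (S k))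
    (f := fun q : X × X => g q.1 * h q.2 * K q) (fun k => measurable_fst (hS k))
    (fun i j hij => (hd hij).preimage _) hintg.integrableOn
  have hU : ∫ q in ⋃ k, Prod.fst ⁻¹' (S k), g q.1 * h q.2 * K q ∂(μ.prod μ)
      = kernelForm μ K g h := by
    refine setIntegral_eq_integral_of_forall_compl_eq_zero fun q hq => ?_
    have : g q.1 = 0 := by
      by_contra h0
      obtain ⟨k, hk⟩ := hc _ h0
      exact hq (mem_iUnion.2 ⟨k, hk⟩)
    simp [this]
  rw [hU] at hs
  simp_rw [e]
  rw [← hs.tsum_eq]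
  exact enorm_tsum_le_tsum_enorm


/-- Two pointwise size comparisons: on `{2^k ≤ ‖g‖}` an `L¹` mass is controlled by an `L^p` mass. -/
lemma setLIntegral_enorm_le_rpow {p t : ℝ} (hp : 1 ≤ p) (ht : 0 < t) {g : X → ℂ} {S : Set X}
    (hS : MeasurableSet S) (h : ∀ y ∈ S, t ≤ ‖g y‖) :
    ∫⁻ y in S, ‖g y‖ₑ ∂μ ≤ ENNReal.ofReal (t ^ (1 - p)) * ∫⁻ y in S, ‖g y‖ₑ ^ p ∂μ := by
  rw [← lintegral_const_mul' _ _ ENNReal.ofReal_ne_top]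
  refine setLIntegral_mono' hS fun y hy => ?_
  have h0 : 0 < ‖g y‖ := ht.trans_le (h y hy)
  rw [← ofReal_norm, ENNReal.ofReal_rpow_of_pos h0, ← ENNReal.ofReal_mul (by positivity)]
  apply ENNReal.ofReal_le_ofReal
  calc ‖g y‖ = ‖g y‖ ^ (1 - p) * ‖g y‖ ^ p := by
        rw [← Real.rpow_add h0]; simp
    _ ≤ _ := by
        gcongr ?_ * _
        exact Real.rpow_le_rpow_of_nonpos ht (h y hy) (by linarith)

lemma setLIntegral_enorm_sq_le_rpow {p t : ℝ} (hp : p ≤ 2) {g : X → ℂ} {S : Set X}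
    (hS : MeasurableSet S) (h0 : ∀ y ∈ S, 0 < ‖g y‖) (h : ∀ y ∈ S, ‖g y‖ ≤ t) :
    ∫⁻ y in S, ‖g y‖ₑ ^ (2 : ℝ) ∂μ
      ≤ ENNReal.ofReal (t ^ (2 - p)) * ∫⁻ y in S, ‖g y‖ₑ ^ p ∂μ := by
  rw [← lintegral_const_mul' _ _ ENNReal.ofReal_ne_top]
  refine setLIntegral_mono' hS fun y hy => ?_
  have h1 := h0 y hy
  have ht : 0 < t := h1.trans_le (h y hy)
  rw [← ofReal_norm, ENNReal.ofReal_rpow_of_pos h1, ENNReal.ofReal_rpow_of_pos h1,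
    ← ENNReal.ofReal_mul (by positivity)]
  apply ENNReal.ofReal_le_ofReal
  calc ‖g y‖ ^ (2 : ℝ) = ‖g y‖ ^ (2 - p) * ‖g y‖ ^ p := by
        rw [← Real.rpow_add h1]; simp
    _ ≤ _ := by
        gcongr ?_ * _
        exact Real.rpow_le_rpow h1.le (h y hy) (by linarith)

lemma tsum_sqrt_mul_sqrt_le (u v : ℤ → ℝ≥0∞) :
    ∑' k, u k ^ (1 / 2 : ℝ) * v k ^ (1 / 2 : ℝ)
      ≤ (∑' k, u k) ^ (1 / 2 : ℝ) * (∑' k, v k) ^ (1 / 2 : ℝ) := by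
  have := ENNReal.lintegral_mul_le_Lp_mul_Lq (Measure.count : Measure ℤ)
    Real.HolderConjugate.two_two (f := fun k => u k ^ (1 / 2 : ℝ)) (g := fun k => v k ^ (1 / 2 : ℝ))
    (measurable_of_countable _).aemeasurable (measurable_of_countable _).aemeasurable
  have e : ∀ x : ℝ≥0∞, (x ^ (2⁻¹ : ℝ)) ^ 2 = x := fun x => by
    rw [← ENNReal.rpow_natCast, ← ENNReal.rpow_mul]
    norm_num
  simpa [lintegral_count, e] using this


lemma lintegral_enorm_indicator_rpow {p : ℝ} (hp : 0 < p) {g : X → ℂ} {S : Set X}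
    (hS : MeasurableSet S) : ∫⁻ y, ‖S.indicator g y‖ₑ ^ p ∂μ = ∫⁻ y in S, ‖g y‖ₑ ^ p ∂μ := by
  rw [← lintegral_indicator hS]
  refine lintegral_congr fun y => ?_
  by_cases hy : y ∈ S <;> simp [hy, hp]

lemma tsum_setLIntegral_le {S : ℤ → Set X} (hS : ∀ k, MeasurableSet (S k))
    (hd : Pairwise (Function.onFun Disjoint S)) (f : X → ℝ≥0∞) :
    ∑' k, ∫⁻ y in S k, f y ∂μ ≤ ∫⁻ y, f y ∂μ := by
  rw [← lintegral_iUnion hS hd]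
  exact setLIntegral_le_lintegral _ _

lemma exists_tsum_truncation_le {p : ℝ} (hp2 : p < 2) (X : Type*) [MeasurableSpace X] : ∃ C : ℝ,
    0 ≤ C ∧ ∀ (μ : Measure X) (h : X → ℂ) (R : ℝ), Measurable h → 0 < R →
    ∑' k : ℤ, ENNReal.ofReal (((2 : ℝ) ^ k) ^ (2 - p)) *
      ∫⁻ z in {z | 0 < ‖h z‖ ∧ ‖h z‖ < R / 2 ^ k}, ‖h z‖ₑ ^ (2 : ℝ) ∂μ
      ≤ ENNReal.ofReal (C * R ^ (2 - p)) * ∫⁻ z, ‖h z‖ₑ ^ p ∂μ := by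
  obtain ⟨C, hC, hsum⟩ := tsum_zpow_indicator_le (s := 2 - p) (by linarith)
  refine ⟨C, hC, fun μ h R hh hR => ?_⟩
  have hU : ∀ k : ℤ, MeasurableSet {z | 0 < ‖h z‖ ∧ ‖h z‖ < R / 2 ^ k} := fun k =>
    (measurableSet_lt measurable_const hh.norm).inter (measurableSet_lt hh.norm measurable_const)
  have e : ∀ k : ℤ, ENNReal.ofReal (((2 : ℝ) ^ k) ^ (2 - p)) *
      ∫⁻ z in {z | 0 < ‖h z‖ ∧ ‖h z‖ < R / 2 ^ k}, ‖h z‖ₑ ^ (2 : ℝ) ∂μ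
      = ∫⁻ z, {z | 0 < ‖h z‖ ∧ ‖h z‖ < R / 2 ^ k}.indicator
        (fun z => ENNReal.ofReal (((2 : ℝ) ^ k) ^ (2 - p)) * ‖h z‖ₑ ^ (2 : ℝ)) z ∂μ := by
    intro k
    rw [lintegral_indicator (hU k), lintegral_const_mul _ (hh.enorm.pow_const _)]
  simp_rw [e]
  rw [← lintegral_tsum fun k =>
    (((hh.enorm.pow_const _).const_mul _).indicator (hU k)).aemeasurable,
    ← lintegral_const_mul _ (hh.enorm.pow_const _)]
  refine lintegral_mono fun z => ?_
  rcases (norm_nonneg (h z)).eq_or_lt with h0 | h0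
  · simp [norm_eq_zero.1 h0.symm, indicator]
  have e2 : ∀ k : ℤ, {z | 0 < ‖h z‖ ∧ ‖h z‖ < R / 2 ^ k}.indicator
        (fun z => ENNReal.ofReal (((2 : ℝ) ^ k) ^ (2 - p)) * ‖h z‖ₑ ^ (2 : ℝ)) z
      = (if (2 : ℝ) ^ k < R / ‖h z‖ then ENNReal.ofReal (((2 : ℝ) ^ k) ^ (2 - p)) else 0)
        * ‖h z‖ₑ ^ (2 : ℝ) := by
    intro k
    have : ‖h z‖ < R / 2 ^ k ↔ (2 : ℝ) ^ k < R / ‖h z‖ := by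
      rw [lt_div_iff₀ (by positivity), lt_div_iff₀ h0, mul_comm]
    have hne : h z ≠ 0 := norm_pos_iff.1 h0
    simp [indicator, hne, this]
  simp_rw [e2]
  rw [ENNReal.tsum_mul_right]
  refine (mul_le_mul_left (hsum _ (by positivity)) _).trans ?_
  rw [← ofReal_norm, ENNReal.ofReal_rpow_of_pos h0, ENNReal.ofReal_rpow_of_pos h0,
    ← ENNReal.ofReal_mul (by positivity), ← ENNReal.ofReal_mul (by positivity)]
  apply ENNReal.ofReal_le_ofReal
  rw [Real.div_rpow hR.le h0.le, Real.rpow_sub h0]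
  have := h0.ne'
  apply le_of_eq
  field_simp


/-- Real interpolation between an `L¹ × L¹` and an `L² × L²` bound for a bilinear form. -/
lemma exists_kernelForm_le {p A₂ : ℝ} (hp1 : 1 < p) (hp2 : p < 2) (hA₂ : 0 ≤ A₂)
    (X : Type*) [MeasurableSpace X] : ∃ C : ℝ, 0 ≤ C ∧
    ∀ (μ : Measure X) [SFinite μ] (K : X × X → ℂ) (A : ℝ), 0 < A → Measurable K →
      (∀ q, ‖K q‖ ≤ A) →
      (∀ g h : X → ℂ, Measurable g → Measurable h → Integrable g μ → Integrable h μ →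
        ‖kernelForm μ K g h‖ₑ ≤ ENNReal.ofReal A₂ * ((∫⁻ y, ‖g y‖ₑ ^ (2 : ℝ) ∂μ) ^ (1 / 2 : ℝ)
          * (∫⁻ z, ‖h z‖ₑ ^ (2 : ℝ) ∂μ) ^ (1 / 2 : ℝ))) →
      ∀ g h : X → ℂ, Measurable g → Measurable h → Integrable g μ → Integrable h μ →
        ‖kernelForm μ K g h‖ₑ ≤ ENNReal.ofReal (C * A ^ (2 / p - 1))
          * ((∫⁻ y, ‖g y‖ₑ ^ p ∂μ) ^ (1 / p) * (∫⁻ z, ‖h z‖ₑ ^ p ∂μ) ^ (1 / p)) := by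
  obtain ⟨C, hC, htr⟩ := exists_tsum_truncation_le hp2 X
  have hp0 : 0 < p := by linarith
  refine ⟨1 + A₂ * (2 ^ (2 - p)) ^ (1 / 2 : ℝ) * C ^ (1 / 2 : ℝ) + 1, by positivity,
    fun μ _ K A hA hK hKA hL2 g h hg hh hgi hhi => ?_⟩
  set G := ∫⁻ y, ‖g y‖ₑ ^ p ∂μ with hG
  set H := ∫⁻ z, ‖h z‖ₑ ^ p ∂μ with hH
  have key : ∀ R : ℝ, 0 < R → ‖kernelForm μ K g h‖ₑ ≤
      ENNReal.ofReal (A * R ^ (1 - p)) * (G * H)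
        + ENNReal.ofReal (A₂ * (2 ^ (2 - p)) ^ (1 / 2 : ℝ) * (C * R ^ (2 - p)) ^ (1 / 2 : ℝ))
          * (G * H) ^ (1 / 2 : ℝ) := by
    intro R hR
    set S : ℤ → Set X := fun k => {y | (2 : ℝ) ^ k ≤ ‖g y‖ ∧ ‖g y‖ < 2 ^ (k + 1)} with hSdef
    have hS : ∀ k, MeasurableSet (S k) := fun k =>
      (measurableSet_le measurable_const hg.norm).inter (measurableSet_lt hg.norm measurable_const)
    have hSd : Pairwise (Function.onFun Disjoint S) := by
      intro i j hij
      refine Set.disjoint_left.2 fun y hi hj => ?_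
      rcases lt_or_gt_of_ne hij with hl | hl
      · have : (2 : ℝ) ^ (i + 1) ≤ 2 ^ j := zpow_le_zpow_right₀ one_le_two (by omega)
        linarith [hi.2, hj.1]
      · have : (2 : ℝ) ^ (j + 1) ≤ 2 ^ i := zpow_le_zpow_right₀ one_le_two (by omega)
        linarith [hi.1, hj.2]
    have hSc : ∀ y, g y ≠ 0 → ∃ k, y ∈ S k := fun y hy =>
      exists_mem_Ico_zpow (norm_pos_iff.2 hy) one_lt_two
    set T : ℤ → Set X := fun k => {z | R / 2 ^ k ≤ ‖h z‖} with hTdef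
    have hT : ∀ k, MeasurableSet (T k) := fun k => measurableSet_le measurable_const hh.norm
    set U : ℤ → Set X := fun k => {z | 0 < ‖h z‖ ∧ ‖h z‖ < R / 2 ^ k} with hUdef
    have hU : ∀ k, MeasurableSet (U k) := fun k =>
      (measurableSet_lt measurable_const hh.norm).inter (measurableSet_lt hh.norm measurable_const)
    have hsplit : ∀ k, kernelForm μ K ((S k).indicator g) h
        = kernelForm μ K ((S k).indicator g) ((T k).indicator h)
          + kernelForm μ K ((S k).indicator g) ((U k).indicator h) := by
      intro k
      rw [kernelForm, kernelForm, kernelForm, ← integral_add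
        (integrable_kernel hK hKA (hgi.indicator (hS k)) (hhi.indicator (hT k)))
        (integrable_kernel hK hKA (hgi.indicator (hS k)) (hhi.indicator (hU k)))]
      refine integral_congr_ae (Filter.Eventually.of_forall fun q => ?_)
      have : h q.2 = (T k).indicator h q.2 + (U k).indicator h q.2 := by
        by_cases h1 : R / 2 ^ k ≤ ‖h q.2‖
        · simp [hTdef, hUdef, indicator, h1, not_lt.2 h1]
        · by_cases h2 : h q.2 = 0
          · simp [h2, indicator]
          · simp [hTdef, hUdef, indicator, h1, not_le.1 h1, h2]
      simp only [this, mul_add, add_mul]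
    have hhigh : ∀ k, ‖kernelForm μ K ((S k).indicator g) ((T k).indicator h)‖ₑ
        ≤ ENNReal.ofReal (A * R ^ (1 - p)) * H * ∫⁻ y in S k, ‖g y‖ₑ ^ p ∂μ := by
      intro k
      refine (enorm_kernelForm_le hKA (hg.indicator (hS k)) (hh.indicator (hT k))).trans ?_
      have e1 := lintegral_enorm_indicator_rpow (μ := μ) one_pos (g := g) (hS k)
      have e2 := lintegral_enorm_indicator_rpow (μ := μ) one_pos (g := h) (hT k)
      simp only [ENNReal.rpow_one] at e1 e2
      rw [e1, e2]
      have hk : (0 : ℝ) < 2 ^ k := by positivity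
      have b1 := setLIntegral_enorm_le_rpow (μ := μ) hp1.le hk (hS k) fun y hy => hy.1
      have b2 := setLIntegral_enorm_le_rpow (μ := μ) hp1.le (div_pos hR hk) (hT k) fun y hy => hy
      have b3 : ∫⁻ y in T k, ‖h y‖ₑ ^ p ∂μ ≤ H := setLIntegral_le_lintegral _ _
      calc _ ≤ ENNReal.ofReal A * ((ENNReal.ofReal (((2 : ℝ) ^ k) ^ (1 - p)) *
            ∫⁻ y in S k, ‖g y‖ₑ ^ p ∂μ) * (ENNReal.ofReal ((R / 2 ^ k) ^ (1 - p)) * H)) := by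
              gcongr
              exact b2.trans (by gcongr)
        _ = (ENNReal.ofReal A * (ENNReal.ofReal (((2 : ℝ) ^ k) ^ (1 - p)) *
              ENNReal.ofReal ((R / 2 ^ k) ^ (1 - p)))) * H * ∫⁻ y in S k, ‖g y‖ₑ ^ p ∂μ := by ring
        _ = _ := by
          rw [← ENNReal.ofReal_mul (by positivity), ← ENNReal.ofReal_mul hA.le,
            ← Real.mul_rpow hk.le (by positivity), mul_div_cancel₀ _ hk.ne']
    have hlow : ∀ k, ‖kernelForm μ K ((S k).indicator g) ((U k).indicator h)‖ₑ
        ≤ ENNReal.ofReal A₂ * ((ENNReal.ofReal (2 ^ (2 - p)) * ∫⁻ y in S k, ‖g y‖ₑ ^ p ∂μ)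
            ^ (1 / 2 : ℝ) * (ENNReal.ofReal (((2 : ℝ) ^ k) ^ (2 - p)) *
              ∫⁻ z in U k, ‖h z‖ₑ ^ (2 : ℝ) ∂μ) ^ (1 / 2 : ℝ)) := by
      intro k
      refine (hL2 _ _ (hg.indicator (hS k)) (hh.indicator (hU k)) (hgi.indicator (hS k))
        (hhi.indicator (hU k))).trans ?_
      rw [lintegral_enorm_indicator_rpow two_pos (hS k),
        lintegral_enorm_indicator_rpow two_pos (hU k),
        ← ENNReal.mul_rpow_of_nonneg _ _ (by norm_num),
        ← ENNReal.mul_rpow_of_nonneg _ _ (by norm_num)]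
      have hk : (0 : ℝ) < 2 ^ k := by positivity
      have b1 := setLIntegral_enorm_sq_le_rpow (μ := μ) hp2.le (hS k)
        (fun y hy => hk.trans_le hy.1) fun y hy => hy.2.le
      refine mul_le_mul_right (ENNReal.rpow_le_rpow ?_ (by norm_num)) _
      refine (mul_le_mul_left b1 _).trans (le_of_eq ?_)
      rw [zpow_add_one₀ two_ne_zero, Real.mul_rpow hk.le zero_le_two,
        ENNReal.ofReal_mul (by positivity)]
      ring
    calc ‖kernelForm μ K g h‖ₑ ≤ ∑' k, ‖kernelForm μ K ((S k).indicator g) h‖ₑ :=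
          enorm_kernelForm_le_tsum hK hKA hgi hhi S hS hSd hSc
      _ ≤ ∑' k, (‖kernelForm μ K ((S k).indicator g) ((T k).indicator h)‖ₑ
          + ‖kernelForm μ K ((S k).indicator g) ((U k).indicator h)‖ₑ) :=
          ENNReal.tsum_le_tsum fun k => by rw [hsplit k]; exact enorm_add_le _ _
      _ = _ := ENNReal.tsum_add
      _ ≤ _ := by
        refine add_le_add ((ENNReal.tsum_le_tsum hhigh).trans ?_)
          ((ENNReal.tsum_le_tsum hlow).trans ?_)
        · rw [ENNReal.tsum_mul_left, mul_comm G, ← mul_assoc]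
          exact mul_le_mul_right (tsum_setLIntegral_le hS hSd _) _
        · rw [ENNReal.tsum_mul_left]
          have b1 : ∑' k, ENNReal.ofReal (2 ^ (2 - p)) * ∫⁻ y in S k, ‖g y‖ₑ ^ p ∂μ
              ≤ ENNReal.ofReal (2 ^ (2 - p)) * G := by
            rw [ENNReal.tsum_mul_left]
            exact mul_le_mul_right (tsum_setLIntegral_le hS hSd _) _
          refine (mul_le_mul_right ((tsum_sqrt_mul_sqrt_le _ _).trans (mul_le_mul'
            (ENNReal.rpow_le_rpow b1 (by norm_num))
            (ENNReal.rpow_le_rpow (htr μ h R hh hR) (by norm_num)))) _).trans (le_of_eq ?_)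
          rw [ENNReal.mul_rpow_of_nonneg _ _ (by norm_num),
            ENNReal.mul_rpow_of_nonneg _ _ (by norm_num),
            ENNReal.mul_rpow_of_nonneg _ _ (by norm_num),
            ENNReal.ofReal_rpow_of_nonneg (by positivity) (by norm_num),
            ENNReal.ofReal_rpow_of_nonneg (by positivity) (by norm_num),
            ENNReal.ofReal_mul (by positivity), ENNReal.ofReal_mul (by positivity)]
          ring
  have hc : ENNReal.ofReal ((1 + A₂ * (2 ^ (2 - p)) ^ (1 / 2 : ℝ) * C ^ (1 / 2 : ℝ) + 1)
      * A ^ (2 / p - 1)) ≠ 0 := by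
    rw [Ne, ENNReal.ofReal_eq_zero, not_le]
    positivity
  rw [← ENNReal.mul_rpow_of_nonneg _ _ (by positivity)]
  by_cases hGH0 : G * H = 0
  · have hz : (∫⁻ y, ‖g y‖ₑ ∂μ) * ∫⁻ z, ‖h z‖ₑ ∂μ = 0 := by
      have aux : ∀ f : X → ℂ, Measurable f → ∫⁻ y, ‖f y‖ₑ ^ p ∂μ = 0 → ∫⁻ y, ‖f y‖ₑ ∂μ = 0 := by
        intro f hf h0
        rw [lintegral_eq_zero_iff (hf.enorm.pow_const p)] at h0
        rw [lintegral_eq_zero_iff hf.enorm]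
        filter_upwards [h0] with y hy
        simpa [hp0, not_lt.2 hp0.le] using hy
      rcases mul_eq_zero.1 hGH0 with h0 | h0
      · rw [aux g hg h0, zero_mul]
      · rw [aux h hh h0, mul_zero]
    refine (enorm_kernelForm_le hKA hg hh).trans ?_
    rw [hz, mul_zero]
    exact zero_le
  by_cases hGHT : G * H = ∞
  · rw [hGHT, ENNReal.top_rpow_of_pos (by positivity), ENNReal.mul_top hc]
    exact le_top
  obtain ⟨t, ht, hGHt⟩ : ∃ t : ℝ, 0 < t ∧ G * H = ENNReal.ofReal t :=
    ⟨_, ENNReal.toReal_pos hGH0 hGHT, (ENNReal.ofReal_toReal hGHT).symm⟩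
  set R := (A ^ (2 : ℝ) * t) ^ (1 / p) with hR
  have hR0 : 0 < R := by positivity
  refine (key R hR0).trans ?_
  rw [hGHt, ENNReal.ofReal_rpow_of_pos ht, ENNReal.ofReal_rpow_of_pos ht,
    ← ENNReal.ofReal_mul (by positivity), ← ENNReal.ofReal_mul (by positivity),
    ← ENNReal.ofReal_mul (by positivity), ← ENNReal.ofReal_add (by positivity) (by positivity)]
  apply ENNReal.ofReal_le_ofReal
  have e0 : ∀ s : ℝ, R ^ s = A ^ (2 / p * s) * t ^ (1 / p * s) := fun s => by
    rw [hR, ← Real.rpow_mul (by positivity), Real.mul_rpow (by positivity) ht.le,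
      ← Real.rpow_mul hA.le]
    congr 2
    ring
  have e1 : A * R ^ (1 - p) * t = A ^ (2 / p - 1) * t ^ (1 / p) := by
    have x1 : A * A ^ (2 / p * (1 - p)) = A ^ (2 / p - 1) := by
      nth_rewrite 1 [← Real.rpow_one A]
      rw [← Real.rpow_add hA]
      congr 1
      field_simp
      ring
    have x2 : t ^ (1 / p * (1 - p)) * t = t ^ (1 / p) := by
      nth_rewrite 2 [← Real.rpow_one t]
      rw [← Real.rpow_add ht]
      congr 1
      field_simp
      ring
    rw [e0, ← x1, ← x2]
    ring
  have e2 : (R ^ (2 - p)) ^ (1 / 2 : ℝ) * t ^ (1 / 2 : ℝ) = A ^ (2 / p - 1) * t ^ (1 / p) := by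
    rw [← Real.rpow_mul hR0.le, e0, mul_assoc, ← Real.rpow_add ht]
    congr 2
    · field_simp
    · field_simp
      ring
  rw [e1, Real.mul_rpow hC (by positivity)]
  have e3 : A₂ * (2 ^ (2 - p)) ^ (1 / 2 : ℝ) * (C ^ (1 / 2 : ℝ) * (R ^ (2 - p)) ^ (1 / 2 : ℝ))
      * t ^ (1 / 2 : ℝ) = A₂ * (2 ^ (2 - p)) ^ (1 / 2 : ℝ) * C ^ (1 / 2 : ℝ)
        * (A ^ (2 / p - 1) * t ^ (1 / p)) := by
    rw [← e2]; ring
  rw [e3]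
  have : 0 ≤ A ^ (2 / p - 1) * t ^ (1 / p) := by positivity
  linarith

end

/-- The Fourier transform on `ℝ²`, `ĝ(x) = ∫ e^{-i⟨y,x⟩} g(y) dy`. -/
def ftrans2 (g : (Fin 2 → ℝ) → ℂ) (x : Fin 2 → ℝ) : ℂ :=
  ∫ y : Fin 2 → ℝ, Complex.exp (-Complex.I * (dot2 y x : ℂ)) * g y

lemma norm_cexp_neg_I_mul (t : ℝ) : ‖Complex.exp (-Complex.I * (t : ℂ))‖ = 1 := by
  have : -Complex.I * (t : ℂ) = ((-t : ℝ) : ℂ) * Complex.I := by push_cast; ring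
  rw [this, Complex.norm_exp_ofReal_mul_I]

lemma conj_cexp_neg_I_mul (t : ℝ) : (starRingEnd ℂ) (Complex.exp (-Complex.I * (t : ℂ)))
    = Complex.exp (-Complex.I * ((-t : ℝ) : ℂ)) := by
  rw [← Complex.exp_conj]
  congr 1
  simp

lemma continuous_dot2 : Continuous fun q : (Fin 2 → ℝ) × (Fin 2 → ℝ) => dot2 q.1 q.2 := by
  unfold dot2
  fun_prop

lemma measurable_cexp_dot2 : Measurable fun q : (Fin 2 → ℝ) × (Fin 2 → ℝ) =>
    Complex.exp (-Complex.I * (dot2 q.1 q.2 : ℂ)) := by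
  have := continuous_dot2
  exact (by fun_prop : Continuous fun q : (Fin 2 → ℝ) × (Fin 2 → ℝ) =>
    Complex.exp (-Complex.I * (dot2 q.1 q.2 : ℂ))).measurable

/-- The Gaussian weight `e^{-b|x|²}` as a complex-valued function. -/
def gaussC (b : ℝ) (x : Fin 2 → ℝ) : ℂ := ((Real.exp (-b * (x 0 ^ 2 + x 1 ^ 2)) : ℝ) : ℂ)

lemma integral_gaussC_mul {b : ℝ} (hb : 0 < b) (u : Fin 2 → ℝ) :
    ∫ x, gaussC b x * Complex.exp (-Complex.I * (dot2 u x : ℂ))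
      = ((π / b : ℝ) : ℂ) * gaussC (1 / (4 * b)) u := by
  have h := GaussianFourier.integral_cexp_neg_mul_sum_add (b := (b : ℂ)) (by simpa using hb)
    (fun i : Fin 2 => -Complex.I * (u i : ℂ))
  simp only [Fin.sum_univ_two, Fintype.card_fin] at h
  have e : ∀ x : Fin 2 → ℝ, gaussC b x * Complex.exp (-Complex.I * (dot2 u x : ℂ))
      = Complex.exp (-(b : ℂ) * ((x 0 : ℂ) ^ 2 + (x 1 : ℂ) ^ 2)
        + (-Complex.I * (u 0 : ℂ) * (x 0 : ℂ) + -Complex.I * (u 1 : ℂ) * (x 1 : ℂ))) := by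
    intro x
    rw [gaussC, Complex.ofReal_exp, ← Complex.exp_add, dot2]
    congr 1
    push_cast
    ring
  simp_rw [e]
  rw [h, gaussC, Complex.ofReal_exp]
  congr 1
  · norm_num
  · congr 1
    push_cast
    have : (b : ℂ) ≠ 0 := by exact_mod_cast hb.ne'
    field_simp
    rw [Complex.I_sq]
    ring

lemma integrable_gaussC {b : ℝ} (hb : 0 < b) : Integrable (gaussC b) := by
  have h := GaussianFourier.integrable_cexp_neg_mul_sum_add (b := (b : ℂ)) (by simpa using hb)
    (fun _ : Fin 2 => 0)
  refine h.congr (Filter.Eventually.of_forall fun x => ?_)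
  simp [gaussC, Fin.sum_univ_two]

lemma norm_gaussC (b : ℝ) (x : Fin 2 → ℝ) :
    ‖gaussC b x‖ = Real.exp (-b * (x 0 ^ 2 + x 1 ^ 2)) := by
  rw [gaussC, Complex.norm_real, Real.norm_eq_abs, abs_of_pos (Real.exp_pos _)]

lemma lintegral_enorm_gaussC {b : ℝ} (hb : 0 < b) :
    ∫⁻ x, ‖gaussC b x‖ₑ = ENNReal.ofReal (π / b) := by
  simp_rw [← ofReal_norm]
  rw [← ofReal_integral_eq_lintegral_ofReal (integrable_gaussC hb).norm
    (Filter.Eventually.of_forall fun _ => norm_nonneg _)]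
  congr 1
  have h := integral_gaussC_mul hb 0
  simp only [dot2, Pi.zero_apply, zero_mul, add_zero, Complex.ofReal_zero, mul_zero,
    Complex.exp_zero, mul_one] at h
  have h0 : gaussC (1 / (4 * b)) 0 = 1 := by simp [gaussC]
  rw [h0, mul_one] at h
  have h2 : ∫ x, gaussC b x = ((∫ x, ‖gaussC b x‖ : ℝ) : ℂ) := by
    rw [← integral_complex_ofReal]
    refine integral_congr_ae (Filter.Eventually.of_forall fun x => ?_)
    simp only [norm_gaussC]
    rfl
  rw [h2] at h
  exact_mod_cast h

lemma ftrans2_mul_conj {g h : (Fin 2 → ℝ) → ℂ} (x : Fin 2 → ℝ) :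
    ftrans2 g x * (starRingEnd ℂ) (ftrans2 h x)
      = ∫ q : (Fin 2 → ℝ) × (Fin 2 → ℝ), g q.1 * (starRingEnd ℂ) (h q.2)
        * Complex.exp (-Complex.I * (dot2 (q.1 - q.2) x : ℂ)) := by
  rw [ftrans2, ftrans2, ← integral_conj, ← integral_prod_mul]
  refine integral_congr_ae (Filter.Eventually.of_forall fun q => ?_)
  simp only [map_mul, conj_cexp_neg_I_mul]
  have : Complex.exp (-Complex.I * (dot2 (q.1 - q.2) x : ℂ))
      = Complex.exp (-Complex.I * (dot2 q.1 x : ℂ))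
        * Complex.exp (-Complex.I * ((-dot2 q.2 x : ℝ) : ℂ)) := by
    rw [← Complex.exp_add]
    congr 1
    simp only [dot2, Pi.sub_apply]
    push_cast
    ring
  rw [this]
  ring

lemma integrable_weight_mul_ftrans2 {w : (Fin 2 → ℝ) → ℂ} {ν : Measure (Fin 2 → ℝ)} [SFinite ν]
    (hw : Integrable w ν) {g h : (Fin 2 → ℝ) → ℂ} (hg : Integrable g) (hh : Integrable h) :
    Integrable (fun r : (Fin 2 → ℝ) × ((Fin 2 → ℝ) × (Fin 2 → ℝ)) =>
      w r.1 * (g r.2.1 * h r.2.2 * Complex.exp (-Complex.I * (dot2 (r.2.1 - r.2.2) r.1 : ℂ))))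
      (ν.prod (volume.prod volume)) := by
  have h1 := hw.mul_prod (hg.mul_prod hh)
  have hm : Measurable fun r : (Fin 2 → ℝ) × ((Fin 2 → ℝ) × (Fin 2 → ℝ)) =>
      Complex.exp (-Complex.I * (dot2 (r.2.1 - r.2.2) r.1 : ℂ)) :=
    measurable_cexp_dot2.comp (by fun_prop :
      Measurable fun r : (Fin 2 → ℝ) × ((Fin 2 → ℝ) × (Fin 2 → ℝ)) => (r.2.1 - r.2.2, r.1))
  have h2 := h1.mul_bdd (c := 1) hm.aestronglyMeasurable
    (Filter.Eventually.of_forall fun r => (norm_cexp_neg_I_mul _).le)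
  refine h2.congr (Filter.Eventually.of_forall fun r => ?_)
  simp only [mul_assoc]

/-- Testing `ĝ · conj ĥ` against an integrable weight, as a bilinear form in `g`, `h`. -/
lemma integral_weight_mul_ftrans2 {w : (Fin 2 → ℝ) → ℂ} {ν : Measure (Fin 2 → ℝ)} [SFinite ν]
    (hw : Integrable w ν) {g h : (Fin 2 → ℝ) → ℂ} (hg : Integrable g) (hh : Integrable h) :
    Integrable (fun x => w x * (ftrans2 g x * (starRingEnd ℂ) (ftrans2 h x))) ν ∧
    ∫ x, w x * (ftrans2 g x * (starRingEnd ℂ) (ftrans2 h x)) ∂ν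
      = kernelForm volume (fun q => ∫ x, w x * Complex.exp (-Complex.I * (dot2 (q.1 - q.2) x : ℂ)) ∂ν)
        g (fun z => (starRingEnd ℂ) (h z)) := by
  have hhc : Integrable fun z => (starRingEnd ℂ) (h z) := by
    refine (integrable_norm_iff ?_).1 ?_
    · exact Complex.continuous_conj.comp_aestronglyMeasurable hh.1
    · simpa using hh.norm
  have hintg := integrable_weight_mul_ftrans2 hw hg hhc
  have e : ∀ x, w x * (ftrans2 g x * (starRingEnd ℂ) (ftrans2 h x))
      = ∫ q : (Fin 2 → ℝ) × (Fin 2 → ℝ), w x * (g q.1 * (starRingEnd ℂ) (h q.2)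
        * Complex.exp (-Complex.I * (dot2 (q.1 - q.2) x : ℂ))) := by
    intro x
    rw [ftrans2_mul_conj, integral_const_mul]
  simp_rw [e]
  refine ⟨hintg.integral_prod_left, ?_⟩
  rw [integral_integral_swap hintg, kernelForm]
  refine integral_congr_ae (Filter.Eventually.of_forall fun q => ?_)
  simp only
  rw [← integral_const_mul]
  refine integral_congr_ae (Filter.Eventually.of_forall fun x => ?_)
  simp only
  ring

lemma measurable_gaussC (b : ℝ) : Measurable (gaussC b) := by
  unfold gaussC
  fun_prop

lemma mul_le_rpow_two_add (a b : ℝ≥0∞) : a * b ≤ a ^ (2 : ℝ) + b ^ (2 : ℝ) := by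
  have e : ∀ x : ℝ≥0∞, x ^ (2 : ℝ) = x * x := fun x => by
    rw [ENNReal.rpow_two, sq]
  rw [e, e]
  rcases le_total a b with h | h
  · exact le_add_left (mul_le_mul_left h _)
  · exact le_add_right (mul_le_mul_right h _)

lemma lintegral_gaussC_mul_enorm_ftrans2_le {b : ℝ} (hb : 0 < b) {g : (Fin 2 → ℝ) → ℂ}
    (hgm : Measurable g) (hg : Integrable g) :
    ∫⁻ x, ‖gaussC b x‖ₑ * ‖ftrans2 g x‖ₑ ^ (2 : ℝ)
      ≤ ENNReal.ofReal (8 * π ^ 2) * ∫⁻ y, ‖g y‖ₑ ^ (2 : ℝ) := by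
  obtain ⟨hi, he⟩ := integral_weight_mul_ftrans2 (integrable_gaussC hb) hg hg
  have e1 : ∀ x, gaussC b x * (ftrans2 g x * (starRingEnd ℂ) (ftrans2 g x))
      = ((‖gaussC b x‖ * ‖ftrans2 g x‖ ^ 2 : ℝ) : ℂ) := by
    intro x
    rw [Complex.mul_conj, Complex.normSq_eq_norm_sq, norm_gaussC, gaussC]
    push_cast
    rfl
  simp_rw [e1] at hi he
  rw [integral_complex_ofReal] at he
  have hi' : Integrable (fun x => ‖gaussC b x‖ * ‖ftrans2 g x‖ ^ 2) := by
    exact hi.re.congr (Filter.Eventually.of_forall fun x => by exact Complex.ofReal_re _)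
  have e2 : ∫⁻ x, ‖gaussC b x‖ₑ * ‖ftrans2 g x‖ₑ ^ (2 : ℝ)
      = ‖kernelForm volume (fun q => ∫ x, gaussC b x *
          Complex.exp (-Complex.I * (dot2 (q.1 - q.2) x : ℂ))) g
            (fun z => (starRingEnd ℂ) (g z))‖ₑ := by
    rw [← he, ← ofReal_norm, Complex.norm_real, Real.norm_eq_abs, abs_of_nonneg
      (integral_nonneg fun x => by positivity), ofReal_integral_eq_lintegral_ofReal hi'
      (Filter.Eventually.of_forall fun x => by positivity)]
    refine lintegral_congr fun x => ?_
    rw [ENNReal.ofReal_mul (norm_nonneg _), ENNReal.ofReal_pow (norm_nonneg _), ofReal_norm,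
      ofReal_norm, ENNReal.rpow_two]
  rw [e2]
  simp_rw [integral_gaussC_mul hb]
  set k : (Fin 2 → ℝ) → ℝ≥0∞ := fun u => ‖((π / b : ℝ) : ℂ) * gaussC (1 / (4 * b)) u‖ₑ with hk
  have hkm : Measurable k := ((measurable_gaussC _).const_mul _).enorm
  have hkneg : ∀ u, k (-u) = k u := fun u => by simp [hk, gaussC]
  have hkint : ∫⁻ u, k u = ENNReal.ofReal (4 * π ^ 2) := by
    simp only [hk, enorm_mul]
    rw [lintegral_const_mul _ (measurable_gaussC _).enorm, lintegral_enorm_gaussC (by positivity),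
      ← ofReal_norm, Complex.norm_real, Real.norm_eq_abs, abs_of_pos (by positivity),
      ← ENNReal.ofReal_mul (by positivity)]
    congr 1
    field_simp
  have hgr : Measurable fun y => ‖g y‖ₑ ^ (2 : ℝ) := hgm.enorm.pow_const _
  have hksub : Measurable fun q : (Fin 2 → ℝ) × (Fin 2 → ℝ) => k (q.1 - q.2) :=
    hkm.comp (measurable_fst.sub measurable_snd)
  have hm1 : Measurable fun q : (Fin 2 → ℝ) × (Fin 2 → ℝ) => ‖g q.1‖ₑ ^ (2 : ℝ) * k (q.1 - q.2) :=
    (hgr.comp measurable_fst).mul hksub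
  have hI : ∫⁻ q : (Fin 2 → ℝ) × (Fin 2 → ℝ), ‖g q.1‖ₑ ^ (2 : ℝ) * k (q.1 - q.2)
      ∂(volume.prod volume) = ENNReal.ofReal (4 * π ^ 2) * ∫⁻ y, ‖g y‖ₑ ^ (2 : ℝ) := by
    rw [lintegral_prod _ hm1.aemeasurable]
    have : ∀ y, ∫⁻ z, ‖g y‖ₑ ^ (2 : ℝ) * k (y - z) = ‖g y‖ₑ ^ (2 : ℝ) * ENNReal.ofReal (4 * π ^ 2) := by
      intro y
      rw [lintegral_const_mul (f := fun z => k (y - z)) _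
          (hkm.comp (measurable_const.sub measurable_id)),
        lintegral_sub_left_eq_self k y, hkint]
    simp_rw [this]
    rw [lintegral_mul_const _ hgr, mul_comm]
  have hI' : ∫⁻ q : (Fin 2 → ℝ) × (Fin 2 → ℝ), ‖g q.2‖ₑ ^ (2 : ℝ) * k (q.1 - q.2)
      ∂(volume.prod volume) = ENNReal.ofReal (4 * π ^ 2) * ∫⁻ y, ‖g y‖ₑ ^ (2 : ℝ) := by
    rw [← lintegral_prod_swap, ← hI]
    refine lintegral_congr fun q => ?_
    rw [← hkneg (q.1 - q.2), neg_sub]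
    rfl
  calc _ ≤ ∫⁻ q : (Fin 2 → ℝ) × (Fin 2 → ℝ), ‖g q.1 * (starRingEnd ℂ) (g q.2) *
        (((π / b : ℝ) : ℂ) * gaussC (1 / (4 * b)) (q.1 - q.2))‖ₑ ∂(volume.prod volume) :=
        enorm_integral_le_lintegral_enorm _
    _ ≤ ∫⁻ q : (Fin 2 → ℝ) × (Fin 2 → ℝ), (‖g q.1‖ₑ ^ (2 : ℝ) * k (q.1 - q.2)
          + ‖g q.2‖ₑ ^ (2 : ℝ) * k (q.1 - q.2)) ∂(volume.prod volume) := by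
        refine lintegral_mono fun q => ?_
        rw [enorm_mul, enorm_mul, ← add_mul]
        have : ‖(starRingEnd ℂ) (g q.2)‖ₑ = ‖g q.2‖ₑ := by
          rw [← ofReal_norm, ← ofReal_norm, RCLike.norm_conj]
        rw [this]
        exact mul_le_mul_left (mul_le_rpow_two_add _ _) _
    _ = ENNReal.ofReal (8 * π ^ 2) * ∫⁻ y, ‖g y‖ₑ ^ (2 : ℝ) := by
        rw [lintegral_add_left hm1, hI, hI', ← add_mul,
          ← ENNReal.ofReal_add (by positivity) (by positivity)]
        congr 2
        ring

lemma measurable_ftrans2 {g : (Fin 2 → ℝ) → ℂ} (hg : Measurable g) : Measurable (ftrans2 g) := by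
  have : Measurable fun q : (Fin 2 → ℝ) × (Fin 2 → ℝ) =>
      Complex.exp (-Complex.I * (dot2 q.2 q.1 : ℂ)) * g q.2 :=
    (measurable_cexp_dot2.comp measurable_swap).mul (hg.comp measurable_snd)
  exact (this.stronglyMeasurable.integral_prod_right' (ν := volume)).measurable

/-- Bessel-type form of Plancherel's theorem for integrable functions on `ℝ²`. -/
lemma lintegral_enorm_ftrans2_sq_le {g : (Fin 2 → ℝ) → ℂ}
    (hgm : Measurable g) (hg : Integrable g) :
    ∫⁻ x, ‖ftrans2 g x‖ₑ ^ (2 : ℝ) ≤ ENNReal.ofReal (8 * π ^ 2) * ∫⁻ y, ‖g y‖ₑ ^ (2 : ℝ) := by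
  have hb : ∀ n : ℕ, (0 : ℝ) < 1 / (n + 1) := fun n => by positivity
  have hlim : ∀ x, Filter.liminf
      (fun n : ℕ => ‖gaussC (1 / (n + 1)) x‖ₑ * ‖ftrans2 g x‖ₑ ^ (2 : ℝ)) Filter.atTop
      = ‖ftrans2 g x‖ₑ ^ (2 : ℝ) := by
    intro x
    apply Filter.Tendsto.liminf_eq
    have h1 : Filter.Tendsto (fun n : ℕ => gaussC (1 / ((n : ℝ) + 1)) x) Filter.atTop (nhds 1) := by
      have h2 : Continuous fun b : ℝ => gaussC b x := by
        unfold gaussC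
        fun_prop
      have := (h2.tendsto 0).comp (tendsto_one_div_add_atTop_nhds_zero_nat (𝕜 := ℝ))
      simpa [gaussC, Function.comp_def] using this
    have h3 := h1.enorm
    simp only [enorm_one] at h3
    simpa using ENNReal.Tendsto.mul_const h3 (b := ‖ftrans2 g x‖ₑ ^ (2 : ℝ)) (Or.inl one_ne_zero)
  calc ∫⁻ x, ‖ftrans2 g x‖ₑ ^ (2 : ℝ)
      = ∫⁻ x, Filter.liminf
        (fun n : ℕ => ‖gaussC (1 / (n + 1)) x‖ₑ * ‖ftrans2 g x‖ₑ ^ (2 : ℝ)) Filter.atTop := by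
        simp_rw [hlim]
    _ ≤ Filter.liminf (fun n : ℕ => ∫⁻ x, ‖gaussC (1 / (n + 1)) x‖ₑ * ‖ftrans2 g x‖ₑ ^ (2 : ℝ))
        Filter.atTop := lintegral_liminf_le fun n =>
          (measurable_gaussC _).enorm.mul ((measurable_ftrans2 hgm).enorm.pow_const _)
    _ ≤ _ := by
        refine Filter.liminf_le_of_le (by isBoundedDefault) fun B hB => ?_
        obtain ⟨n, hn⟩ := hB.exists
        exact hn.trans (lintegral_gaussC_mul_enorm_ftrans2_le (hb n) hgm hg)

/-- `L²` bound for the bilinear form attached to a bounded weight. -/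
lemma enorm_kernelForm_weight_le {w : (Fin 2 → ℝ) → ℂ} {V : Set (Fin 2 → ℝ)}
    (hw : IntegrableOn w V) (hw1 : ∀ x, ‖w x‖ ≤ 1) {g h : (Fin 2 → ℝ) → ℂ}
    (hgm : Measurable g) (hhm : Measurable h) (hg : Integrable g) (hh : Integrable h) :
    ‖kernelForm volume (fun q => ∫ x in V, w x * Complex.exp (-Complex.I * (dot2 (q.1 - q.2) x : ℂ)))
        g h‖ₑ
      ≤ ENNReal.ofReal (8 * π ^ 2) * ((∫⁻ y, ‖g y‖ₑ ^ (2 : ℝ)) ^ (1 / 2 : ℝ)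
          * (∫⁻ z, ‖h z‖ₑ ^ (2 : ℝ)) ^ (1 / 2 : ℝ)) := by
  have hen : ∀ z : ℂ, ‖(starRingEnd ℂ) z‖ₑ = ‖z‖ₑ := fun z => by
    rw [← ofReal_norm, ← ofReal_norm, RCLike.norm_conj]
  have hcm : Measurable fun z => (starRingEnd ℂ) (h z) :=
    Complex.continuous_conj.measurable.comp hhm
  have hci : Integrable fun z => (starRingEnd ℂ) (h z) :=
    (integrable_norm_iff hcm.aestronglyMeasurable).1 (by simpa using hh.norm)
  obtain ⟨-, he⟩ := integral_weight_mul_ftrans2 hw hg hci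
  simp only [Complex.conj_conj] at he
  rw [← he]
  have hP1 := lintegral_enorm_ftrans2_sq_le hgm hg
  have hP2 := lintegral_enorm_ftrans2_sq_le hcm hci
  simp only [hen] at hP2
  set h' := fun z => (starRingEnd ℂ) (h z) with hh'
  calc _ ≤ ∫⁻ x in V, ‖w x * (ftrans2 g x * (starRingEnd ℂ) (ftrans2 h' x))‖ₑ :=
        enorm_integral_le_lintegral_enorm _
    _ ≤ ∫⁻ x, ‖ftrans2 g x‖ₑ * ‖ftrans2 h' x‖ₑ := by
        refine (setLIntegral_le_lintegral _ _).trans (lintegral_mono fun x => ?_)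
        rw [enorm_mul, enorm_mul, hen]
        refine mul_le_of_le_one_left' ?_
        rw [← ofReal_norm]
        exact ENNReal.ofReal_le_one.2 (hw1 x)
    _ ≤ (∫⁻ x, ‖ftrans2 g x‖ₑ ^ (2 : ℝ)) ^ (1 / 2 : ℝ)
          * (∫⁻ x, ‖ftrans2 h' x‖ₑ ^ (2 : ℝ)) ^ (1 / 2 : ℝ) :=
        ENNReal.lintegral_mul_le_Lp_mul_Lq volume Real.HolderConjugate.two_two
          (measurable_ftrans2 hgm).enorm.aemeasurable (measurable_ftrans2 hcm).enorm.aemeasurable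
    _ ≤ (ENNReal.ofReal (8 * π ^ 2) * ∫⁻ y, ‖g y‖ₑ ^ (2 : ℝ)) ^ (1 / 2 : ℝ)
          * (ENNReal.ofReal (8 * π ^ 2) * ∫⁻ y, ‖h y‖ₑ ^ (2 : ℝ)) ^ (1 / 2 : ℝ) := by
        gcongr
    _ = _ := by
        rw [ENNReal.mul_rpow_of_nonneg _ _ (by norm_num), ENNReal.mul_rpow_of_nonneg _ _ (by norm_num)]
        have : ENNReal.ofReal (8 * π ^ 2) = ENNReal.ofReal (8 * π ^ 2) ^ (1 / 2 : ℝ)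
            * ENNReal.ofReal (8 * π ^ 2) ^ (1 / 2 : ℝ) := by
          rw [← ENNReal.rpow_add_of_nonneg _ _ (by norm_num) (by norm_num)]
          norm_num
        nth_rewrite 3 [this]
        ring

/-- The identification `ℝ² × ℝ² ≃ ℝ⁴`. -/
def joinFour (q : (Fin 2 → ℝ) × (Fin 2 → ℝ)) : Fin 4 → ℝ := ![q.1 0, q.1 1, q.2 0, q.2 1]

lemma continuous_joinFour : Continuous joinFour := by
  unfold joinFour
  fun_prop

lemma measurePreserving_joinFour : MeasurePreserving joinFour
    ((volume : Measure (Fin 2 → ℝ)).prod volume) volume := by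
  have h1 := volume_measurePreserving_sumPiEquivProdPi_symm (fun _ : Fin 2 ⊕ Fin 2 => ℝ)
  have h2 := volume_measurePreserving_piCongrLeft (fun _ : Fin 4 => ℝ)
    (finSumFinEquiv (m := 2) (n := 2))
  have h := h2.comp h1
  suffices e : joinFour = (MeasurableEquiv.piCongrLeft (fun _ : Fin 4 => ℝ)
      (finSumFinEquiv (m := 2) (n := 2))) ∘
        (MeasurableEquiv.sumPiEquivProdPi fun _ : Fin 2 ⊕ Fin 2 => ℝ).symm by
    rw [e]
    exact h
  funext q i
  obtain ⟨j, rfl⟩ := (finSumFinEquiv (m := 2) (n := 2)).surjective i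
  rw [Function.comp_apply]
  refine Eq.trans ?_ (MeasurableEquiv.piCongrLeft_apply_apply (β := fun _ : Fin 4 => ℝ)
    (finSumFinEquiv (m := 2) (n := 2)) _ j).symm
  rcases j with j | j <;> fin_cases j <;> rfl

lemma measurableEmbedding_joinFour : MeasurableEmbedding joinFour := by
  refine continuous_joinFour.measurableEmbedding fun q r h => ?_
  have h0 := congrFun h 0
  have h1 := congrFun h 1
  have h2 := congrFun h 2
  have h3 := congrFun h 3
  simp only [joinFour, Matrix.cons_val] at h0 h1 h2 h3
  refine Prod.ext (funext fun i => ?_) (funext fun i => ?_) <;> fin_cases i <;> assumption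

section
variable {V : Set (Fin 2 → ℝ)} {ψ : (Fin 2 → ℝ) → Fin 2 → ℝ} {F : (Fin 2 → ℝ) × (Fin 2 → ℝ) → ℂ}

/-- The Fourier transform of a function on `ℝ² × ℝ²` along the graph of `ψ`. -/
def graphTransform (ψ : (Fin 2 → ℝ) → Fin 2 → ℝ) (F : (Fin 2 → ℝ) × (Fin 2 → ℝ) → ℂ)
    (x : Fin 2 → ℝ) : ℂ :=
  ∫ q, Complex.exp (-Complex.I * ((dot2 q.1 x + dot2 q.2 (ψ x) : ℝ) : ℂ)) * F q
    ∂((volume : Measure (Fin 2 → ℝ)).prod volume)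

/-- The inner part of `graphTransform` at a fixed second variable. -/
def graphSlice (ψ : (Fin 2 → ℝ) → Fin 2 → ℝ) (F : (Fin 2 → ℝ) × (Fin 2 → ℝ) → ℂ)
    (x v : Fin 2 → ℝ) : ℂ :=
  Complex.exp (-Complex.I * (dot2 v (ψ x) : ℂ)) * ftrans2 (fun u => F (u, v)) x

lemma graphTransform_eq (hF : Integrable F ((volume : Measure (Fin 2 → ℝ)).prod volume))
    (x : Fin 2 → ℝ) : graphTransform ψ F x = ∫ v, graphSlice ψ F x v := by
  rw [graphTransform, integral_prod_symm]
  · refine integral_congr_ae (Filter.Eventually.of_forall fun v => ?_)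
    simp only [graphSlice, ftrans2]
    rw [← integral_const_mul]
    refine integral_congr_ae (Filter.Eventually.of_forall fun u => ?_)
    simp only
    rw [← mul_assoc, ← Complex.exp_add]
    congr 2
    push_cast
    ring
  · refine hF.bdd_mul (c := 1) ?_ (Filter.Eventually.of_forall fun q => (norm_cexp_neg_I_mul _).le)
    have : Continuous fun q : (Fin 2 → ℝ) × (Fin 2 → ℝ) => dot2 q.1 x + dot2 q.2 (ψ x) := by
      unfold dot2
      fun_prop
    exact (by fun_prop : Continuous fun q : (Fin 2 → ℝ) × (Fin 2 → ℝ) =>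
      Complex.exp (-Complex.I * ((dot2 q.1 x + dot2 q.2 (ψ x) : ℝ) : ℂ))).aestronglyMeasurable

lemma measurable_graphSlice (hψ : Measurable ψ) (hF : Measurable F) :
    Measurable fun q : (Fin 2 → ℝ) × (Fin 2 → ℝ) => graphSlice ψ F q.1 q.2 := by
  refine Measurable.mul ?_ ?_
  · exact measurable_cexp_dot2.comp (measurable_snd.prodMk (hψ.comp measurable_fst))
  · have : Measurable fun r : ((Fin 2 → ℝ) × (Fin 2 → ℝ)) × (Fin 2 → ℝ) =>
        Complex.exp (-Complex.I * (dot2 r.2 r.1.1 : ℂ)) * F (r.2, r.1.2) :=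
      (measurable_cexp_dot2.comp (measurable_snd.prodMk measurable_fst.fst)).mul
        (hF.comp (measurable_snd.prodMk measurable_fst.snd))
    exact (this.stronglyMeasurable.integral_prod_right' (ν := volume)).measurable

lemma norm_graphSlice_le (x v : Fin 2 → ℝ) : ‖graphSlice ψ F x v‖ ≤ ∫ u, ‖F (u, v)‖ := by
  rw [graphSlice, norm_mul, norm_cexp_neg_I_mul, one_mul, ftrans2]
  refine (norm_integral_le_integral_norm _).trans_eq ?_
  simp only [norm_mul, norm_cexp_neg_I_mul, one_mul]

/-- The kernel appearing in the `T T*` form of the restriction operator. -/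
def graphKernel (V : Set (Fin 2 → ℝ)) (ψ : (Fin 2 → ℝ) → Fin 2 → ℝ) (w : Fin 2 → ℝ)
    (q : (Fin 2 → ℝ) × (Fin 2 → ℝ)) : ℂ :=
  ∫ x in V, Complex.exp (-Complex.I * (dot2 w (ψ x) : ℂ))
    * Complex.exp (-Complex.I * (dot2 (q.1 - q.2) x : ℂ))

lemma measurable_graphKernel (hψ : Measurable ψ) (w : Fin 2 → ℝ) :
    Measurable (graphKernel V ψ w) := by
  have : Measurable fun r : ((Fin 2 → ℝ) × (Fin 2 → ℝ)) × (Fin 2 → ℝ) =>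
      Complex.exp (-Complex.I * (dot2 w (ψ r.2) : ℂ))
        * Complex.exp (-Complex.I * (dot2 (r.1.1 - r.1.2) r.2 : ℂ)) :=
    (measurable_cexp_dot2.comp (measurable_const.prodMk (hψ.comp measurable_snd))).mul
      (measurable_cexp_dot2.comp ((measurable_fst.fst.sub measurable_fst.snd).prodMk measurable_snd))
  exact (this.stronglyMeasurable.integral_prod_right' (ν := volume.restrict V)).measurable

lemma lintegral_graphTransform_sq_le (hV : volume V ≠ ⊤) (hψ : Measurable ψ) (hFm : Measurable F)
    (hF : Integrable F ((volume : Measure (Fin 2 → ℝ)).prod volume)) :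
    ∫⁻ x in V, ‖graphTransform ψ F x‖ₑ ^ 2 ≤ ∫⁻ v, ∫⁻ v',
      ‖∫ x in V, graphSlice ψ F x v * (starRingEnd ℂ) (graphSlice ψ F x v')‖ₑ := by
  have hVf : Fact (volume V < ⊤) := ⟨hV.lt_top⟩
  have hsm := measurable_graphSlice hψ hFm
  have hN := hF.swap.integral_norm_prod_left
  have hdom : Integrable (fun r : (Fin 2 → ℝ) × ((Fin 2 → ℝ) × (Fin 2 → ℝ)) =>
      (1 : ℝ) * ((∫ u, ‖F (u, r.2.1)‖) * ∫ u, ‖F (u, r.2.2)‖))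
      ((volume.restrict V).prod (volume.prod volume)) :=
    (integrable_const (1 : ℝ)).mul_prod (hN.mul_prod hN)
  have hm : Measurable fun r : (Fin 2 → ℝ) × ((Fin 2 → ℝ) × (Fin 2 → ℝ)) =>
      graphSlice ψ F r.1 r.2.1 * (starRingEnd ℂ) (graphSlice ψ F r.1 r.2.2) :=
    (hsm.comp (measurable_fst.prodMk measurable_snd.fst)).mul
      (Complex.continuous_conj.measurable.comp (hsm.comp (measurable_fst.prodMk measurable_snd.snd)))
  have hintg : Integrable (fun r : (Fin 2 → ℝ) × ((Fin 2 → ℝ) × (Fin 2 → ℝ)) =>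
      graphSlice ψ F r.1 r.2.1 * (starRingEnd ℂ) (graphSlice ψ F r.1 r.2.2))
      ((volume.restrict V).prod (volume.prod volume)) := by
    refine hdom.mono' hm.aestronglyMeasurable (Filter.Eventually.of_forall fun r => ?_)
    rw [norm_mul, RCLike.norm_conj, one_mul]
    exact mul_le_mul (norm_graphSlice_le _ _) (norm_graphSlice_le _ _) (norm_nonneg _)
      (integral_nonneg fun _ => norm_nonneg _)
  have e : ∀ x, ∫ q : (Fin 2 → ℝ) × (Fin 2 → ℝ),
      graphSlice ψ F x q.1 * (starRingEnd ℂ) (graphSlice ψ F x q.2) ∂(volume.prod volume)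
      = ((‖graphTransform ψ F x‖ ^ 2 : ℝ) : ℂ) := by
    intro x
    rw [integral_prod_mul (f := fun v => graphSlice ψ F x v)
      (g := fun v => (starRingEnd ℂ) (graphSlice ψ F x v)), integral_conj, ← graphTransform_eq hF,
      Complex.mul_conj, Complex.normSq_eq_norm_sq]
  have hi := hintg.integral_prod_left
  simp only [e] at hi
  have hi' : Integrable (fun x => ‖graphTransform ψ F x‖ ^ 2) (volume.restrict V) :=
    hi.re.congr (Filter.Eventually.of_forall fun x => by exact Complex.ofReal_re _)
  have e2 : ∫⁻ x in V, ‖graphTransform ψ F x‖ₑ ^ 2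
      = ‖∫ q : (Fin 2 → ℝ) × (Fin 2 → ℝ), (∫ x in V,
        graphSlice ψ F x q.1 * (starRingEnd ℂ) (graphSlice ψ F x q.2)) ∂(volume.prod volume)‖ₑ := by
    rw [← integral_integral_swap hintg]
    simp only [e]
    rw [integral_complex_ofReal, ← ofReal_norm, Complex.norm_real, Real.norm_eq_abs, abs_of_nonneg
      (integral_nonneg fun x => by positivity), ofReal_integral_eq_lintegral_ofReal hi'
      (Filter.Eventually.of_forall fun x => by positivity)]
    refine lintegral_congr fun x => ?_
    rw [ENNReal.ofReal_pow (norm_nonneg _), ofReal_norm]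
  rw [e2]
  refine (enorm_integral_le_lintegral_enorm _).trans_eq ?_
  rw [lintegral_prod]
  exact hintg.integral_prod_right.aestronglyMeasurable.enorm

end

section
variable {V : Set (Fin 2 → ℝ)} {ψ : (Fin 2 → ℝ) → Fin 2 → ℝ} {F : (Fin 2 → ℝ) × (Fin 2 → ℝ) → ℂ}

lemma integrable_cexp_neg_I_mul {X : Type*} [MeasurableSpace X] {μ : Measure X} [IsFiniteMeasure μ]
    {θ : X → ℝ} (hθ : Measurable θ) :
    Integrable (fun x => Complex.exp (-Complex.I * (θ x : ℂ))) μ := by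
  refine (integrable_const (1 : ℝ)).mono' ?_
    (Filter.Eventually.of_forall fun x => (norm_cexp_neg_I_mul _).le)
  exact (by fun_prop : Measurable fun x => Complex.exp (-Complex.I * (θ x : ℂ))).aestronglyMeasurable

lemma integral_graphSlice_mul_conj (hV : volume V ≠ ⊤) (hψ : Measurable ψ) {v v' : Fin 2 → ℝ}
    (hv : Integrable fun u => F (u, v)) (hv' : Integrable fun u => F (u, v')) :
    ∫ x in V, graphSlice ψ F x v * (starRingEnd ℂ) (graphSlice ψ F x v')
      = kernelForm volume (graphKernel V ψ (v - v')) (fun u => F (u, v))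
        (fun u => (starRingEnd ℂ) (F (u, v'))) := by
  have hVf : Fact (volume V < ⊤) := ⟨hV.lt_top⟩
  have hw : Integrable (fun x => Complex.exp (-Complex.I * (dot2 (v - v') (ψ x) : ℂ)))
      (volume.restrict V) :=
    integrable_cexp_neg_I_mul (continuous_dot2.measurable.comp (measurable_const.prodMk hψ))
  rw [show graphKernel V ψ (v - v') = _ from rfl]
  unfold graphKernel
  rw [← (integral_weight_mul_ftrans2 hw hv hv').2]
  refine integral_congr_ae (Filter.Eventually.of_forall fun x => ?_)
  simp only [graphSlice, map_mul, conj_cexp_neg_I_mul]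
  have e : Complex.exp (-Complex.I * (dot2 (v - v') (ψ x) : ℂ))
      = Complex.exp (-Complex.I * (dot2 v (ψ x) : ℂ))
        * Complex.exp (-Complex.I * ((-dot2 v' (ψ x) : ℝ) : ℂ)) := by
    rw [← Complex.exp_add]
    congr 1
    simp only [dot2, Pi.sub_apply]
    push_cast
    ring
  rw [e]
  ring

/-- **Tomas–Stein–Strichartz type restriction theorem** for a graph over a subset of `ℝ²`: decay of
order `γ` of the Fourier transform of the graph measure in the last two variables. -/
theorem restriction_of_decay {p : ℝ} (hp1 : 1 < p) (hp2 : p < 2) (hV : volume V ≠ ⊤)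
    (hψ : Measurable ψ) {C : ℝ}
    (hdecay : ∀ u w : Fin 2 → ℝ, w ≠ 0 →
      ‖∫ x in V, Complex.exp (-Complex.I * ((dot2 u x + dot2 w (ψ x) : ℝ) : ℂ))‖
        ≤ C * ‖w‖ ^ (-(4 * (p - 1) / (2 - p)))) :
    ∃ C' : ℝ, 0 < C' ∧ ∀ F : (Fin 2 → ℝ) × (Fin 2 → ℝ) → ℂ, Measurable F →
      Integrable F ((volume : Measure (Fin 2 → ℝ)).prod volume) →
      ∫⁻ x in V, ‖graphTransform ψ F x‖ₑ ^ 2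
        ≤ ENNReal.ofReal C' * (∫⁻ q, ‖F q‖ₑ ^ p ∂(volume.prod volume)) ^ (2 / p) := by
  have hVf : Fact (volume V < ⊤) := ⟨hV.lt_top⟩
  obtain ⟨K, hK, hhls⟩ := hls_fin_two hp1 hp2
  obtain ⟨C₁, hC₁, hker⟩ := exists_kernelForm_le (A₂ := 8 * π ^ 2) hp1 hp2 (by positivity)
    (Fin 2 → ℝ)
  refine ⟨C₁ * (|C| + 1) ^ (2 / p - 1) * K + 1, by positivity, fun F hFm hF => ?_⟩
  have hen : ∀ z : ℂ, ‖(starRingEnd ℂ) z‖ₑ = ‖z‖ₑ := fun z => by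
    rw [← ofReal_norm, ← ofReal_norm, RCLike.norm_conj]
  have hbound : ∀ v v' : Fin 2 → ℝ, v' ≠ v → (Integrable fun u => F (u, v)) →
      (Integrable fun u => F (u, v')) →
      ‖∫ x in V, graphSlice ψ F x v * (starRingEnd ℂ) (graphSlice ψ F x v')‖ₑ
        ≤ ENNReal.ofReal (C₁ * (|C| + 1) ^ (2 / p - 1)) *
          ((∫⁻ u, ‖F (u, v)‖ₑ ^ p) ^ (1 / p) * (∫⁻ u, ‖F (u, v')‖ₑ ^ p) ^ (1 / p)
            * ENNReal.ofReal (‖v - v'‖ ^ (-(4 * (1 - 1 / p))))) := by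
    intro v v' hne hv hv'
    have hw : v - v' ≠ 0 := sub_ne_zero.2 hne.symm
    have hw0 : 0 < ‖v - v'‖ := norm_pos_iff.2 hw
    have hFv : ∀ v, Measurable fun u => F (u, v) := fun v => hFm.comp measurable_prodMk_right
    have hcm : Measurable fun u => (starRingEnd ℂ) (F (u, v')) :=
      Complex.continuous_conj.measurable.comp (hFv v')
    have hci : Integrable fun u => (starRingEnd ℂ) (F (u, v')) :=
      (integrable_norm_iff hcm.aestronglyMeasurable).1 (by simpa using hv'.norm)
    rw [integral_graphSlice_mul_conj hV hψ hv hv']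
    have h := hker volume (graphKernel V ψ (v - v'))
      ((|C| + 1) * ‖v - v'‖ ^ (-(4 * (p - 1) / (2 - p)))) (by positivity)
      (measurable_graphKernel hψ _) (fun q => ?_) (fun g h hg hh hgi hhi => ?_)
      (fun u => F (u, v)) (fun u => (starRingEnd ℂ) (F (u, v'))) (hFv v) hcm hv hci
    · refine h.trans_eq ?_
      simp only [hen]
      rw [Real.mul_rpow (by positivity) (by positivity), ← Real.rpow_mul hw0.le,
        show -(4 * (p - 1) / (2 - p)) * (2 / p - 1) = -(4 * (1 - 1 / p)) by
          have : (2 - p) ≠ 0 := by linarith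
          have : p ≠ 0 := by linarith
          field_simp, ← mul_assoc C₁, ENNReal.ofReal_mul (by positivity)]
      ring
    · refine le_trans (le_of_eq ?_) ((hdecay (q.1 - q.2) (v - v') hw).trans ?_)
      · rw [graphKernel]
        congr 2
        funext x
        rw [← Complex.exp_add]
        congr 1
        push_cast
        ring
      · gcongr
        exact (le_abs_self C).trans (by linarith)
    · exact enorm_kernelForm_weight_le (integrable_cexp_neg_I_mul
        (continuous_dot2.measurable.comp (measurable_const.prodMk hψ)))
        (fun x => (norm_cexp_neg_I_mul _).le) hg hh hgi hhi
  have hae : ∀ᵐ v : Fin 2 → ℝ, Integrable fun u => F (u, v) := hF.prod_left_ae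
  have hFF : Measurable fun v => (∫⁻ u, ‖F (u, v)‖ₑ ^ p) ^ (1 / p) :=
    (Measurable.lintegral_prod_left' (f := fun q : (Fin 2 → ℝ) × (Fin 2 → ℝ) => ‖F q‖ₑ ^ p)
      (hFm.enorm.pow_const p)).pow_const _
  calc ∫⁻ x in V, ‖graphTransform ψ F x‖ₑ ^ 2
      ≤ ∫⁻ v, ∫⁻ v', ‖∫ x in V, graphSlice ψ F x v * (starRingEnd ℂ) (graphSlice ψ F x v')‖ₑ :=
        lintegral_graphTransform_sq_le hV hψ hFm hF
    _ ≤ ∫⁻ v, ∫⁻ v', ENNReal.ofReal (C₁ * (|C| + 1) ^ (2 / p - 1)) *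
          ((∫⁻ u, ‖F (u, v)‖ₑ ^ p) ^ (1 / p) * (∫⁻ u, ‖F (u, v')‖ₑ ^ p) ^ (1 / p)
            * ENNReal.ofReal (‖v - v'‖ ^ (-(4 * (1 - 1 / p))))) := by
        refine lintegral_mono_ae ?_
        filter_upwards [hae] with v hv
        refine lintegral_mono_ae ?_
        filter_upwards [hae, compl_mem_ae_iff.2 (measure_singleton v)] with v' hv' hne
        exact hbound v v' hne hv hv'
    _ = ENNReal.ofReal (C₁ * (|C| + 1) ^ (2 / p - 1)) * ∫⁻ v, ∫⁻ v',
          (∫⁻ u, ‖F (u, v)‖ₑ ^ p) ^ (1 / p) * (∫⁻ u, ‖F (u, v')‖ₑ ^ p) ^ (1 / p)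
            * ENNReal.ofReal (‖v - v'‖ ^ (-(4 * (1 - 1 / p)))) := by
        simp_rw [lintegral_const_mul' _ _ ENNReal.ofReal_ne_top]
    _ ≤ ENNReal.ofReal (C₁ * (|C| + 1) ^ (2 / p - 1)) * (ENNReal.ofReal K *
          (∫⁻ v, ((∫⁻ u, ‖F (u, v)‖ₑ ^ p) ^ (1 / p)) ^ p) ^ (2 / p)) :=
        mul_le_mul_right (hhls _ hFF) _
    _ = ENNReal.ofReal (C₁ * (|C| + 1) ^ (2 / p - 1) * K)
          * (∫⁻ q, ‖F q‖ₑ ^ p ∂(volume.prod volume)) ^ (2 / p) := by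
        rw [← mul_assoc, ← ENNReal.ofReal_mul (by positivity),
          lintegral_prod_symm _ (hFm.enorm.pow_const p).aemeasurable]
        simp_rw [← ENNReal.rpow_mul]
        rw [one_div_mul_cancel (by linarith)]
        simp_rw [ENNReal.rpow_one]
    _ ≤ _ := by
        gcongr
        linarith

end

lemma ftrans_graphMap_eq (ψ : (Fin 2 → ℝ) → Fin 2 → ℝ) (f : (Fin 4 → ℝ) → ℂ) (x : Fin 2 → ℝ) :
    ftrans f (graphMap ψ x) = graphTransform ψ (f ∘ joinFour) x := by
  rw [ftrans, graphTransform, ← measurePreserving_joinFour.integral_comp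
    measurableEmbedding_joinFour]
  refine integral_congr_ae (Filter.Eventually.of_forall fun q => ?_)
  simp only [Function.comp_apply, dot4, graphMap, joinFour, dot2, Matrix.cons_val]
  congr 4
  ring

lemma norm_setIntegral_le_of_slices {E : Type*} [MeasurableSpace E] {μ : Measure E} {T : ℝ × ℝ → E}
    (hT : MeasurePreserving T (volume.prod volume) μ) (hTe : MeasurableEmbedding T) {S : Set E}
    (hS : MeasurableSet S) {h : E → ℂ} (hh : IntegrableOn h S μ) {R B : ℝ} (hR0 : 0 ≤ R)
    (hR : ∀ y z, T (y, z) ∈ S → |y| ≤ R)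
    (hB : ∀ y, ‖∫ z in {z | T (y, z) ∈ S}, h (T (y, z))‖ ≤ B) :
    ‖∫ x in S, h x ∂μ‖ ≤ 2 * R * B := by
  have hi : Integrable (S.indicator h) μ := (integrable_indicator_iff hS).2 hh
  have hi2 : Integrable (fun q => S.indicator h (T q)) (volume.prod volume) :=
    (hT.integrable_comp_emb hTe).2 hi
  have hin : ∀ y, ∫ z, S.indicator h (T (y, z)) = ∫ z in {z | T (y, z) ∈ S}, h (T (y, z)) := by
    intro y
    have hm : MeasurableSet {z | T (y, z) ∈ S} :=
      (hTe.measurable.comp measurable_prodMk_left) hS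
    rw [← integral_indicator hm]
    rfl
  rw [← integral_indicator hS, ← hT.integral_comp hTe, integral_prod _ hi2]
  simp_rw [hin]
  refine (norm_integral_le_of_norm_le (g := (Icc (-R) R).indicator fun _ => B) ?_
    (Filter.Eventually.of_forall fun y => ?_)).trans_eq ?_
  · exact (integrable_indicator_iff measurableSet_Icc).2 (integrableOn_const (by simp))
  · by_cases hy : y ∈ Icc (-R) R
    · rw [indicator_of_mem hy]
      exact hB y
    · have : {z | T (y, z) ∈ S} = ∅ := by
        ext z
        simp only [mem_ofPred_eq, mem_empty_iff_false, iff_false]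
        exact fun hz => hy (abs_le.1 (hR y z hz))
      rw [indicator_of_notMem hy, this]
      simp
  · rw [integral_indicator measurableSet_Icc, setIntegral_const]
    simp only [measureReal_def, volume_Icc, smul_eq_mul, sub_neg_eq_add]
    rw [ENNReal.toReal_ofReal (by linarith)]
    ring

/-- The point `(y, z)` of the plane. -/
def pairMap (q : ℝ × ℝ) : Fin 2 → ℝ := ![q.1, q.2]

lemma measurePreserving_pairMap : MeasurePreserving pairMap (volume.prod volume) volume :=
  (volume_preserving_finTwoArrow ℝ).symm

lemma measurableEmbedding_pairMap : MeasurableEmbedding pairMap :=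
  (MeasurableEquiv.finTwoArrow (α := ℝ)).symm.measurableEmbedding

/-- The point `(z, y + τ z)` of the plane. -/
def shearMap (τ : ℝ) (q : ℝ × ℝ) : Fin 2 → ℝ := ![q.2, q.1 + τ * q.2]

lemma measurePreserving_shearMap (τ : ℝ) :
    MeasurePreserving (shearMap τ) (volume.prod volume) volume := by
  have h1 : MeasurePreserving (fun q : ℝ × ℝ => (q.1, q.2 + τ * q.1)) (volume.prod volume)
      (volume.prod volume) :=
    (MeasurePreserving.id volume).skew_product (g := fun x y => y + τ * x) (by fun_prop)
      (Filter.Eventually.of_forall fun x => (measurePreserving_add_right volume (τ * x)).map_eq)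
  exact measurePreserving_pairMap.comp (h1.comp Measure.measurePreserving_swap)

lemma measurableEmbedding_shearMap (τ : ℝ) : MeasurableEmbedding (shearMap τ) := by
  have hc : Continuous (shearMap τ) := by
    unfold shearMap
    fun_prop
  refine hc.measurableEmbedding fun q r h => ?_
  have h0 := congrFun h 0
  have h1 := congrFun h 1
  simp only [shearMap, Matrix.cons_val] at h0 h1
  rw [h0] at h1
  exact Prod.ext (by linarith) h0

/-- The derivative of order `j` of `ζ₀ g₀ + ζ₁ g₁`. -/
def pairDeriv (g : Fin 2 → ℝ → ℝ) (j : ℕ) (ζ : Fin 2 → ℝ) (s : ℝ) : ℝ :=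
  ζ 0 * iteratedDeriv j (g 0) s + ζ 1 * iteratedDeriv j (g 1) s

section
variable {g : Fin 2 → ℝ → ℝ} {U : Set ℝ}

lemma analyticAt_iteratedDeriv' {f : ℝ → ℝ} {x : ℝ} (h : AnalyticAt ℝ f x) (j : ℕ) :
    AnalyticAt ℝ (iteratedDeriv j f) x := by
  rw [iteratedDeriv_eq_iterate]
  exact h.iterated_deriv j

lemma analyticAt_pairDeriv (hg : ∀ i, AnalyticOnNhd ℝ (g i) U) (j : ℕ) (ζ : Fin 2 → ℝ) :
    AnalyticOnNhd ℝ (pairDeriv g j ζ) U := fun s hs =>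
  (analyticAt_const.mul (analyticAt_iteratedDeriv' (hg 0 s hs) j)).add
    (analyticAt_const.mul (analyticAt_iteratedDeriv' (hg 1 s hs) j))

lemma hasDerivAt_pairDeriv (hg : ∀ i, AnalyticOnNhd ℝ (g i) U) (j : ℕ) (ζ : Fin 2 → ℝ) {s : ℝ}
    (hs : s ∈ U) : HasDerivAt (pairDeriv g j ζ) (pairDeriv g (j + 1) ζ s) s := by
  unfold pairDeriv
  rw [iteratedDeriv_succ, iteratedDeriv_succ]
  exact ((analyticAt_iteratedDeriv' (hg 0 s hs) j).differentiableAt.hasDerivAt.const_mul _).add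
    ((analyticAt_iteratedDeriv' (hg 1 s hs) j).differentiableAt.hasDerivAt.const_mul _)

lemma continuousAt_pairDeriv (hg : ∀ i, AnalyticOnNhd ℝ (g i) U) (j : ℕ)
    {q : (Fin 2 → ℝ) × ℝ} (hs : q.2 ∈ U) :
    ContinuousAt (fun q : (Fin 2 → ℝ) × ℝ => pairDeriv g j q.1 q.2) q := by
  have h : ∀ i, ContinuousAt (fun q : (Fin 2 → ℝ) × ℝ => iteratedDeriv j (g i) q.2) q := fun i =>
    ContinuousAt.comp (g := iteratedDeriv j (g i)) (f := Prod.snd)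
      (analyticAt_iteratedDeriv' (hg i q.2 hs) j).continuousAt continuousAt_snd
  have h0 := h 0
  have h1 := h 1
  unfold pairDeriv
  fun_prop

end

/-- The set of `x` with `x₀ ∈ I` and `x₁ = s x₀ᵏ` for some `s ∈ J`. -/
def wedge (k : ℝ) (I J : Set ℝ) : Set (Fin 2 → ℝ) := {x | x 0 ∈ I ∧ x 1 * x 0 ^ (-k) ∈ J}

/-- The phase `u · x + L x₀ʳ G_ζ(x₁ x₀⁻ᵏ)`. -/
def wedgePhase (k r : ℝ) (g : Fin 2 → ℝ → ℝ) (u ζ : Fin 2 → ℝ) (L : ℝ) (x : Fin 2 → ℝ) : ℝ :=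
  dot2 u x + L * (x 0 ^ r * pairDeriv g 0 ζ (x 1 * x 0 ^ (-k)))

lemma measurable_wedge_coord (k : ℝ) : Measurable fun x : Fin 2 → ℝ => x 1 * x 0 ^ (-k) := by
  fun_prop

lemma measurableSet_wedge (k : ℝ) {I J : Set ℝ} (hI : MeasurableSet I) (hJ : MeasurableSet J) :
    MeasurableSet (wedge k I J) :=
  (measurable_pi_apply 0 hI).inter (measurable_wedge_coord k hJ)

lemma abs_mem_wedge_le {k ε M : ℝ} (hk : 0 < k) (hε : 0 < ε) {J : Set ℝ} (hJ : ∀ s ∈ J, |s| ≤ M)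
    {x : Fin 2 → ℝ} (hx : x ∈ wedge k (Ico ε 1) J) : |x 1| ≤ M := by
  obtain ⟨h0, h1⟩ := hx
  have hx0 : 0 < x 0 := hε.trans_le h0.1
  have e : x 1 = (x 1 * x 0 ^ (-k)) * x 0 ^ k := by
    rw [mul_assoc, ← Real.rpow_add hx0]
    simp
  rw [e, abs_mul, abs_of_pos (Real.rpow_pos_of_pos hx0 _)]
  have h2 := hJ _ h1
  have h3 : x 0 ^ k ≤ 1 := Real.rpow_le_one hx0.le h0.2.le hk.le
  nlinarith [abs_nonneg (x 1 * x 0 ^ (-k)), Real.rpow_nonneg hx0.le k]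

lemma volume_wedge_ne_top {k ε M : ℝ} (hk : 0 < k) (hε : 0 < ε) {J : Set ℝ}
    (hJ : ∀ s ∈ J, |s| ≤ M) : volume (wedge k (Ico ε 1) J) ≠ ⊤ := by
  have hsub : wedge k (Ico ε 1) J ⊆ Metric.closedBall 0 (max 1 M) := by
    intro x hx
    have h1 := abs_mem_wedge_le hk hε hJ hx
    have h0 := hx.1
    rw [mem_closedBall_zero_iff, pi_norm_le_iff_of_nonneg (by positivity)]
    intro i
    fin_cases i
    · exact le_max_of_le_left (abs_le.2 ⟨by have := h0.1; simp only [Fin.zero_eta]; linarith, h0.2.le⟩)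
    · exact le_max_of_le_right h1
  exact ((measure_mono hsub).trans_lt measure_closedBall_lt_top).ne

section
variable {g : Fin 2 → ℝ → ℝ} {U : Set ℝ} {k r ε M : ℝ}

lemma continuousOn_wedgePhase (hg : ∀ i, AnalyticOnNhd ℝ (g i) U) (hε : 0 < ε) {J : Set ℝ}
    (hJ : J ⊆ U) (u ζ : Fin 2 → ℝ) (L : ℝ) :
    ContinuousOn (wedgePhase k r g u ζ L) (wedge k (Ico ε 1) J) := by
  intro x hx
  have hx0 : x 0 ≠ 0 := (hε.trans_le hx.1.1).ne'
  have h1 : ContinuousAt (fun x : Fin 2 → ℝ => x 1 * x 0 ^ (-k)) x :=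
    (continuous_apply 1).continuousAt.mul
      ((continuous_apply 0).continuousAt.rpow_const (Or.inl hx0))
  have h2 : ContinuousAt (fun x : Fin 2 → ℝ => pairDeriv g 0 ζ (x 1 * x 0 ^ (-k))) x :=
    ContinuousAt.comp (g := pairDeriv g 0 ζ) (f := fun x : Fin 2 → ℝ => x 1 * x 0 ^ (-k))
      (analyticAt_pairDeriv hg 0 ζ _ (hJ hx.2)).continuousAt h1
  have h3 : ContinuousAt (fun x : Fin 2 → ℝ => x 0 ^ r) x :=
    (continuous_apply 0).continuousAt.rpow_const (Or.inl hx0)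
  have h4 : ContinuousAt (fun x : Fin 2 → ℝ => dot2 u x) x :=
    (continuous_dot2.comp (Continuous.prodMk_right u)).continuousAt
  exact (h4.add (continuousAt_const.mul (h3.mul h2))).continuousWithinAt

lemma integrableOn_cexp_wedgePhase (hg : ∀ i, AnalyticOnNhd ℝ (g i) U) (hk : 0 < k) (hε : 0 < ε)
    {J : Set ℝ} (hJm : MeasurableSet J) (hJ : J ⊆ U) (hJM : ∀ s ∈ J, |s| ≤ M)
    (u ζ : Fin 2 → ℝ) (L : ℝ) :
    IntegrableOn (fun x => Complex.exp (-Complex.I * (wedgePhase k r g u ζ L x : ℂ)))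
      (wedge k (Ico ε 1) J) := by
  have hc := continuousOn_wedgePhase (k := k) (r := r) hg hε hJ u ζ L
  refine IntegrableOn.of_bound (volume_wedge_ne_top hk hε hJM).lt_top
    (ContinuousOn.aestronglyMeasurable ?_ (measurableSet_wedge k measurableSet_Ico hJm)) 1
    (Filter.Eventually.of_forall fun x => (norm_cexp_neg_I_mul _).le)
  exact Complex.continuous_exp.comp_continuousOn
    (continuousOn_const.mul (Complex.continuous_ofReal.comp_continuousOn hc))

lemma rpow_abs_le_rpow (hε : 0 < ε) {y : ℝ} (hy : ε ≤ y) (hy1 : y ≤ 1) (e : ℝ) :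
    ε ^ |e| ≤ y ^ e := by
  have hy0 : 0 < y := hε.trans_le hy
  calc ε ^ |e| ≤ y ^ |e| := Real.rpow_le_rpow hε.le hy (abs_nonneg e)
    _ ≤ y ^ e := Real.rpow_le_rpow_of_exponent_ge hy0 hy1 (le_abs_self e)

lemma rpow_le_rpow_neg_abs (hε : 0 < ε) {y : ℝ} (hy : ε ≤ y) (hy1 : y ≤ 1) (e : ℝ) :
    y ^ e ≤ ε ^ (-|e|) := by
  have hy0 : 0 < y := hε.trans_le hy
  calc y ^ e ≤ y ^ (-|e|) := Real.rpow_le_rpow_of_exponent_ge hy0 hy1 (neg_abs_le e)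
    _ ≤ ε ^ (-|e|) := Real.rpow_le_rpow_of_nonpos hε hy (by simp)

lemma cexp_neg_I_eq (t : ℝ) :
    Complex.exp (-Complex.I * (t : ℂ)) = Complex.exp (Complex.I * ((-t : ℝ) : ℂ)) := by
  congr 1
  push_cast
  ring

/-- Oscillatory integral bound on a wedge when a derivative of order `N ≥ 2` of `G_ζ` does not
vanish; the slices are vertical. -/
lemma exists_wedge_bound_of_pairDeriv (hg : ∀ i, AnalyticOnNhd ℝ (g i) U) (hk : 0 < k) (hε : 0 < ε)
    {N : ℕ} (hN : 2 ≤ N) : ∃ C : ℝ, 0 ≤ C ∧ ∀ (J : Set ℝ) (ζ u : Fin 2 → ℝ) (M c L : ℝ),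
      J.OrdConnected → J ⊆ U → (∀ s ∈ J, |s| ≤ M) → 0 < c → 0 < L →
      (∀ s ∈ J, c ≤ |pairDeriv g N ζ s|) →
      ‖∫ x in wedge k (Ico ε 1) J, Complex.exp (-Complex.I * (wedgePhase k r g u ζ L x : ℂ))‖
        ≤ C * (L * c) ^ (-(1 / N : ℝ)) := by
  obtain ⟨C, hC, hv⟩ := exists_vdc_ordConnected hN
  refine ⟨2 * 1 * (C * (ε ^ |r - k * N|) ^ (-(1 / N : ℝ))), by positivity,
    fun J ζ u M c L hJ hJU hJM hc hL hlow => ?_⟩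
  have hi := integrableOn_cexp_wedgePhase (k := k) (r := r) hg hk hε hJ.measurableSet hJU hJM u ζ L
  rw [mul_assoc (2 * 1), mul_assoc C, ← Real.mul_rpow (by positivity) (by positivity)]
  refine norm_setIntegral_le_of_slices measurePreserving_pairMap measurableEmbedding_pairMap
    (measurableSet_wedge k measurableSet_Ico hJ.measurableSet) hi zero_le_one ?_ ?_
  · rintro y z ⟨hy, -⟩
    simp only [pairMap, Matrix.cons_val] at hy
    exact abs_le.2 ⟨by linarith [hy.1], hy.2.le⟩
  · intro y
    by_cases hy : y ∈ Ico ε 1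
    swap
    · have : {z | pairMap (y, z) ∈ wedge k (Ico ε 1) J} = ∅ := by
        ext z
        simp only [mem_ofPred_eq, mem_empty_iff_false, iff_false]
        exact fun hz => hy hz.1
      rw [this]
      simp only [Measure.restrict_empty, integral_zero_measure, norm_zero]
      positivity
    have hy0 : 0 < y := hε.trans_le hy.1
    have hS : {z | pairMap (y, z) ∈ wedge k (Ico ε 1) J} = (fun z => z * y ^ (-k)) ⁻¹' J := by
      ext z
      simp only [mem_ofPred_eq, wedge, pairMap, Matrix.cons_val, mem_preimage]
      exact ⟨fun h => h.2, fun h => ⟨hy, h⟩⟩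
    rw [hS]
    have hyk : 0 < y ^ (-k) := Real.rpow_pos_of_pos hy0 _
    obtain ⟨f, hf0, hf1, hfN⟩ : ∃ f : ℕ → ℝ → ℝ,
        (f 0 = fun z => -(u 0 * y + u 1 * z + L * (y ^ r * pairDeriv g 0 ζ (z * y ^ (-k))))) ∧
        (f 1 = fun z => -(u 1 + L * (y ^ r * (pairDeriv g 1 ζ (z * y ^ (-k)) * y ^ (-k))))) ∧
        ∀ i, f (i + 2) = fun z =>
          -(L * (y ^ r * (pairDeriv g (i + 2) ζ (z * y ^ (-k)) * (y ^ (-k)) ^ (i + 2)))) :=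
      ⟨fun i => match i with
        | 0 => _
        | 1 => _
        | (i + 2) => fun z =>
          -(L * (y ^ r * (pairDeriv g (i + 2) ζ (z * y ^ (-k)) * (y ^ (-k)) ^ (i + 2)))), rfl, rfl, fun i => rfl⟩
    have hD : ∀ j, ∀ z ∈ (fun z => z * y ^ (-k)) ⁻¹' J,
        HasDerivAt (fun z => pairDeriv g j ζ (z * y ^ (-k)))
          (pairDeriv g (j + 1) ζ (z * y ^ (-k)) * y ^ (-k)) z := by
      intro j z hz
      have h1 : HasDerivAt (fun z => z * y ^ (-k)) (y ^ (-k)) z := by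
        simpa using (hasDerivAt_id z).mul_const (y ^ (-k))
      exact HasDerivAt.comp z (hasDerivAt_pairDeriv hg j ζ (hJU hz)) h1
    have hf : ∀ i, ∀ z ∈ (fun z => z * y ^ (-k)) ⁻¹' J, HasDerivAt (f i) (f (i + 1) z) z := by
      intro i z hz
      have h := hD i z hz
      match i with
      | 0 =>
        have h1 : HasDerivAt (fun z => u 0 * y + u 1 * z) (u 1) z := by
          simpa using ((hasDerivAt_id z).const_mul (u 1)).const_add (u 0 * y)
        rw [hf0, hf1]
        exact (h1.add ((h.const_mul (y ^ r)).const_mul L)).neg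
      | 1 =>
        rw [hf1, hfN 0]
        refine ((((h.mul_const (y ^ (-k))).const_mul (y ^ r)).const_mul L).const_add
          (u 1)).neg.congr_deriv ?_
        ring
      | (i + 2) =>
        rw [hfN i, show i + 2 + 1 = i + 1 + 2 by ring, hfN (i + 1)]
        refine (((h.mul_const ((y ^ (-k)) ^ (i + 2))).const_mul (y ^ r)).const_mul L).neg.congr_deriv ?_
        ring
    have hoc : ((fun z => z * y ^ (-k)) ⁻¹' J).OrdConnected :=
      hJ.preimage_mono fun z z' h => mul_le_mul_of_nonneg_right h hyk.le
    have hb : Bornology.IsBounded ((fun z => z * y ^ (-k)) ⁻¹' J) := by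
      refine (Metric.isBounded_Icc (-(M / y ^ (-k))) (M / y ^ (-k))).subset fun z hz => ?_
      have := hJM _ hz
      rw [abs_mul, abs_of_pos hyk, ← le_div_iff₀ hyk] at this
      exact abs_le.1 this
    have key := hv _ (L * c * ε ^ |r - k * N|) f hoc hb (by positivity) hf (fun z hz => ?_)
    · rw [mul_comm (ε ^ _)]
      refine le_trans (le_of_eq ?_) key
      congr 2
      funext z
      rw [cexp_neg_I_eq]
      simp only [hf0, wedgePhase, pairMap, dot2, Matrix.cons_val]
    · have hfN' : f N = fun z =>
          -(L * (y ^ r * (pairDeriv g N ζ (z * y ^ (-k)) * (y ^ (-k)) ^ N))) := by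
        obtain ⟨j, rfl⟩ := Nat.exists_eq_add_of_le' hN
        exact hfN j
      rw [hfN', abs_neg, abs_mul, abs_mul, abs_mul, abs_of_pos hL,
        abs_of_pos (Real.rpow_pos_of_pos hy0 _), abs_of_pos (pow_pos hyk N)]
      have h1 : y ^ r * (y ^ (-k)) ^ N = y ^ (r - k * N) := by
        rw [← Real.rpow_mul_natCast hy0.le, ← Real.rpow_add hy0]
        congr 1
        ring
      have h2 := rpow_abs_le_rpow hε hy.1 hy.2.le (r - k * N)
      calc L * c * ε ^ |r - k * N| ≤ L * |pairDeriv g N ζ (z * y ^ (-k))| * y ^ (r - k * N) := by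
            gcongr
            exact hlow _ hz
        _ = _ := by rw [← h1]; ring

end

/-- The second derivative test on a bounded interval, for an analytic phase. -/
lemma exists_vdc_two : ∃ C : ℝ, 0 ≤ C ∧ ∀ (S : Set ℝ) (μ : ℝ) (f₀ f₁ f₂ : ℝ → ℝ),
    S.OrdConnected → Bornology.IsBounded S → 0 < μ → AnalyticOnNhd ℝ f₀ S →
    (∀ x ∈ S, ∀ᶠ y in nhds x, HasDerivAt f₀ (f₁ y) y) → (∀ x ∈ S, HasDerivAt f₁ (f₂ x) x) →
    (∀ x ∈ S, μ ≤ |f₂ x|) →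
    ‖∫ x in S, Complex.exp (Complex.I * (f₀ x : ℂ))‖ ≤ C * μ ^ (-(1 / 2 : ℝ)) := by
  obtain ⟨C, hC, hv⟩ := exists_vdc_ordConnected le_rfl
  refine ⟨C, hC, fun S μ f₀ f₁ f₂ hS hb hμ ha h1 h2 h3 => ?_⟩
  have := hv S μ (fun i => iteratedDeriv i f₀) hS hb hμ (fun i x hx => ?_) (fun x hx => ?_)
  · simpa using this
  · rw [iteratedDeriv_succ]
    exact (analyticAt_iteratedDeriv' (ha x hx) i).differentiableAt.hasDerivAt
  · have e : deriv f₀ =ᶠ[nhds x] f₁ := (h1 x hx).mono fun y hy => hy.deriv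
    rw [iteratedDeriv_succ, iteratedDeriv_one, e.deriv_eq, (h2 x hx).deriv]
    exact h3 x hx

lemma abs_rpow_sub_rpow_le {k ε : ℝ} (hk : 0 < k) (hε : 0 < ε) {y z : ℝ} (hy : y ∈ Icc ε 1)
    (hz : z ∈ Icc ε 1) : |z ^ k - y ^ k| ≤ k * ε ^ (-|k - 1|) * |z - y| := by
  refine (convex_Icc ε 1).norm_image_sub_le_of_norm_hasDerivWithin_le (f := fun x => x ^ k)
    (f' := fun x => k * x ^ (k - 1)) (fun x hx => ?_) (fun x hx => ?_) hy hz
  · exact (Real.hasDerivAt_rpow_const (Or.inl (hε.trans_le hx.1).ne')).hasDerivWithinAt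
  · rw [Real.norm_eq_abs, abs_mul, abs_of_pos hk,
      abs_of_pos (Real.rpow_pos_of_pos (hε.trans_le hx.1) _)]
    exact mul_le_mul_of_nonneg_left (rpow_le_rpow_neg_abs hε hx.1 hx.2 _) hk.le

/-- The second derivative in `z` of `zʳ G((y + τ z) z⁻ᵏ)`, in terms of the values of `G`, `G'`,
`G''` at `s = (y + τ z) z⁻ᵏ`. -/
def slantDeriv (k r τ G₀ G₁ G₂ s z : ℝ) : ℝ :=
  r * (r - 1) * z ^ (r - 2) * G₀ +
    (2 * (r * z ^ (r - 1)) * (τ * z ^ (-k) - k * s * z⁻¹) +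
      z ^ r * (-(2 * k * τ * z ^ (-k) * z⁻¹) + k * (k + 1) * s * z⁻¹ ^ 2)) * G₁ +
    z ^ r * (τ * z ^ (-k) - k * s * z⁻¹) ^ 2 * G₂

section
variable {g : Fin 2 → ℝ → ℝ} {U : Set ℝ} {k r ε M : ℝ}

lemma hasDerivAt_slant {τ y z : ℝ} (hz : 0 < z) :
    HasDerivAt (fun z => (y + τ * z) * z ^ (-k))
      (τ * z ^ (-k) - k * ((y + τ * z) * z ^ (-k)) * z⁻¹) z := by
  have h1 : HasDerivAt (fun z => y + τ * z) τ z := by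
    simpa using ((hasDerivAt_id z).const_mul τ).const_add y
  refine (h1.mul (Real.hasDerivAt_rpow_const (p := -k) (Or.inl hz.ne'))).congr_deriv ?_
  rw [Real.rpow_sub_one hz.ne']
  ring

lemma hasDerivAt_slantPhase (hg : ∀ i, AnalyticOnNhd ℝ (g i) U) {τ y z : ℝ} (hz : 0 < z)
    (hU : (y + τ * z) * z ^ (-k) ∈ U) (u ζ : Fin 2 → ℝ) (L : ℝ) :
    HasDerivAt (fun z => -(u 0 * z + u 1 * (y + τ * z) +
        L * (z ^ r * pairDeriv g 0 ζ ((y + τ * z) * z ^ (-k)))))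
      (-(u 0 + u 1 * τ + L * (r * z ^ (r - 1) * pairDeriv g 0 ζ ((y + τ * z) * z ^ (-k)) +
        z ^ r * (pairDeriv g 1 ζ ((y + τ * z) * z ^ (-k)) *
          (τ * z ^ (-k) - k * ((y + τ * z) * z ^ (-k)) * z⁻¹))))) z := by
  have h1 : HasDerivAt (fun z => u 0 * z + u 1 * (y + τ * z)) (u 0 + u 1 * τ) z := by
    have a1 : HasDerivAt (fun z => u 0 * z) (u 0) z := by
      simpa using (hasDerivAt_id z).const_mul (u 0)
    have a2 : HasDerivAt (fun z => y + τ * z) τ z := by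
      simpa using ((hasDerivAt_id z).const_mul τ).const_add y
    exact a1.add (a2.const_mul (u 1))
  have h2 := HasDerivAt.comp z (hasDerivAt_pairDeriv hg 0 ζ hU) (hasDerivAt_slant (k := k) hz)
  have h3 := (Real.hasDerivAt_rpow_const (p := r) (Or.inl hz.ne')).mul h2
  exact (h1.add (h3.const_mul L)).neg

lemma hasDerivAt_slantPhase_deriv (hg : ∀ i, AnalyticOnNhd ℝ (g i) U) {τ y z : ℝ} (hz : 0 < z)
    (hU : (y + τ * z) * z ^ (-k) ∈ U) (u ζ : Fin 2 → ℝ) (L : ℝ) :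
    HasDerivAt (fun z => -(u 0 + u 1 * τ +
      L * (r * z ^ (r - 1) * pairDeriv g 0 ζ ((y + τ * z) * z ^ (-k)) +
        z ^ r * (pairDeriv g 1 ζ ((y + τ * z) * z ^ (-k)) *
          (τ * z ^ (-k) - k * ((y + τ * z) * z ^ (-k)) * z⁻¹)))))
      (-(L * slantDeriv k r τ (pairDeriv g 0 ζ ((y + τ * z) * z ^ (-k)))
        (pairDeriv g 1 ζ ((y + τ * z) * z ^ (-k))) (pairDeriv g 2 ζ ((y + τ * z) * z ^ (-k)))
        ((y + τ * z) * z ^ (-k)) z)) z := by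
  have hS := hasDerivAt_slant (k := k) (τ := τ) (y := y) hz
  have h0 := HasDerivAt.comp z (hasDerivAt_pairDeriv hg 0 ζ hU) hS
  have h1 := HasDerivAt.comp z (hasDerivAt_pairDeriv hg 1 ζ hU) hS
  have p1 := (Real.hasDerivAt_rpow_const (x := z) (p := r - 1) (Or.inl hz.ne')).const_mul r
  have p0 := Real.hasDerivAt_rpow_const (x := z) (p := r) (Or.inl hz.ne')
  have pk := (Real.hasDerivAt_rpow_const (x := z) (p := -k) (Or.inl hz.ne')).const_mul τ
  have pi := hasDerivAt_inv hz.ne'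
  have hA := (p1.mul h0).add (p0.mul (h1.mul (pk.sub ((hS.const_mul k).mul pi))))
  refine ((hA.const_mul L).const_add (u 0 + u 1 * τ)).neg.congr_deriv ?_
  simp only [Function.comp, slantDeriv, Pi.mul_apply, Pi.sub_apply]
  rw [show r - 1 - 1 = r - 2 by ring, Real.rpow_sub_one hz.ne' (-k)]
  ring

/-- Slices of a wedge along lines of large slope are intervals. -/
lemma ordConnected_slant (hk : 0 < k) (hε : 0 < ε) {J : Set ℝ} (hJ : J.OrdConnected)
    (hJM : ∀ s ∈ J, |s| ≤ M) {τ : ℝ} (hτ : M * (k * ε ^ (-|k - 1|)) ≤ τ) (y : ℝ) :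
    {z | shearMap τ (y, z) ∈ wedge k (Ico ε 1) J}.OrdConnected := by
  have key : ∀ e z w, |e| ≤ M → z ∈ Ico ε 1 → w ∈ Ico ε 1 → z ≤ w →
      e * (w ^ k - z ^ k) ≤ τ * (w - z) := by
    intro e z w he hz hw hzw
    have h := abs_rpow_sub_rpow_le hk hε ⟨hz.1, hz.2.le⟩ ⟨hw.1, hw.2.le⟩
    have hM := (abs_nonneg e).trans he
    calc e * (w ^ k - z ^ k) ≤ |e| * |w ^ k - z ^ k| := by
          rw [← abs_mul]
          exact le_abs_self _
      _ ≤ M * (k * ε ^ (-|k - 1|) * |w - z|) := by gcongr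
      _ = M * (k * ε ^ (-|k - 1|)) * (w - z) := by
          rw [abs_of_nonneg (sub_nonneg.2 hzw)]
          ring
      _ ≤ _ := mul_le_mul_of_nonneg_right hτ (sub_nonneg.2 hzw)
  refine ⟨fun z₁ h₁ z₂ h₂ z hz => ?_⟩
  obtain ⟨i₁, j₁⟩ := h₁
  obtain ⟨i₂, j₂⟩ := h₂
  simp only [shearMap, Matrix.cons_val] at i₁ i₂ j₁ j₂
  have i : z ∈ Ico ε 1 := ⟨i₁.1.trans hz.1, hz.2.trans_lt i₂.2⟩
  have hp : ∀ w ∈ Ico ε 1, w ^ (-k) * w ^ k = 1 := by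
    intro w hw
    rw [← Real.rpow_add (hε.trans_le hw.1)]
    simp
  have hz0 : 0 < z ^ k := Real.rpow_pos_of_pos (hε.trans_le i.1) _
  refine ⟨i, hJ.out j₁ j₂ ⟨?_, ?_⟩⟩
  · simp only [shearMap, Matrix.cons_val]
    refine le_of_mul_le_mul_right ?_ hz0
    have h := key _ _ _ (hJM _ j₁) i₁ i hz.1
    rw [mul_sub, mul_assoc _ (z₁ ^ (-k)) (z₁ ^ k), hp _ i₁] at h
    rw [mul_assoc _ (z ^ (-k)), hp _ i]
    linarith
  · simp only [shearMap, Matrix.cons_val]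
    refine le_of_mul_le_mul_right ?_ hz0
    have h := key _ _ _ (hJM _ j₂) i i₂ hz.2
    rw [mul_sub, mul_assoc _ (z₂ ^ (-k)) (z₂ ^ k), hp _ i₂] at h
    rw [mul_assoc _ (z ^ (-k)), hp _ i]
    linarith

/-- Oscillatory integral bound on a wedge when the second derivative of the phase along lines of
slope `τ` does not vanish. -/
lemma exists_wedge_bound_of_slantDeriv (hg : ∀ i, AnalyticOnNhd ℝ (g i) U) (hU : IsOpen U)
    (hk : 0 < k) (hε : 0 < ε) :
    ∃ C : ℝ, 0 ≤ C ∧ ∀ (J : Set ℝ) (ζ u : Fin 2 → ℝ) (τ M c L : ℝ),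
      J.OrdConnected → J ⊆ U → 0 ≤ M → (∀ s ∈ J, |s| ≤ M) → M * (k * ε ^ (-|k - 1|)) ≤ τ → 0 < c →
      0 < L → (∀ s ∈ J, ∀ z ∈ Ico ε 1, c ≤ |slantDeriv k r τ (pairDeriv g 0 ζ s)
        (pairDeriv g 1 ζ s) (pairDeriv g 2 ζ s) s z|) →
      ‖∫ x in wedge k (Ico ε 1) J, Complex.exp (-Complex.I * (wedgePhase k r g u ζ L x : ℂ))‖
        ≤ 2 * (M + τ) * (C * (L * c) ^ (-(1 / 2 : ℝ))) := by
  obtain ⟨C, hC, hv⟩ := exists_vdc_two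
  refine ⟨C, hC, fun J ζ u τ M c L hJ hJU hM hJM hτ hc hL hlow => ?_⟩
  have hi := integrableOn_cexp_wedgePhase (k := k) (r := r) hg hk hε hJ.measurableSet hJU hJM u ζ L
  have hτ0 : 0 ≤ τ := le_trans (by positivity) hτ
  refine norm_setIntegral_le_of_slices (measurePreserving_shearMap τ)
    (measurableEmbedding_shearMap τ)
    (measurableSet_wedge k measurableSet_Ico hJ.measurableSet) hi (by positivity) ?_ fun y => ?_
  · intro y z h
    have h1 := abs_mem_wedge_le hk hε hJM h
    have h0 := h.1
    simp only [shearMap, Matrix.cons_val] at h0 h1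
    have h2 : 0 ≤ τ * z := mul_nonneg hτ0 (hε.le.trans h0.1)
    have h3 : τ * z ≤ τ := mul_le_of_le_one_right hτ0 h0.2.le
    rw [abs_le] at h1 ⊢
    constructor <;> linarith [h1.1, h1.2]
  · have hz0 : ∀ z ∈ {z | shearMap τ (y, z) ∈ wedge k (Ico ε 1) J},
        z ∈ Ico ε 1 ∧ 0 < z ∧ (y + τ * z) * z ^ (-k) ∈ J := by
      rintro z ⟨h0, h1⟩
      simp only [shearMap, Matrix.cons_val] at h0 h1
      exact ⟨h0, hε.trans_le h0.1, h1⟩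
    have hb : Bornology.IsBounded {z | shearMap τ (y, z) ∈ wedge k (Ico ε 1) J} :=
      (Metric.isBounded_Icc ε 1).subset fun z hz =>
        ⟨(hz0 z hz).1.1, (hz0 z hz).1.2.le⟩
    refine le_trans (le_of_eq ?_) (hv _ (L * c)
      (fun z => -(u 0 * z + u 1 * (y + τ * z) +
        L * (z ^ r * pairDeriv g 0 ζ ((y + τ * z) * z ^ (-k))))) _ _
      (ordConnected_slant hk hε hJ hJM hτ y) hb
      (by positivity) ?_ ?_ (fun z hz => hasDerivAt_slantPhase_deriv (r := r) hg (hz0 z hz).2.1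
        (hJU (hz0 z hz).2.2) u ζ L) fun z hz => ?_)
    · congr 2
      funext z
      rw [cexp_neg_I_eq]
      simp only [wedgePhase, shearMap, dot2, Matrix.cons_val]
    · intro z hz
      obtain ⟨-, h0, h1⟩ := hz0 z hz
      have hr : ∀ e : ℝ, AnalyticAt ℝ (fun z : ℝ => z ^ e) z := fun e =>
        (Real.contDiffAt_rpow_const_of_ne h0.ne').analyticAt
      have hlin : AnalyticAt ℝ (fun z : ℝ => y + τ * z) z :=
        analyticAt_const.add (analyticAt_const.mul analyticAt_id)
      have hG : AnalyticAt ℝ (fun z => pairDeriv g 0 ζ ((y + τ * z) * z ^ (-k))) z :=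
        AnalyticAt.comp (g := pairDeriv g 0 ζ) (f := fun z => (y + τ * z) * z ^ (-k))
          (analyticAt_pairDeriv hg 0 ζ _ (hJU h1)) (hlin.mul (hr _))
      exact (((analyticAt_const.mul analyticAt_id).add (analyticAt_const.mul hlin)).add
        (analyticAt_const.mul ((hr _).mul hG))).neg
    · intro z hz
      obtain ⟨-, h0, h1⟩ := hz0 z hz
      have h2 := (hasDerivAt_slant (k := k) (τ := τ) (y := y) h0).continuousAt.eventually
        (hU.mem_nhds (hJU h1))
      filter_upwards [lt_mem_nhds h0, h2] with w hw hwU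
      exact hasDerivAt_slantPhase hg hw hwU u ζ L
    · obtain ⟨h, -, h1⟩ := hz0 z hz
      rw [abs_neg, abs_mul, abs_of_pos hL]
      exact mul_le_mul_of_nonneg_left (hlow _ h1 z h) hL.le

end

/-- Uniform decay of order `κ` of the oscillatory integrals over the part of the wedge given by
subintervals of `V`, for frequencies in the directions of `Z`. -/
def WedgeDecay (g : Fin 2 → ℝ → ℝ) (k r ε κ : ℝ) (V : Set ℝ) (Z : Set (Fin 2 → ℝ)) : Prop :=
  ∃ C : ℝ, 0 ≤ C ∧ ∀ ζ ∈ Z, ∀ J : Set ℝ, J.OrdConnected → J ⊆ V → ∀ (u : Fin 2 → ℝ) (L : ℝ),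
    1 ≤ L →
    ‖∫ x in wedge k (Ico ε 1) J, Complex.exp (-Complex.I * (wedgePhase k r g u ζ L x : ℂ))‖
      ≤ C * L ^ (-κ)

section
variable {g : Fin 2 → ℝ → ℝ} {a b k r ε κ s₀ : ℝ} {ζ₀ : Fin 2 → ℝ}

lemma wedgeDecay_of_pairDeriv_ne_zero (hg : ∀ i, AnalyticOnNhd ℝ (g i) (Ioo a b)) (hk : 0 < k)
    (hε : 0 < ε) {N : ℕ} (hN : 2 ≤ N) (hκ : κ ≤ 1 / N) (hs : s₀ ∈ Ioo a b)
    (h0 : pairDeriv g N ζ₀ s₀ ≠ 0) :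
    ∃ V ∈ nhds s₀, ∃ Z ∈ nhds ζ₀, WedgeDecay g k r ε κ V Z := by
  obtain ⟨C, hC, hb⟩ := exists_wedge_bound_of_pairDeriv (r := r) hg hk hε hN
  have hc := (continuousAt_pairDeriv hg N (q := (ζ₀, s₀)) hs).abs.eventually
    (lt_mem_nhds (half_lt_self (abs_pos.2 h0)))
  rw [nhds_prod_eq, Filter.eventually_prod_iff] at hc
  obtain ⟨pa, ha, pb, hpb, h⟩ := hc
  refine ⟨{s | pb s} ∩ Ioo a b, Filter.inter_mem hpb (isOpen_Ioo.mem_nhds hs), {ζ | pa ζ}, ha,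
    C * (|pairDeriv g N ζ₀ s₀| / 2) ^ (-(1 / N : ℝ)), by positivity,
    fun ζ hζ J hJ hJV u L hL => ?_⟩
  have hL0 : 0 < L := one_pos.trans_le hL
  refine (hb J ζ u (max |a| |b|) (|pairDeriv g N ζ₀ s₀| / 2) L hJ (fun s hs => (hJV hs).2)
    (fun s hs => ?_) (half_pos (abs_pos.2 h0)) hL0 fun s hs => (h hζ (hJV hs).1).le).trans ?_
  · exact abs_le_max_abs_abs (hJV hs).2.1.le (hJV hs).2.2.le
  · rw [Real.mul_rpow hL0.le (by positivity), mul_assoc, mul_comm (L ^ _)]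
    gcongr

lemma slantDeriv_eq_of_eq_zero {τ G₀ G₁ s z : ℝ} (hz : 0 < z) :
    slantDeriv k r τ G₀ G₁ 0 s z = z ^ (r - 2) *
      (r * (r - 1) * G₀ - k * s * (2 * r - k - 1) * G₁ +
        τ * (2 * (r - k) * z ^ (1 - k) * G₁)) := by
  have e1 : z ^ (r - 1) = z ^ (r - 2) * z := by
    rw [← Real.rpow_add_one hz.ne']
    ring_nf
  have e0 : z ^ r = z ^ (r - 2) * z * z := by
    rw [← e1, ← Real.rpow_add_one hz.ne']
    ring_nf
  have ek : z ^ (1 - k) = z ^ (-k) * z := by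
    rw [← Real.rpow_add_one hz.ne']
    ring_nf
  rw [slantDeriv, e1, e0, ek]
  field_simp
  ring

/-- A sufficiently large slope makes the second derivative along slanted lines nonzero. -/
lemma exists_slantDeriv_ne_zero (hkr : k < r) (hr : 1 < r) (hε : 0 < ε)
    {G₀ G₁ : ℝ} (h : G₀ ≠ 0 ∨ G₁ ≠ 0) (s T : ℝ) :
    ∃ τ, T ≤ τ ∧ ∀ z ∈ Icc ε 1, slantDeriv k r τ G₀ G₁ 0 s z ≠ 0 := by
  by_cases h1 : G₁ = 0
  · refine ⟨T, le_rfl, fun z hz => ?_⟩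
    have hz0 := hε.trans_le hz.1
    rw [slantDeriv_eq_of_eq_zero hz0, h1]
    have hG : G₀ ≠ 0 := h.resolve_right (not_not.2 h1)
    have : r * (r - 1) * G₀ ≠ 0 :=
      mul_ne_zero (mul_ne_zero (by linarith) (by linarith)) hG
    simpa only [mul_zero, sub_zero, add_zero] using
      mul_ne_zero (Real.rpow_pos_of_pos hz0 _).ne' this
  · have hA : 0 < 2 * (r - k) * ε ^ |1 - k| * |G₁| := by
      have := sub_pos.2 hkr
      positivity
    generalize hB : r * (r - 1) * G₀ - k * s * (2 * r - k - 1) * G₁ = B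
    refine ⟨max T 0 + (|B| + 1) / (2 * (r - k) * ε ^ |1 - k| * |G₁|), ?_, fun z hz => ?_⟩
    · have := le_max_left T 0
      have : 0 ≤ (|B| + 1) / (2 * (r - k) * ε ^ |1 - k| * |G₁|) := by positivity
      linarith
    · have hz0 := hε.trans_le hz.1
      rw [slantDeriv_eq_of_eq_zero hz0, hB]
      refine mul_ne_zero (Real.rpow_pos_of_pos hz0 _).ne' fun h0 => ?_
      have hlow : 2 * (r - k) * ε ^ |1 - k| * |G₁| ≤ |2 * (r - k) * z ^ (1 - k) * G₁| := by
        rw [abs_mul, abs_mul, abs_of_pos (by linarith : 0 < 2 * (r - k)),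
          abs_of_pos (Real.rpow_pos_of_pos hz0 _)]
        have := rpow_abs_le_rpow hε hz.1 hz.2 (1 - k)
        gcongr
      have h2 : |B| = (max T 0 + (|B| + 1) / (2 * (r - k) * ε ^ |1 - k| * |G₁|)) *
          |2 * (r - k) * z ^ (1 - k) * G₁| := by
        nth_rewrite 1 [eq_neg_of_add_eq_zero_left h0]
        rw [abs_neg, abs_mul, abs_of_nonneg (by positivity)]
      have h3 : |B| + 1 ≤ (max T 0 + (|B| + 1) / (2 * (r - k) * ε ^ |1 - k| * |G₁|)) *
          |2 * (r - k) * z ^ (1 - k) * G₁| :=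
        calc |B| + 1 = (|B| + 1) / (2 * (r - k) * ε ^ |1 - k| * |G₁|) *
              (2 * (r - k) * ε ^ |1 - k| * |G₁|) := (div_mul_cancel₀ _ hA.ne').symm
          _ ≤ _ := by
            gcongr
            exact le_add_of_nonneg_left (le_max_right _ _)
      linarith

lemma wedgeDecay_of_pairDeriv_two_eq_zero (hg : ∀ i, AnalyticOnNhd ℝ (g i) (Ioo a b))
    (hk : 0 < k) (hkr : k < r) (hr : 1 < r) (hε : 0 < ε) (hε1 : ε ≤ 1) (hκ : κ ≤ 1 / 2)
    (hs : s₀ ∈ Ioo a b) (h2 : pairDeriv g 2 ζ₀ s₀ = 0)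
    (h01 : pairDeriv g 0 ζ₀ s₀ ≠ 0 ∨ pairDeriv g 1 ζ₀ s₀ ≠ 0) :
    ∃ V ∈ nhds s₀, ∃ Z ∈ nhds ζ₀, WedgeDecay g k r ε κ V Z := by
  obtain ⟨C, hC, hb⟩ := exists_wedge_bound_of_slantDeriv (r := r) hg isOpen_Ioo hk hε
  obtain ⟨τ, hτ, hne⟩ := exists_slantDeriv_ne_zero hkr hr hε h01 s₀
    (max |a| |b| * (k * ε ^ (-|k - 1|)))
  have hcont : ∀ q : ((Fin 2 → ℝ) × ℝ) × ℝ, q.1.2 ∈ Ioo a b → 0 < q.2 →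
      ContinuousAt (fun q : ((Fin 2 → ℝ) × ℝ) × ℝ =>
        |slantDeriv k r τ (pairDeriv g 0 q.1.1 q.1.2) (pairDeriv g 1 q.1.1 q.1.2)
          (pairDeriv g 2 q.1.1 q.1.2) q.1.2 q.2|) q := by
    intro q hq hq0
    have hG : ∀ j, ContinuousAt (fun q : ((Fin 2 → ℝ) × ℝ) × ℝ => pairDeriv g j q.1.1 q.1.2) q :=
      fun j => ContinuousAt.comp (g := fun q : (Fin 2 → ℝ) × ℝ => pairDeriv g j q.1 q.2)
        (f := Prod.fst) (continuousAt_pairDeriv hg j hq) continuousAt_fst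
    have hp : ∀ e : ℝ, ContinuousAt (fun q : ((Fin 2 → ℝ) × ℝ) × ℝ => q.2 ^ e) q := fun e =>
      continuousAt_snd.rpow_const (Or.inl hq0.ne')
    have hi : ContinuousAt (fun q : ((Fin 2 → ℝ) × ℝ) × ℝ => q.2⁻¹) q :=
      continuousAt_snd.inv₀ hq0.ne'
    have h0 := hG 0
    have h1 := hG 1
    have h2 := hG 2
    have p0 := hp r
    have p1 := hp (r - 1)
    have p2 := hp (r - 2)
    have pk := hp (-k)
    unfold slantDeriv
    fun_prop
  have hz0 : ∀ z ∈ Icc ε 1, 0 < z := fun z hz => hε.trans_le hz.1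
  obtain ⟨z₁, hz₁, hmin⟩ := (isCompact_Icc (a := ε) (b := 1)).exists_isMinOn
    (nonempty_Icc.2 hε1)
    (f := fun z => |slantDeriv k r τ (pairDeriv g 0 ζ₀ s₀) (pairDeriv g 1 ζ₀ s₀)
      (pairDeriv g 2 ζ₀ s₀) s₀ z|)
    (fun z hz => ((hcont ((ζ₀, s₀), z) hs (hz0 z hz)).comp (f := fun z => ((ζ₀, s₀), z))
      (Continuous.prodMk_right _).continuousAt).continuousWithinAt)
  generalize hc : |slantDeriv k r τ (pairDeriv g 0 ζ₀ s₀) (pairDeriv g 1 ζ₀ s₀)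
      (pairDeriv g 2 ζ₀ s₀) s₀ z₁| = c at hmin
  have hc0 : 0 < c := by
    rw [← hc, h2]
    exact abs_pos.2 (hne z₁ hz₁)
  have hev : ∀ᶠ q in nhds (ζ₀, s₀), ∀ z ∈ Icc ε 1, c / 2 < |slantDeriv k r τ
      (pairDeriv g 0 q.1 q.2) (pairDeriv g 1 q.1 q.2) (pairDeriv g 2 q.1 q.2) q.2 z| := by
    refine isCompact_Icc.eventually_forall_of_forall_eventually fun z hz => ?_
    refine (hcont ((ζ₀, s₀), z) hs (hz0 z hz)).eventually (lt_mem_nhds ?_)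
    have h := hmin hz
    simp only [mem_ofPred_eq, hc] at h
    exact (half_lt_self hc0).trans_le h
  rw [nhds_prod_eq, Filter.eventually_prod_iff] at hev
  obtain ⟨pa, ha, pb, hpb, h⟩ := hev
  have hτ0 : 0 ≤ τ := le_trans (by positivity) hτ
  refine ⟨{s | pb s} ∩ Ioo a b, Filter.inter_mem hpb (isOpen_Ioo.mem_nhds hs), {ζ | pa ζ}, ha,
    2 * (max |a| |b| + τ) * (C * (c / 2) ^ (-(1 / 2 : ℝ))), by positivity,
    fun ζ hζ J hJ hJV u L hL => ?_⟩
  have hL0 : 0 < L := one_pos.trans_le hL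
  refine (hb J ζ u τ (max |a| |b|) (c / 2) L hJ (fun s hs => (hJV hs).2) (by positivity)
    (fun s hs => ?_) hτ (half_pos hc0) hL0
    fun s hs z hz => (h hζ (hJV hs).1 z ⟨hz.1, hz.2.le⟩).le).trans ?_
  · exact abs_le_max_abs_abs (hJV hs).2.1.le (hJV hs).2.2.le
  · rw [Real.mul_rpow hL0.le (by positivity), mul_comm (L ^ _), mul_assoc (2 * _),
      mul_assoc C]
    gcongr

/-- Decay over the whole wedge, obtained by patching the local estimates. -/
lemma exists_wedge_bound {c d : ℝ} (hg : ∀ i, AnalyticOnNhd ℝ (g i) (Ioo a b)) (hk : 0 < k)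
    (hε : 0 < ε) (hac : a < c) (hcd : c < d) (hdb : d < b)
    (hloc : ∀ s ∈ Icc c d, ∀ ζ : Fin 2 → ℝ, ‖ζ‖ = 1 →
      ∃ V ∈ nhds s, ∃ Z ∈ nhds ζ, WedgeDecay g k r ε κ V Z) :
    ∃ C : ℝ, 0 ≤ C ∧ ∀ (ζ u : Fin 2 → ℝ) (L : ℝ), ‖ζ‖ = 1 → 1 ≤ L →
      ‖∫ x in wedge k (Ico ε 1) (Ioo c d),
        Complex.exp (-Complex.I * (wedgePhase k r g u ζ L x : ℂ))‖ ≤ C * L ^ (-κ) := by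
  have hsub : Ioo c d ⊆ Ioo a b := Ioo_subset_Ioo hac.le hdb.le
  have hfix : ∀ ζ₀ : Fin 2 → ℝ, ‖ζ₀‖ = 1 → ∃ Z ∈ nhds ζ₀, ∃ C : ℝ, 0 ≤ C ∧
      ∀ ζ ∈ Z, ∀ (u : Fin 2 → ℝ) (L : ℝ), 1 ≤ L →
      ‖∫ x in wedge k (Ico ε 1) (Ioo c d),
        Complex.exp (-Complex.I * (wedgePhase k r g u ζ L x : ℂ))‖ ≤ C * L ^ (-κ) := by
    intro ζ₀ hζ₀
    choose! V hV hVZ using fun s hs => hloc s hs ζ₀ hζ₀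
    obtain ⟨t, ht0, htm, ⟨n, htn⟩, ht⟩ := exists_monotone_Icc_subset_open_cover_Icc hcd.le
      (c := fun s : Icc c d => {x : Icc c d | (x : ℝ) ∈ interior (V s)})
      (fun s => isOpen_interior.preimage continuous_subtype_val)
      (fun x _ => mem_iUnion.2 ⟨x, mem_interior_iff_mem_nhds.2 (hV x x.2)⟩)
    have hind : ∀ j, ∃ Z ∈ nhds ζ₀, ∃ C : ℝ, 0 ≤ C ∧
        ∀ ζ ∈ Z, ∀ (u : Fin 2 → ℝ) (L : ℝ), 1 ≤ L →
        ‖∫ x in wedge k (Ico ε 1) (Ioo c d ∩ Iic (t j : ℝ)),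
          Complex.exp (-Complex.I * (wedgePhase k r g u ζ L x : ℂ))‖ ≤ C * L ^ (-κ) := by
      intro j
      induction j with
      | zero =>
        refine ⟨univ, Filter.univ_mem, 0, le_rfl, fun ζ _ u L _ => ?_⟩
        have : wedge k (Ico ε 1) (Ioo c d ∩ Iic (t 0 : ℝ)) = ∅ := by
          ext x
          simp only [wedge, mem_ofPred_eq, mem_empty_iff_false, iff_false, ht0]
          exact fun h => absurd h.2.1.1 (not_lt.2 h.2.2)
        rw [this]
        simp
      | succ j ih =>
        obtain ⟨Z₁, hZ₁, C₁, hC₁, h₁⟩ := ih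
        obtain ⟨i, hi⟩ := ht j
        obtain ⟨Z₂, hZ₂, C₂, hC₂, h₂⟩ := hVZ i i.2
        refine ⟨Z₁ ∩ Z₂, Filter.inter_mem hZ₁ hZ₂, C₁ + C₂, by positivity,
          fun ζ hζ u L hL => ?_⟩
        have hle : (t j : ℝ) ≤ t (j + 1) := htm (Nat.le_succ j)
        have hun : wedge k (Ico ε 1) (Ioo c d ∩ Iic (t (j + 1) : ℝ)) =
            wedge k (Ico ε 1) (Ioo c d ∩ Iic (t j : ℝ)) ∪
              wedge k (Ico ε 1) (Ioo c d ∩ Ioc (t j : ℝ) (t (j + 1))) := by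
          rw [← Iic_union_Ioc_eq_Iic hle, inter_union_distrib_left]
          ext x
          simp only [wedge, mem_ofPred_eq, mem_union]
          tauto
        have hdis : Disjoint (wedge k (Ico ε 1) (Ioo c d ∩ Iic (t j : ℝ)))
            (wedge k (Ico ε 1) (Ioo c d ∩ Ioc (t j : ℝ) (t (j + 1)))) :=
          disjoint_left.2 fun x h h' => absurd h'.2.2.1 (not_lt.2 h.2.2)
        have hM : ∀ s ∈ Ioo c d, |s| ≤ max |c| |d| := fun s hs =>
          abs_le_max_abs_abs hs.1.le hs.2.le
        have hintg : ∀ {J : Set ℝ}, MeasurableSet J → J ⊆ Ioo c d →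
            IntegrableOn (fun x => Complex.exp (-Complex.I * (wedgePhase k r g u ζ L x : ℂ)))
              (wedge k (Ico ε 1) J) := fun hJ hJc =>
          integrableOn_cexp_wedgePhase hg hk hε hJ (hJc.trans hsub) (fun s hs => hM s (hJc hs))
            u ζ L
        rw [hun, setIntegral_union hdis
          (measurableSet_wedge k measurableSet_Ico (measurableSet_Ioo.inter measurableSet_Ioc))
          (hintg (measurableSet_Ioo.inter measurableSet_Iic) inter_subset_left)
          (hintg (measurableSet_Ioo.inter measurableSet_Ioc) inter_subset_left), add_mul]
        refine (norm_add_le _ _).trans (add_le_add (h₁ ζ hζ.1 u L hL) (h₂ ζ hζ.2 _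
          (ordConnected_Ioo.inter ordConnected_Ioc) (fun s hs => ?_) u L hL))
        exact interior_subset (hi (show (⟨s, hs.1.1.le, hs.1.2.le⟩ : Icc c d) ∈ Icc (t j) (t (j + 1))
          from ⟨hs.2.1.le, hs.2.2⟩))
    obtain ⟨Z, hZ, C, hC, h⟩ := hind n
    refine ⟨Z, hZ, C, hC, fun ζ hζ u L hL => ?_⟩
    have := h ζ hζ u L hL
    have hd : Ioo c d ⊆ Iic d := fun s hs => hs.2.le
    rwa [htn n le_rfl, inter_eq_self_of_subset_left hd] at this
  have hsph := (isCompact_sphere (0 : Fin 2 → ℝ) 1).induction_on (p := fun Z => ∃ C : ℝ, 0 ≤ C ∧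
      ∀ ζ ∈ Z, ∀ (u : Fin 2 → ℝ) (L : ℝ), 1 ≤ L →
      ‖∫ x in wedge k (Ico ε 1) (Ioo c d),
        Complex.exp (-Complex.I * (wedgePhase k r g u ζ L x : ℂ))‖ ≤ C * L ^ (-κ))
    ⟨0, le_rfl, by simp⟩ (fun s t hst ⟨C, hC, h⟩ => ⟨C, hC, fun ζ hζ => h ζ (hst hζ)⟩)
    (fun s t ⟨C₁, hC₁, h₁⟩ ⟨C₂, hC₂, h₂⟩ => ⟨max C₁ C₂, hC₁.trans (le_max_left _ _), ?_⟩)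
    (fun ζ hζ => ?_)
  · obtain ⟨C, hC, h⟩ := hsph
    exact ⟨C, hC, fun ζ u L hζ hL => h ζ (mem_sphere_zero_iff_norm.2 hζ) u L hL⟩
  · rintro ζ (hζ | hζ) u L hL
    · refine (h₁ ζ hζ u L hL).trans ?_
      gcongr
      exact le_max_left _ _
    · refine (h₂ ζ hζ u L hL).trans ?_
      gcongr
      exact le_max_right _ _
  · obtain ⟨Z, hZ, h⟩ := hfix ζ (mem_sphere_zero_iff_norm.1 hζ)
    exact ⟨Z, mem_nhdsWithin_of_mem_nhds hZ, h⟩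

end

/-- The diagonal map with entries `p` and `q`. -/
def scaleMap (p q : ℝ) (x : Fin 2 → ℝ) : Fin 2 → ℝ := ![p * x 0, q * x 1]

lemma measurableEmbedding_scaleMap {p q : ℝ} (hp : 0 < p) (hq : 0 < q) :
    MeasurableEmbedding (scaleMap p q) := by
  have hc : Continuous (scaleMap p q) := by
    refine continuous_pi fun i => ?_
    fin_cases i <;> simp only [scaleMap] <;> fun_prop
  refine hc.measurableEmbedding fun x y h => ?_
  have h0 := congrFun h 0
  have h1 := congrFun h 1
  simp only [scaleMap, Matrix.cons_val] at h0 h1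
  ext i
  fin_cases i
  · exact mul_left_cancel₀ hp.ne' h0
  · exact mul_left_cancel₀ hq.ne' h1

lemma ofReal_smul_map_scaleMap {p q : ℝ} (hp : 0 < p) (hq : 0 < q) :
    ENNReal.ofReal (p * q) • Measure.map (scaleMap p q) volume = volume := by
  have h := Real.smul_map_diagonal_volume_pi (D := ![p, q])
    (by simpa [Matrix.det_diagonal] using ⟨hp.ne', hq.ne'⟩)
  have e : ⇑(Matrix.toLin' (Matrix.diagonal ![p, q])) = scaleMap p q := by
    funext x i
    fin_cases i <;> simp [scaleMap, Matrix.mulVec_diagonal]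
  simpa [Matrix.det_diagonal, e, abs_of_pos hp, abs_of_pos hq] using h

lemma setIntegral_scaleMap {p q : ℝ} (hp : 0 < p) (hq : 0 < q) (S : Set (Fin 2 → ℝ))
    (h : (Fin 2 → ℝ) → ℂ) :
    ∫ x in S, h x = ((p * q : ℝ) : ℂ) * ∫ x in scaleMap p q ⁻¹' S, h (scaleMap p q x) := by
  conv_lhs => rw [← ofReal_smul_map_scaleMap hp hq]
  rw [Measure.restrict_smul, integral_smul_measure,
    (measurableEmbedding_scaleMap hp hq).setIntegral_map,
    ENNReal.toReal_ofReal (by positivity), Complex.real_smul]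

lemma lintegral_scaleMap {p q : ℝ} (hp : 0 < p) (hq : 0 < q) (S : Set (Fin 2 → ℝ))
    (h : (Fin 2 → ℝ) → ℝ≥0∞) :
    ∫⁻ x in S, h x = ENNReal.ofReal (p * q) * ∫⁻ x in scaleMap p q ⁻¹' S, h (scaleMap p q x) := by
  conv_lhs => rw [← ofReal_smul_map_scaleMap hp hq]
  rw [Measure.restrict_smul, lintegral_smul_measure,
    (measurableEmbedding_scaleMap hp hq).restrict_map,
    (measurableEmbedding_scaleMap hp hq).lintegral_map, smul_eq_mul]

/-- Summation of a dyadic recursion. -/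
lemma exists_decay_of_recursion {X : Type*} {F : X → ℝ → ℝ} {S : X → X} {C κ a ρ v : ℝ}
    (hC : 0 ≤ C) (hv : 0 ≤ v) (ha : 0 ≤ a) (haκ : a < κ) (hρ : 0 < ρ) (hρ1 : ρ < 1)
    (hFv : ∀ u L, F u L ≤ v)
    (hF : ∀ u L, 1 ≤ L → F u L ≤ C * L ^ (-κ) + ρ ^ a * F (S u) (ρ * L)) :
    ∀ u L, 0 < L → F u L ≤ (v + C / (ρ ^ (a - κ) - 1) * ρ ^ (a - κ)) * L ^ (-a) := by
  have hρa : 1 < ρ ^ (a - κ) := Real.one_lt_rpow_of_pos_of_lt_one_of_neg hρ hρ1 (by linarith)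
  generalize hB : ρ ^ (a - κ) = B at hρa
  generalize hC₂ : C / (B - 1) = C₂
  have hC₂' : C₂ * B = C₂ + C := by
    rw [← hC₂]
    field_simp [(sub_pos.2 hρa).ne']
    ring
  have hC₂0 : 0 ≤ C₂ := by
    rw [← hC₂]
    exact div_nonneg hC (sub_pos.2 hρa).le
  have key : ∀ n : ℕ, ∀ u L, ρ ≤ L → ρ ^ n * L ≤ 1 →
      L ^ a * F u L ≤ v + C₂ * B - C₂ * L ^ (a - κ) := by
    intro n
    induction n with
    | zero =>
      intro u L h1 h2
      have hL : 0 < L := hρ.trans_le h1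
      have h2 : L ≤ 1 := by simpa using h2
      have e1 : L ^ (a - κ) ≤ B := hB ▸ Real.rpow_le_rpow_of_nonpos hρ h1 (by linarith)
      have e2 : L ^ a * F u L ≤ 1 * v := by
        have := Real.rpow_le_one hL.le h2 ha
        have h0 := Real.rpow_nonneg hL.le a
        exact (mul_le_mul_of_nonneg_left (hFv u L) h0).trans (mul_le_mul_of_nonneg_right this hv)
      nlinarith
    | succ n ih =>
      intro u L h1 h2
      have hL : 0 < L := hρ.trans_le h1
      rcases le_total L 1 with h | h
      · refine ih u L h1 ((mul_le_mul_of_nonneg_right ?_ hL.le).trans ((one_mul L).trans_le h))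
        exact pow_le_one₀ hρ.le hρ1.le
      · have h3 := ih (S u) (ρ * L) (le_mul_of_one_le_right hρ.le h)
          (by rwa [← mul_assoc, ← pow_succ])
        have h4 := mul_le_mul_of_nonneg_left (hF u L h) (Real.rpow_nonneg hL.le a)
        rw [Real.mul_rpow hρ.le hL.le, Real.mul_rpow hρ.le hL.le, hB] at h3
        have e : L ^ a * L ^ (-κ) = L ^ (a - κ) := by
          rw [← Real.rpow_add hL]
          rfl
        have e' : L ^ a * (C * L ^ (-κ) + ρ ^ a * F (S u) (ρ * L)) =
            C * L ^ (a - κ) + ρ ^ a * L ^ a * F (S u) (ρ * L) := by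
          rw [← e]
          ring
        have e'' : C₂ * (B * L ^ (a - κ)) = C₂ * L ^ (a - κ) + C * L ^ (a - κ) := by
          rw [← mul_assoc, hC₂', add_mul]
        linarith
  intro u L hL
  rw [Real.rpow_neg hL.le, ← div_eq_mul_inv, le_div_iff₀ (Real.rpow_pos_of_pos hL a), mul_comm]
  rcases le_total ρ L with h | h
  · obtain ⟨n, hn⟩ := exists_pow_lt_of_lt_one (inv_pos.2 hL) hρ1
    refine (key n u L h ?_).trans (sub_le_self _ (by positivity))
    exact ((lt_inv_mul_iff₀' hL).1 (by simpa using hn)).le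
  · have := Real.rpow_le_one hL.le (h.trans hρ1.le) ha
    have h0 := Real.rpow_nonneg hL.le a
    have h2 : 0 ≤ C₂ * B := by positivity
    nlinarith [(mul_le_mul_of_nonneg_left (hFv u L) h0).trans (mul_le_mul_of_nonneg_right this hv)]

section
variable {g : Fin 2 → ℝ → ℝ} {U J : Set ℝ} {k r ε κ M : ℝ}

lemma wedge_Ioo_eq_union (hε : 0 < ε) (hε1 : ε < 1) :
    wedge k (Ioo 0 1) J = wedge k (Ico ε 1) J ∪ wedge k (Ioo 0 ε) J := by
  rw [← Ioo_union_Ico_eq_Ioo hε hε1.le, union_comm]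
  ext x
  simp only [wedge, mem_ofPred_eq, mem_union]
  tauto

lemma scaleMap_preimage_wedge (hε : 0 < ε) :
    scaleMap ε (ε ^ k) ⁻¹' wedge k (Ioo 0 ε) J = wedge k (Ioo 0 1) J := by
  ext x
  simp only [wedge, mem_ofPred_eq, mem_preimage, scaleMap, Matrix.cons_val, mem_Ioo,
    mul_pos_iff_of_pos_left hε, mul_lt_iff_lt_one_right hε]
  refine and_congr_right fun hx => ?_
  rw [Real.mul_rpow hε.le hx.1.le, mul_mul_mul_comm, ← Real.rpow_add hε]
  simp

lemma wedgePhase_scaleMap (hε : 0 < ε) {x : Fin 2 → ℝ} (hx : 0 < x 0) (u ζ : Fin 2 → ℝ) (L : ℝ) :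
    wedgePhase k r g u ζ L (scaleMap ε (ε ^ k) x) =
      wedgePhase k r g (scaleMap ε (ε ^ k) u) ζ (ε ^ r * L) x := by
  simp only [wedgePhase, scaleMap, Matrix.cons_val, dot2, Real.mul_rpow hε.le hx.le]
  have : ε ^ k * x 1 * (ε ^ (-k) * x 0 ^ (-k)) = x 1 * x 0 ^ (-k) := by
    rw [mul_mul_mul_comm, ← Real.rpow_add hε]
    simp
  rw [this]
  ring

lemma volume_wedge_Ioo_ne_top (hk : 0 < k) (hJ : ∀ s ∈ J, |s| ≤ M) :
    volume (wedge k (Ioo 0 1) J) ≠ ⊤ := by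
  have hsub : wedge k (Ioo 0 1) J ⊆ Metric.closedBall 0 (max 1 M) := by
    intro x hx
    have h1 := abs_mem_wedge_le hk (ε := x 0) hx.1.1 hJ (x := x) ⟨⟨le_rfl, hx.1.2⟩, hx.2⟩
    have h0 := hx.1
    rw [mem_closedBall_zero_iff, pi_norm_le_iff_of_nonneg (by positivity)]
    intro i
    fin_cases i
    · exact le_max_of_le_left (abs_le.2 ⟨by have := h0.1; simp only [Fin.zero_eta]; linarith, h0.2.le⟩)
    · exact le_max_of_le_right h1
  exact ((measure_mono hsub).trans_lt measure_closedBall_lt_top).ne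

/-- Decay of order `γ ≤ (1 + k) / r` over the full wedge, from decay of order `κ > (1 + k) / r` over
a dyadic piece. -/
lemma exists_full_wedge_bound (hg : ∀ i, AnalyticOnNhd ℝ (g i) U) (hk : 0 < k) (hr : 0 < r)
    (hε : 0 < ε) (hε1 : ε < 1) (hJm : MeasurableSet J) (hJU : J ⊆ U) (hJM : ∀ s ∈ J, |s| ≤ M)
    (hκ : (1 + k) / r < κ) {C : ℝ} (hC : 0 ≤ C)
    (hA : ∀ (ζ u : Fin 2 → ℝ) (L : ℝ), ‖ζ‖ = 1 → 1 ≤ L →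
      ‖∫ x in wedge k (Ico ε 1) J, Complex.exp (-Complex.I * (wedgePhase k r g u ζ L x : ℂ))‖
        ≤ C * L ^ (-κ)) {γ : ℝ} (hγ0 : 0 ≤ γ) (hγ : γ ≤ (1 + k) / r) :
    ∃ C' : ℝ, ∀ (ζ u : Fin 2 → ℝ) (L : ℝ), ‖ζ‖ = 1 → 0 < L →
      ‖∫ x in wedge k (Ioo 0 1) J, Complex.exp (-Complex.I * (wedgePhase k r g u ζ L x : ℂ))‖
        ≤ C' * L ^ (-γ) := by
  have hfin := volume_wedge_Ioo_ne_top hk hJM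
  have hvol : ∀ u ζ L, ‖∫ x in wedge k (Ioo 0 1) J,
      Complex.exp (-Complex.I * (wedgePhase k r g u ζ L x : ℂ))‖ ≤
        volume.real (wedge k (Ioo 0 1) J) := fun u ζ L => by
    simpa using norm_setIntegral_le_of_norm_le_const hfin.lt_top
      fun x _ => (norm_cexp_neg_I_mul (wedgePhase k r g u ζ L x)).le
  have hm : ∀ {I}, MeasurableSet I → MeasurableSet (wedge k I J) := fun hI =>
    measurableSet_wedge k hI hJm
  have hrec : ∀ ζ : Fin 2 → ℝ, ‖ζ‖ = 1 → ∀ (u : Fin 2 → ℝ) (L : ℝ), 1 ≤ L →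
      ‖∫ x in wedge k (Ioo 0 1) J, Complex.exp (-Complex.I * (wedgePhase k r g u ζ L x : ℂ))‖ ≤
      C * L ^ (-κ) + (ε ^ r) ^ ((1 + k) / r) * ‖∫ x in wedge k (Ioo 0 1) J,
        Complex.exp (-Complex.I *
          (wedgePhase k r g (scaleMap ε (ε ^ k) u) ζ (ε ^ r * L) x : ℂ))‖ := by
    intro ζ hζ u L hL
    have hintg : IntegrableOn (fun x => Complex.exp (-Complex.I * (wedgePhase k r g u ζ L x : ℂ)))
        (wedge k (Ioo 0 1) J) := by
      refine IntegrableOn.of_bound hfin.lt_top (ContinuousOn.aestronglyMeasurable ?_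
        (hm measurableSet_Ioo)) 1 (Filter.Eventually.of_forall fun x => (norm_cexp_neg_I_mul _).le)
      refine Complex.continuous_exp.comp_continuousOn
        (continuousOn_const.mul (Complex.continuous_ofReal.comp_continuousOn fun x hx => ?_))
      have h2 : ∀ᶠ y : Fin 2 → ℝ in nhds x, y 0 ∈ Ico (x 0 / 2) 1 :=
        (continuous_apply 0).continuousAt.eventually
          (Ico_mem_nhds (half_lt_self hx.1.1) hx.1.2)
      have hx2 := half_pos hx.1.1
      have h1 := continuousOn_wedgePhase (k := k) (r := r) hg hx2 hJU u ζ L x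
        ⟨⟨(half_lt_self hx.1.1).le, hx.1.2⟩, hx.2⟩
      exact h1.mono_of_mem_nhdsWithin
        (mem_nhdsWithin_iff_eventually.2 (h2.mono fun y hy hyw => ⟨hy, hyw.2⟩))
    have hdis : Disjoint (wedge k (Ico ε 1) J) (wedge k (Ioo 0 ε) J) :=
      disjoint_left.2 fun x h h' => absurd h'.1.2 (not_lt.2 h.1.1)
    have hsc := setIntegral_scaleMap hε (Real.rpow_pos_of_pos hε k) (wedge k (Ioo 0 ε) J)
      (fun x => Complex.exp (-Complex.I * (wedgePhase k r g u ζ L x : ℂ)))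
    rw [scaleMap_preimage_wedge hε, setIntegral_congr_fun (hm (I := Ioo 0 1) measurableSet_Ioo)
      (g := fun x => Complex.exp (-Complex.I *
          (wedgePhase k r g (scaleMap ε (ε ^ k) u) ζ (ε ^ r * L) x : ℂ)))
      (fun x hx => by simp only [wedgePhase_scaleMap hε hx.1.1])] at hsc
    have hjac : (ε ^ r) ^ ((1 + k) / r) = ε * ε ^ k := by
      rw [← Real.rpow_mul hε.le, mul_div_cancel₀ _ hr.ne', Real.rpow_add hε, Real.rpow_one]
    have hun := wedge_Ioo_eq_union (k := k) (J := J) hε hε1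
    rw [hun] at hintg
    conv_lhs => rw [hun]
    rw [setIntegral_union hdis (hm measurableSet_Ioo) hintg.left_of_union hintg.right_of_union, hsc]
    refine (norm_add_le _ _).trans (add_le_add (hA ζ u L hζ hL) ?_)
    rw [norm_mul, Complex.norm_real, Real.norm_of_nonneg (by positivity), hjac]
  have ha : 0 ≤ (1 + k) / r := by positivity
  have hρ : ε ^ r < 1 := Real.rpow_lt_one hε.le hε1 hr
  generalize hB : volume.real (wedge k (Ioo 0 1) J) + C / ((ε ^ r) ^ ((1 + k) / r - κ) - 1) *
    (ε ^ r) ^ ((1 + k) / r - κ) = B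
  refine ⟨max B (volume.real (wedge k (Ioo 0 1) J)), fun ζ u L hζ hL => ?_⟩
  rcases le_total 1 L with h | h
  · have := exists_decay_of_recursion (S := scaleMap ε (ε ^ k)) hC measureReal_nonneg ha hκ
      (Real.rpow_pos_of_pos hε r) hρ (fun u L => hvol u ζ L) (hrec ζ hζ) u L hL
    rw [hB] at this
    refine this.trans ?_
    have h1 : L ^ (-((1 + k) / r)) ≤ L ^ (-γ) :=
      Real.rpow_le_rpow_of_exponent_le h (neg_le_neg hγ)
    exact (mul_le_mul_of_nonneg_right (le_max_left _ _) (by positivity)).trans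
      (mul_le_mul_of_nonneg_left h1 (measureReal_nonneg.trans (le_max_right _ _)))
  · have h1 : 1 ≤ L ^ (-γ) := Real.one_le_rpow_of_pos_of_le_one_of_nonpos hL h (by linarith)
    exact (hvol u ζ L).trans ((le_max_right _ _).trans
      (le_mul_of_one_le_right (measureReal_nonneg.trans (le_max_right _ _)) h1))

end

lemma isBigO_pow_of_iteratedDeriv_eq_zero {f : ℝ → ℝ} {x : ℝ} (hf : AnalyticAt ℝ f x) {n : ℕ}
    (h : ∀ i < n, iteratedDeriv i f x = 0) : f =O[nhds x] fun y => (y - x) ^ n := by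
  obtain ⟨h, hh, he⟩ := (natCast_le_analyticOrderAt hf).1
    ((natCast_le_analyticOrderAt_iff_iteratedDeriv_eq_zero hf).2 h)
  refine Asymptotics.IsBigO.congr' (f₁ := fun y => (y - x) ^ n * h y)
    (g₁ := fun y => (y - x) ^ n * 1) ?_ (he.mono fun y hy => hy.symm)
    (Filter.Eventually.of_forall fun y => by simp)
  exact (Asymptotics.isBigO_refl _ _).mul (hh.continuousAt.isBigO_one ℝ)

/-- The determinant of the Hessian of `x₀ʳ G(x₁ x₀⁻ᵏ)` at `(1, s)`, where `G₀`, `G₁`, `G₂` are the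
values of `G`, `G'`, `G''` at `s`. -/
def hessDet (k r s G₀ G₁ G₂ : ℝ) : ℝ :=
  r * (r - 1) * (G₀ * G₂) + k * (1 - k) * s * (G₁ * G₂) - (r - k) ^ 2 * (G₁ * G₁)

section
variable {g : Fin 2 → ℝ → ℝ} {U : Set ℝ} {σ : ℝ}

lemma iteratedDeriv_pairDeriv (hg : ∀ i, AnalyticOnNhd ℝ (g i) U) (hU : IsOpen U) (i j : ℕ)
    (ζ : Fin 2 → ℝ) {s : ℝ} (hs : s ∈ U) :
    iteratedDeriv i (pairDeriv g j ζ) s = pairDeriv g (j + i) ζ s := by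
  induction i generalizing s with
  | zero => simp
  | succ i ih =>
    rw [iteratedDeriv_succ, Filter.EventuallyEq.deriv_eq
      (f := pairDeriv g (j + i) ζ) ((hU.eventually_mem hs).mono fun y hy => ih hy),
      (hasDerivAt_pairDeriv hg (j + i) ζ hs).deriv]
    rfl

lemma isBigO_hessDet (hg : ∀ i, AnalyticOnNhd ℝ (g i) U) (hU : IsOpen U) (hσ : σ ∈ U)
    (ζ : Fin 2 → ℝ) (k r : ℝ) {N : ℕ} (hN : 2 ≤ N) (h : ∀ j ≤ N, pairDeriv g j ζ σ = 0) :
    (fun s => hessDet k r s (pairDeriv g 0 ζ s) (pairDeriv g 1 ζ s) (pairDeriv g 2 ζ s))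
      =O[nhds σ] fun s => (s - σ) ^ (2 * N - 1) := by
  have hb : ∀ j n, j + n = N + 1 → pairDeriv g j ζ =O[nhds σ] fun s => (s - σ) ^ n := by
    intro j n hn
    refine isBigO_pow_of_iteratedDeriv_eq_zero (analyticAt_pairDeriv hg j ζ σ hσ) fun i hi => ?_
    rw [iteratedDeriv_pairDeriv hg hU i j ζ hσ]
    exact h _ (by omega)
  have hle : ∀ {m n : ℕ}, n ≤ m →
      (fun s => (s - σ) ^ m) =O[nhds σ] fun s => (s - σ) ^ n := by
    intro m n hmn
    obtain ⟨l, rfl⟩ := Nat.exists_eq_add_of_le hmn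
    have : ContinuousAt (fun s => (s - σ) ^ l) σ := by fun_prop
    simpa [pow_add] using
      (Asymptotics.isBigO_refl (fun s => (s - σ) ^ n) (nhds σ)).mul (this.isBigO_one ℝ)
  have hprod : ∀ i j n n', i + n = N + 1 → j + n' = N + 1 → 2 * N - 1 ≤ n + n' →
      (fun s => pairDeriv g i ζ s * pairDeriv g j ζ s)
        =O[nhds σ] fun s => (s - σ) ^ (2 * N - 1) := by
    intro i j n n' h1 h2 h3
    refine Asymptotics.IsBigO.trans ?_ (hle h3)
    simpa only [pow_add] using (hb i n h1).mul (hb j n' h2)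
  have hs : (fun s : ℝ => k * (1 - k) * s) =O[nhds σ] fun _ => (1 : ℝ) := by
    have : ContinuousAt (fun s : ℝ => k * (1 - k) * s) σ := by fun_prop
    exact this.isBigO_one ℝ
  have h02 := hprod 0 2 (N + 1) (N - 1) (by omega) (by omega) (by omega)
  have h12 := hprod 1 2 N (N - 1) (by omega) (by omega) (by omega)
  have h11 := hprod 1 1 N N (by omega) (by omega) (by omega)
  have h12' := hs.mul h12
  simp only [one_mul] at h12'
  exact ((h02.const_mul_left _).add h12').sub (h11.const_mul_left _)

/-- A lower bound for the Hessian determinant along a filter prevents `G_ζ` from being too flat. -/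
lemma exists_pairDeriv_ne_zero_of_hessDet (hg : ∀ i, AnalyticOnNhd ℝ (g i) U) (hU : IsOpen U)
    (hσ : σ ∈ U) (ζ : Fin 2 → ℝ) (k r : ℝ) {N n : ℕ} (hN : 2 ≤ N) (hn : n + 2 ≤ 2 * N)
    {l : Filter ℝ} [l.NeBot] (hl : l ≤ nhdsWithin σ {σ}ᶜ) {D : ℝ} (hD : 0 < D)
    (hlow : ∀ᶠ s in l, D * |s - σ| ^ n ≤
      |hessDet k r s (pairDeriv g 0 ζ s) (pairDeriv g 1 ζ s) (pairDeriv g 2 ζ s)|) :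
    ∃ j ≤ N, pairDeriv g j ζ σ ≠ 0 := by
  by_contra! h
  have h1 := (isBigO_hessDet hg hU hσ ζ k r hN h).mono (hl.trans nhdsWithin_le_nhds)
  have h2 : (fun s => (s - σ) ^ n) =O[l] fun s =>
      hessDet k r s (pairDeriv g 0 ζ s) (pairDeriv g 1 ζ s) (pairDeriv g 2 ζ s) := by
    refine Asymptotics.IsBigO.of_bound D⁻¹ (hlow.mono fun s hs => ?_)
    rw [norm_pow, Real.norm_eq_abs, Real.norm_eq_abs, inv_mul_eq_div, le_div_iff₀' hD]
    exact hs
  have h3 := (h2.trans h1)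
  have h4 : (fun s => (s - σ) ^ (2 * N - 1)) =o[l] fun s => (s - σ) ^ n := by
    have := Asymptotics.isLittleO_pow_sub_pow_sub σ (by omega : n < 2 * N - 1)
    simp only [← norm_pow] at this
    exact (Asymptotics.isLittleO_norm_norm.1 this).mono (hl.trans nhdsWithin_le_nhds)
  refine h3.not_isLittleO ?_ h4
  refine Filter.Eventually.frequently (Filter.Eventually.filter_mono hl ?_)
  exact eventually_mem_nhdsWithin.mono fun s hs => pow_ne_zero _ (sub_ne_zero.2 hs)

end

section
variable {k : ℝ}

/-- The differential of `x₀ᵉ h(x₁ x₀⁻ᵏ)`. -/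
lemma hasFDerivAt_rpow_mul_comp (k e : ℝ) {h : ℝ → ℝ} {h' : ℝ} {x : Fin 2 → ℝ} (hx : 0 < x 0)
    (hh : HasDerivAt h h' (x 1 * x 0 ^ (-k))) :
    HasFDerivAt (fun y : Fin 2 → ℝ => y 0 ^ e * h (y 1 * y 0 ^ (-k)))
      ((x 0 ^ (e - 1) * (e * h (x 1 * x 0 ^ (-k)) - k * (x 1 * x 0 ^ (-k)) * h')) •
          (ContinuousLinearMap.proj 0 : (Fin 2 → ℝ) →L[ℝ] ℝ) +
        (x 0 ^ (e - k) * h') • (ContinuousLinearMap.proj 1 : (Fin 2 → ℝ) →L[ℝ] ℝ)) x := by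
  have h0 : HasFDerivAt (fun y : Fin 2 → ℝ => y 0)
      (ContinuousLinearMap.proj 0 : (Fin 2 → ℝ) →L[ℝ] ℝ) x := hasFDerivAt_apply 0 x
  have h1 : HasFDerivAt (fun y : Fin 2 → ℝ => y 1)
      (ContinuousLinearMap.proj 1 : (Fin 2 → ℝ) →L[ℝ] ℝ) x := hasFDerivAt_apply 1 x
  have hp : ∀ e : ℝ, HasFDerivAt (fun y : Fin 2 → ℝ => y 0 ^ e)
      ((e * x 0 ^ (e - 1)) • (ContinuousLinearMap.proj 0 : (Fin 2 → ℝ) →L[ℝ] ℝ)) x := fun e =>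
    HasDerivAt.comp_hasFDerivAt (h₂ := fun t : ℝ => t ^ e) x
      (Real.hasDerivAt_rpow_const (Or.inl hx.ne')) h0
  have h2 := HasDerivAt.comp_hasFDerivAt x hh (h1.mul (hp (-k)))
  refine ((hp e).mul h2).congr_fderiv ?_
  ext v
  have e1 : x 0 ^ (-k - 1) = x 0 ^ (-k) * (x 0)⁻¹ := by
    rw [Real.rpow_sub_one hx.ne', div_eq_mul_inv]
  have e2 : x 0 ^ e = x 0 ^ (e - 1) * x 0 := by
    rw [← Real.rpow_add_one hx.ne', sub_add_cancel]
  have e3 : x 0 ^ (e - k) = x 0 ^ (e - 1) * x 0 * x 0 ^ (-k) := by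
    rw [← e2, ← Real.rpow_add hx]
    rfl
  simp only [add_apply, smul_apply, smul_eq_mul,
    ContinuousLinearMap.proj_apply, Function.comp, Pi.mul_apply, e1, e2, e3]
  field_simp
  ring

/-- The Hessian at `(1, s)` of a function that agrees with `x₀ʳ h(x₁ x₀⁻ᵏ)` near every point of a
neighborhood. -/
lemma hess_eq_of_eventuallyEq {r s : ℝ} {f : (Fin 2 → ℝ) → ℝ} {h : ℝ → ℝ}
    (hh : AnalyticAt ℝ h s) (hf : ∀ᶠ y in nhds ![1, s], f y = y 0 ^ r * h (y 1 * y 0 ^ (-k))) :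
    Hess f ![1, s] = !![(r - 1) * (r * h s - k * s * deriv h s) -
        k * s * ((r - k) * deriv h s - k * s * deriv (deriv h) s),
        (r - k) * deriv h s - k * s * deriv (deriv h) s;
        (r - k) * deriv h s - k * s * deriv (deriv h) s, deriv (deriv h) s] := by
  have hc : ContinuousAt (fun y : Fin 2 → ℝ => y 1 * y 0 ^ (-k)) ![1, s] :=
    (continuous_apply 1).continuousAt.mul
      ((continuous_apply 0).continuousAt.rpow_const (Or.inl (by simp)))
  have hsv : ∀ᶠ y : Fin 2 → ℝ in nhds ![1, s], 0 < y 0 ∧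
      AnalyticAt ℝ h (y 1 * y 0 ^ (-k)) ∧ f =ᶠ[nhds y] fun y => y 0 ^ r * h (y 1 * y 0 ^ (-k)) := by
    have a1 : ∀ᶠ y : Fin 2 → ℝ in nhds ![1, s], 0 < y 0 :=
      (continuous_apply 0).continuousAt.eventually (lt_mem_nhds (by simp))
    have a2 : ∀ᶠ y : Fin 2 → ℝ in nhds ![1, s], AnalyticAt ℝ h (y 1 * y 0 ^ (-k)) :=
      hc.eventually (by simpa using hh.eventually_analyticAt)
    exact a1.and (a2.and hf.eventually_nhds)
  have e0 : (fun y => fderiv ℝ f y (Pi.single 0 1)) =ᶠ[nhds ![1, s]]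
      fun y => y 0 ^ (r - 1) * (fun t => r * h t - k * t * deriv h t) (y 1 * y 0 ^ (-k)) := by
    filter_upwards [hsv] with y ⟨h1, h2, h3⟩
    rw [h3.fderiv_eq, (hasFDerivAt_rpow_mul_comp k r h1 h2.differentiableAt.hasDerivAt).fderiv]
    simp
  have e1 : (fun y => fderiv ℝ f y (Pi.single 1 1)) =ᶠ[nhds ![1, s]]
      fun y => y 0 ^ (r - k) * deriv h (y 1 * y 0 ^ (-k)) := by
    filter_upwards [hsv] with y ⟨h1, h2, h3⟩
    rw [h3.fderiv_eq, (hasFDerivAt_rpow_mul_comp k r h1 h2.differentiableAt.hasDerivAt).fderiv]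
    simp
  have hs : (![1, s] : Fin 2 → ℝ) 1 * (![1, s] : Fin 2 → ℝ) 0 ^ (-k) = s := by simp
  have hd := hh.differentiableAt.hasDerivAt
  have hd2 := hh.deriv.differentiableAt.hasDerivAt
  have d0 : HasDerivAt (fun t => r * h t - k * t * deriv h t)
      ((r - k) * deriv h s - k * s * deriv (deriv h) s) s := by
    have hk : HasDerivAt (fun t : ℝ => k * t) k s := by
      simpa using (hasDerivAt_id s).const_mul k
    refine ((hd.const_mul r).sub (hk.mul hd2)).congr_deriv ?_
    ring
  have E0 := e0.fderiv_eq.trans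
    (hasFDerivAt_rpow_mul_comp k (r - 1) (x := ![1, s]) (by simp) (hs.symm ▸ d0)).fderiv
  have E1 := e1.fderiv_eq.trans
    (hasFDerivAt_rpow_mul_comp k (r - k) (x := ![1, s]) (by simp) (hs.symm ▸ hd2)).fderiv
  ext i j
  fin_cases j <;> fin_cases i <;> simp [Hess, E0, E1]

end

section
variable {α₁ α₂ a b c d m : ℝ} {φ : (Fin 2 → ℝ) → Fin 2 → ℝ}

lemma dil_one_zero (t s : ℝ) : dil α₁ α₂ t ![1, s] 0 = t ^ α₁ := by simp [dil]

lemma dil_one_one (t s : ℝ) : dil α₁ α₂ t ![1, s] 1 = t ^ α₂ * s := by simp [dil]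

lemma dil_one (x : Fin 2 → ℝ) : dil α₁ α₂ 1 x = x := by
  ext i
  fin_cases i <;> simp [dil]

lemma dil_slope (hα₁ : 0 < α₁) {t : ℝ} (ht : 0 < t) (s : ℝ) :
    dil α₁ α₂ t ![1, s] 1 * dil α₁ α₂ t ![1, s] 0 ^ (-(α₂ / α₁)) = s := by
  rw [dil_one_zero, dil_one_one, ← Real.rpow_mul ht.le, mul_neg, mul_div_cancel₀ _ hα₁.ne',
    mul_right_comm, ← Real.rpow_add ht, add_neg_cancel, Real.rpow_zero, one_mul]

lemma eq_dil (hα₁ : 0 < α₁) {x : Fin 2 → ℝ} (hx : 0 < x 0) :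
    x = dil α₁ α₂ (x 0 ^ (1 / α₁)) ![1, x 1 * x 0 ^ (-(α₂ / α₁))] := by
  ext i
  fin_cases i
  · simp [dil, ← Real.rpow_mul hx.le, hα₁.ne']
  · simp [dil, ← Real.rpow_mul hx.le]
    rw [mul_left_comm, ← Real.rpow_add hx]
    simp [div_eq_inv_mul]

lemma Vab_eq_wedge (hα₁ : 0 < α₁) : Vab α₁ α₂ a b = wedge (α₂ / α₁) (Ioi 0) (Ioo a b) := by
  ext x
  constructor
  · rintro ⟨s, t, h1, h2, ht, rfl⟩
    refine ⟨?_, ?_⟩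
    · rw [dil_one_zero]
      exact Real.rpow_pos_of_pos ht _
    · rw [dil_slope hα₁ ht]
      exact ⟨h1, h2⟩
  · rintro ⟨hx, h1, h2⟩
    exact ⟨_, _, h1, h2, Real.rpow_pos_of_pos hx _, eq_dil hα₁ hx⟩

lemma V1_eq_wedge (hα₁ : 0 < α₁) : V1 α₁ α₂ c d = wedge (α₂ / α₁) (Ioo 0 1) (Ioo c d) := by
  ext x
  constructor
  · rintro ⟨s, t, h1, h2, ht, ht1, rfl⟩
    refine ⟨?_, ?_⟩
    · rw [dil_one_zero]
      exact ⟨Real.rpow_pos_of_pos ht _, Real.rpow_lt_one ht.le ht1 hα₁⟩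
    · rw [dil_slope hα₁ ht]
      exact ⟨h1, h2⟩
  · rintro ⟨hx, h1, h2⟩
    exact ⟨_, _, h1, h2, Real.rpow_pos_of_pos hx.1 _,
      Real.rpow_lt_one hx.1.le hx.2 (by positivity), eq_dil hα₁ hx.1⟩

lemma V1_subset_Vab (hac : a ≤ c) (hdb : d ≤ b) : V1 α₁ α₂ c d ⊆ Vab α₁ α₂ a b := by
  rintro x ⟨s, t, h1, h2, ht, -, rfl⟩
  exact ⟨s, t, hac.trans_lt h1, h2.trans_le hdb, ht, rfl⟩

lemma one_vec_mem_Vab {s : ℝ} (hs : s ∈ Ioo a b) : ![1, s] ∈ Vab α₁ α₂ a b :=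
  ⟨s, 1, hs.1, hs.2, one_pos, (dil_one _).symm⟩

lemma Vab_mem_nhds (hα₁ : 0 < α₁) {s : ℝ} (hs : s ∈ Ioo a b) :
    Vab α₁ α₂ a b ∈ nhds ![1, s] := by
  have h1 : ContinuousAt (fun y : Fin 2 → ℝ => y 1 * y 0 ^ (-(α₂ / α₁))) ![1, s] :=
    (continuous_apply 1).continuousAt.mul
      ((continuous_apply 0).continuousAt.rpow_const (Or.inl (by simp)))
  have h0 : ∀ᶠ y : Fin 2 → ℝ in nhds ![1, s], 0 < y 0 :=
    (continuous_apply 0).continuousAt.eventually (lt_mem_nhds (by simp))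
  rw [Vab_eq_wedge hα₁]
  exact h0.and (h1.eventually (isOpen_Ioo.mem_nhds (by simpa using hs)))

lemma analyticAt_one_vec (s : ℝ) : AnalyticAt ℝ (fun s : ℝ => (![1, s] : Fin 2 → ℝ)) s := by
  rw [analyticAt_pi_iff]
  intro i
  fin_cases i
  · exact analyticAt_const
  · exact analyticAt_id

lemma analyticOnNhd_slice (H1 : AnalyticOnNhd ℝ φ (Vab α₁ α₂ a b)) (i : Fin 2) :
    AnalyticOnNhd ℝ (fun s => φ ![1, s] i) (Ioo a b) := fun s hs =>
  analyticAt_pi_iff.1 (AnalyticAt.fun_comp (f := fun s : ℝ => (![1, s] : Fin 2 → ℝ))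
    (H1 _ (one_vec_mem_Vab hs)) (analyticAt_one_vec s)) i

lemma apply_eq_of_homogeneous (hα₁ : 0 < α₁)
    (H2 : ∀ x ∈ Vab α₁ α₂ a b, ∀ t : ℝ, 0 < t → φ (dil α₁ α₂ t x) = t ^ m • φ x)
    {x : Fin 2 → ℝ} (hx : x ∈ Vab α₁ α₂ a b) (i : Fin 2) :
    φ x i = x 0 ^ (m / α₁) * φ ![1, x 1 * x 0 ^ (-(α₂ / α₁))] i := by
  obtain ⟨s, t, h1, h2, ht, rfl⟩ := hx
  rw [dil_slope hα₁ ht, H2 _ (one_vec_mem_Vab ⟨h1, h2⟩) t ht, dil_one_zero, ← Real.rpow_mul ht.le,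
    mul_div_cancel₀ _ hα₁.ne']
  rfl

lemma Qform_one_vec (hα₁ : 0 < α₁) (H1 : AnalyticOnNhd ℝ φ (Vab α₁ α₂ a b))
    (H2 : ∀ x ∈ Vab α₁ α₂ a b, ∀ t : ℝ, 0 < t → φ (dil α₁ α₂ t x) = t ^ m • φ x)
    {s : ℝ} (hs : s ∈ Ioo a b) (ζ : Fin 2 → ℝ) :
    Qform φ ![1, s] ζ = hessDet (α₂ / α₁) (m / α₁) s
      (pairDeriv (fun i s => φ ![1, s] i) 0 ζ s) (pairDeriv (fun i s => φ ![1, s] i) 1 ζ s)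
      (pairDeriv (fun i s => φ ![1, s] i) 2 ζ s) := by
  have h : ∀ i, ∀ᶠ y in nhds ![1, s],
      φ y i = y 0 ^ (m / α₁) * (fun s => φ ![1, s] i) (y 1 * y 0 ^ (-(α₂ / α₁))) := fun i =>
    Filter.mem_of_superset (Vab_mem_nhds hα₁ hs) fun y hy => apply_eq_of_homogeneous hα₁ H2 hy i
  rw [Qform, hess_eq_of_eventuallyEq (analyticOnNhd_slice H1 0 s hs) (h 0),
    hess_eq_of_eventuallyEq (analyticOnNhd_slice H1 1 s hs) (h 1), Matrix.det_fin_two]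
  simp only [hessDet, pairDeriv, iteratedDeriv_zero, iteratedDeriv_succ,
    Matrix.add_apply, Matrix.smul_apply, Matrix.of_apply, Matrix.cons_val, smul_eq_mul]
  ring

lemma Qform_smul (x : Fin 2 → ℝ) (t : ℝ) (ζ : Fin 2 → ℝ) :
    Qform φ x (t • ζ) = t ^ 2 * Qform φ x ζ := by
  simp only [Qform, Matrix.det_fin_two, Matrix.add_apply, Matrix.smul_apply, Pi.smul_apply,
    smul_eq_mul]
  ring

lemma exists_smul_onS1 {ζ : Fin 2 → ℝ} (hζ : ζ ≠ 0) : ∃ t : ℝ, 0 < t ∧ onS1 (t • ζ) := by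
  have h : 0 < ζ 0 ^ 2 + ζ 1 ^ 2 := by
    refine (by positivity : 0 ≤ ζ 0 ^ 2 + ζ 1 ^ 2).lt_of_ne' fun h => hζ ?_
    ext i
    fin_cases i <;> simp <;> nlinarith [sq_nonneg (ζ 0), sq_nonneg (ζ 1)]
  refine ⟨(√(ζ 0 ^ 2 + ζ 1 ^ 2))⁻¹, by positivity, ?_⟩
  simp only [onS1, Pi.smul_apply, smul_eq_mul, mul_pow, ← mul_add, inv_pow, Real.sq_sqrt h.le]
  exact inv_mul_cancel₀ h.ne'

lemma not_elliptic_of_Qform_eq_zero {x ζ : Fin 2 → ℝ} (hζ : ζ ≠ 0) (h : Qform φ x ζ = 0) :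
    ¬ Elliptic φ x := by
  rintro ⟨ε, hε, H⟩
  obtain ⟨t, -, ht1⟩ := exists_smul_onS1 hζ
  have := H _ ht1
  rw [Qform_smul, h, mul_zero, abs_zero] at this
  exact this.not_gt hε

lemma one_vec_mem_closure (hcd : c < d) {s : ℝ} (hs : s ∈ Icc c d) :
    ![1, s] ∈ closure (Vab α₁ α₂ c d) := by
  have hc : Continuous fun s : ℝ => (![1, s] : Fin 2 → ℝ) :=
    continuous_iff_continuousAt.2 fun s => (analyticAt_one_vec s).continuousAt
  rw [← closure_Ioo hcd.ne] at hs
  have hsub : (fun s : ℝ => (![1, s] : Fin 2 → ℝ)) '' Ioo c d ⊆ Vab α₁ α₂ c d :=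
    image_subset_iff.2 fun s hs => one_vec_mem_Vab hs
  exact closure_mono hsub
    (image_closure_subset_closure_image hc (mem_image_of_mem _ hs))

lemma eq_of_not_elliptic (hα₁ : 0 < α₁) (hcd : c < d) {σ : ℝ}
    (H3 : {x | x ∈ closure (Vab α₁ α₂ c d) ∧ x ≠ 0 ∧ ¬ Elliptic φ x}
        = {x | ∃ t : ℝ, 0 < t ∧ x = dil α₁ α₂ t ![1, σ]}) {s : ℝ} (hs : s ∈ Icc c d)
    (h : ¬ Elliptic φ ![1, s]) : s = σ := by
  have hmem : ![1, s] ∈ {x | x ∈ closure (Vab α₁ α₂ c d) ∧ x ≠ 0 ∧ ¬ Elliptic φ x} :=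
    ⟨one_vec_mem_closure hcd hs, fun h0 => by simpa using congrFun h0 0, h⟩
  rw [H3] at hmem
  obtain ⟨t, ht, he⟩ := hmem
  have := dil_slope (α₂ := α₂) hα₁ ht σ
  rw [← he] at this
  simpa using this

/-- Finite type of every component at the flat direction. -/
lemma exists_pairDeriv_ne_zero (hα₁ : 0 < α₁) (H1 : AnalyticOnNhd ℝ φ (Vab α₁ α₂ a b))
    (H2 : ∀ x ∈ Vab α₁ α₂ a b, ∀ t : ℝ, 0 < t → φ (dil α₁ α₂ t x) = t ^ m • φ x)
    {σ : ℝ} (hσ : σ ∈ Ioo a b) {l : Filter ℝ} [l.NeBot] (hl : l ≤ nhdsWithin σ {σ}ᶜ)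
    {D : ℝ} (hD : 0 < D) {n N : ℕ} (hN : 2 ≤ N) (hn : n + 2 ≤ 2 * N)
    (h : ∀ᶠ s in l, ∀ ζ, onS1 ζ → D * |s - σ| ^ n ≤ |Qform φ ![1, s] ζ|)
    {ζ : Fin 2 → ℝ} (hζ : ζ ≠ 0) :
    ∃ j ≤ N, pairDeriv (fun i s => φ ![1, s] i) j ζ σ ≠ 0 := by
  obtain ⟨t, ht, ht1⟩ := exists_smul_onS1 hζ
  refine exists_pairDeriv_ne_zero_of_hessDet (analyticOnNhd_slice H1) isOpen_Ioo hσ ζ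
    (α₂ / α₁) (m / α₁) hN hn hl (div_pos hD (pow_pos ht 2)) ?_
  filter_upwards [h, (hl.trans nhdsWithin_le_nhds) (isOpen_Ioo.mem_nhds hσ)] with s hs hsU
  rw [← Qform_one_vec hα₁ H1 H2 hsU ζ, div_mul_eq_mul_div, div_le_iff₀' (pow_pos ht 2),
    ← abs_of_pos (pow_pos ht 2), ← abs_mul, ← Qform_smul]
  exact hs _ ht1

end

section
variable {α₁ α₂ a b c d m : ℝ} {φ : (Fin 2 → ℝ) → Fin 2 → ℝ}

/-- The flatness order `n < 2m/(α₁+α₂) - 3` is below a type that still beats the homogeneity. -/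
lemma exists_type_bound {α : ℝ} (hα : 0 < α) (hm : 3 * α ≤ m) {n : ℕ}
    (hn : (n : ℝ) < 2 * m / α - 3) :
    ∃ N : ℕ, 2 ≤ N ∧ n + 2 ≤ 2 * N ∧ α / m < 1 / N := by
  have hm0 : 0 < m := by linarith
  refine ⟨max 2 ((n + 3) / 2), le_max_left _ _, by omega, ?_⟩
  have h0 : (0 : ℝ) < (max 2 ((n + 3) / 2) : ℕ) := by
    exact_mod_cast lt_of_lt_of_le two_pos (le_max_left _ _)
  rw [div_lt_div_iff₀ hm0 h0, one_mul]
  rcases max_choice 2 ((n + 3) / 2) with h | h <;> rw [h]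
  · push_cast
    linarith
  · have h1 : (((n + 3) / 2 : ℕ) : ℝ) ≤ (n + 3) / 2 := by
      exact_mod_cast Nat.cast_div_le (α := ℝ) (m := n + 3) (n := 2)
    rw [lt_sub_iff_add_lt, lt_div_iff₀ hα] at hn
    nlinarith

/-- Near `σ` on one side, a lower bound for `|Q|` of order `n₁` or `n₂`. -/
lemma exists_oneSided_lower_bound {β σ D δ : ℝ} (hcd : c < d) (hσ : σ ∈ Icc c d) (hδ : 0 < δ)
    {n₁ n₂ : ℕ}
    (H4a : σ ∈ Set.Ioc c d → ∀ s ∈ Set.Ioo (σ - δ) σ, ∀ t : ℝ, 0 < t →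
      ∀ ζ : Fin 2 → ℝ, onS1 ζ →
        D * t ^ β * |s - σ| ^ n₁ ≤ |Qform φ (dil α₁ α₂ t ![1, s]) ζ|)
    (H4b : σ ∈ Set.Ico c d → ∀ s ∈ Set.Ioo σ (σ + δ), ∀ t : ℝ, 0 < t →
      ∀ ζ : Fin 2 → ℝ, onS1 ζ →
        D * t ^ β * |s - σ| ^ n₂ ≤ |Qform φ (dil α₁ α₂ t ![1, s]) ζ|) :
    ∃ l : Filter ℝ, l.NeBot ∧ l ≤ nhdsWithin σ {σ}ᶜ ∧ ∃ n ≤ max n₁ n₂,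
      ∀ᶠ s in l, ∀ ζ, onS1 ζ → D * |s - σ| ^ n ≤ |Qform φ ![1, s] ζ| := by
  rcases hσ.1.eq_or_lt with h | h
  · refine ⟨nhdsWithin σ (Ioi σ), inferInstance, nhdsWithin_mono _ fun s hs => ne_of_gt hs, n₂,
      le_max_right _ _, ?_⟩
    filter_upwards [Ioo_mem_nhdsGT (lt_add_of_pos_right σ hδ)] with s hs ζ hζ
    simpa [dil_one] using H4b ⟨hσ.1, h ▸ hcd⟩ s hs 1 one_pos ζ hζ
  · refine ⟨nhdsWithin σ (Iio σ), inferInstance, nhdsWithin_mono _ fun s hs => ne_of_lt hs, n₁,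
      le_max_left _ _, ?_⟩
    filter_upwards [Ioo_mem_nhdsLT (sub_lt_self σ hδ)] with s hs ζ hζ
    simpa [dil_one] using H4a ⟨h, hσ.2⟩ s hs 1 one_pos ζ hζ

/-- Uniform decay of the Fourier transform of the surface measure. -/
theorem exists_fourier_decay {σ D δ : ℝ} (hα₁ : 0 < α₁) (hα₂ : 0 < α₂)
    (hm : 3 * (α₁ + α₂) ≤ m) (H1 : AnalyticOnNhd ℝ φ (Vab α₁ α₂ a b))
    (H2 : ∀ x ∈ Vab α₁ α₂ a b, ∀ t : ℝ, 0 < t → φ (dil α₁ α₂ t x) = t ^ m • φ x)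
    (hac : a < c) (hcd : c < d) (hdb : d < b) (hσ : σ ∈ Set.Icc c d)
    (H3 : {x | x ∈ closure (Vab α₁ α₂ c d) ∧ x ≠ 0 ∧ ¬ Elliptic φ x}
        = {x | ∃ t : ℝ, 0 < t ∧ x = dil α₁ α₂ t ![1, σ]})
    {n₁ n₂ : ℕ} (hn : ((max n₁ n₂ : ℕ) : ℝ) < 2 * m / (α₁ + α₂) - 3) (hD : 0 < D) (hδ : 0 < δ)
    (H4a : σ ∈ Set.Ioc c d → ∀ s ∈ Set.Ioo (σ - δ) σ, ∀ t : ℝ, 0 < t →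
      ∀ ζ : Fin 2 → ℝ, onS1 ζ →
        D * t ^ (2 * (m - α₁ - α₂)) * |s - σ| ^ n₁ ≤ |Qform φ (dil α₁ α₂ t ![1, s]) ζ|)
    (H4b : σ ∈ Set.Ico c d → ∀ s ∈ Set.Ioo σ (σ + δ), ∀ t : ℝ, 0 < t →
      ∀ ζ : Fin 2 → ℝ, onS1 ζ →
        D * t ^ (2 * (m - α₁ - α₂)) * |s - σ| ^ n₂ ≤ |Qform φ (dil α₁ α₂ t ![1, s]) ζ|)
    {γ : ℝ} (hγ0 : 0 ≤ γ) (hγ : γ ≤ (α₁ + α₂) / m) :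
    ∃ C : ℝ, ∀ u w : Fin 2 → ℝ, w ≠ 0 →
      ‖∫ x in V1 α₁ α₂ c d, Complex.exp (-Complex.I * ((dot2 u x + dot2 w (φ x) : ℝ) : ℂ))‖
        ≤ C * ‖w‖ ^ (-γ) := by
  set g : Fin 2 → ℝ → ℝ := fun i s => φ ![1, s] i with hgdef
  have hg : ∀ i, AnalyticOnNhd ℝ (g i) (Ioo a b) := analyticOnNhd_slice H1
  set k := α₂ / α₁ with hkdef
  set r := m / α₁ with hrdef
  have hα : 0 < α₁ + α₂ := add_pos hα₁ hα₂
  have hk : 0 < k := div_pos hα₂ hα₁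
  have hr1 : 1 < r := (one_lt_div hα₁).2 (by linarith)
  have hkr : k < r := div_lt_div_of_pos_right (by linarith) hα₁
  have hratio : (1 + k) / r = (α₁ + α₂) / m := by
    have : m ≠ 0 := by linarith
    rw [hkdef, hrdef]
    field_simp
  obtain ⟨N, hN, hnN, hNκ⟩ := exists_type_bound hα hm hn
  obtain ⟨l, hl, hlσ, n, hnn, hlow⟩ := exists_oneSided_lower_bound hcd hσ hδ H4a H4b
  have hsub : Icc c d ⊆ Ioo a b := Icc_subset_Ioo hac hdb
  have hloc : ∀ s ∈ Icc c d, ∀ ζ : Fin 2 → ℝ, ‖ζ‖ = 1 →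
      ∃ V ∈ nhds s, ∃ Z ∈ nhds ζ, WedgeDecay g k r (1 / 2) (1 / N) V Z := by
    intro s hs ζ hζ
    have hζ0 : ζ ≠ 0 := fun h => by simp [h] at hζ
    by_cases h : ∃ j, 2 ≤ j ∧ j ≤ N ∧ pairDeriv g j ζ s ≠ 0
    · obtain ⟨j, hj2, hjN, hj⟩ := h
      exact wedgeDecay_of_pairDeriv_ne_zero hg hk (by norm_num) hj2
        (one_div_le_one_div_of_le (by exact_mod_cast two_pos.trans_le hj2)
          (by exact_mod_cast hjN)) (hsub hs) hj
    · push Not at h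
      have h2 := h 2 le_rfl hN
      refine wedgeDecay_of_pairDeriv_two_eq_zero hg hk hkr hr1 (by norm_num) (by norm_num)
        (one_div_le_one_div_of_le two_pos (by exact_mod_cast hN)) (hsub hs) h2 ?_
      by_contra! h01
      have hQ : Qform φ ![1, s] ζ = 0 := by
        rw [Qform_one_vec hα₁ H1 H2 (hsub hs) ζ, h2, h01.1, h01.2]
        simp [hessDet]
      obtain rfl := eq_of_not_elliptic hα₁ hcd H3 hs (not_elliptic_of_Qform_eq_zero hζ0 hQ)
      obtain ⟨j, hjN, hj⟩ := exists_pairDeriv_ne_zero hα₁ H1 H2 (hsub hs) hlσ hD hN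
        ((Nat.add_le_add_right hnn 2).trans hnN) hlow hζ0
      rcases j with _ | _ | j
      · exact hj h01.1
      · exact hj h01.2
      · exact hj (h _ (by omega) hjN)
  obtain ⟨C, hC, hA⟩ := exists_wedge_bound (ε := 1 / 2) (r := r) hg hk (by norm_num) hac hcd hdb
    hloc
  obtain ⟨C', hC'⟩ := exists_full_wedge_bound (M := max |c| |d|) hg hk (one_pos.trans hr1)
    (by norm_num) (by norm_num) measurableSet_Ioo (Ioo_subset_Icc_self.trans hsub)
    (fun s hs => abs_le_max_abs_abs hs.1.le hs.2.le) (hratio.trans_lt hNκ) hC hA hγ0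
    (hγ.trans_eq hratio.symm)
  refine ⟨C', fun u w hw => ?_⟩
  have hw' : 0 < ‖w‖ := norm_pos_iff.2 hw
  have hm1 : MeasurableSet (wedge k (Ioo 0 1) (Ioo c d)) :=
    measurableSet_wedge k measurableSet_Ioo measurableSet_Ioo
  refine le_of_eq_of_le ?_ (hC' (‖w‖⁻¹ • w) u ‖w‖ (by
    rw [norm_smul, norm_inv, norm_norm, inv_mul_cancel₀ hw'.ne']) hw')
  rw [V1_eq_wedge hα₁]
  refine congrArg _ (setIntegral_congr_fun hm1 fun x hx => ?_)
  have hx' : x ∈ Vab α₁ α₂ a b :=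
    V1_subset_Vab hac.le hdb.le (by rw [V1_eq_wedge hα₁]; exact hx)
  have : dot2 u x + dot2 w (φ x) = wedgePhase k r g u (‖w‖⁻¹ • w) ‖w‖ x := by
    simp only [wedgePhase, dot2, pairDeriv, iteratedDeriv_zero, Pi.smul_apply, smul_eq_mul,
      apply_eq_of_homogeneous hα₁ H2 hx', hgdef]
    field_simp
    simp only [hkdef, hrdef]
  simp only [this]

end

section
variable {V : Set (Fin 2 → ℝ)} {φ : (Fin 2 → ℝ) → Fin 2 → ℝ}

lemma enorm_ftrans_le (f : (Fin 4 → ℝ) → ℂ) (ξ : Fin 4 → ℝ) :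
    ‖ftrans f ξ‖ₑ ≤ eLpNorm f 1 volume := by
  rw [eLpNorm_one_eq_lintegral_enorm]
  refine (enorm_integral_le_lintegral_enorm _).trans (lintegral_mono fun x => ?_)
  rw [enorm_mul, ← ofReal_norm (Complex.exp _), norm_cexp_neg_I_mul, ENNReal.ofReal_one, one_mul]

lemma restriction_one (hV : volume V ≠ ⊤) : ∃ C : ℝ, 0 < C ∧ ∀ f : SchwartzMap (Fin 4 → ℝ) ℂ,
    eLpNorm (fun x : Fin 2 → ℝ => ftrans (⇑f) (graphMap φ x)) 2 (volume.restrict V) ≤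
      ENNReal.ofReal C * eLpNorm (⇑f) 1 volume := by
  refine ⟨volume.real V ^ (1 / 2 : ℝ) + 1, by positivity, fun f => ?_⟩
  refine (eLpNorm_le_of_ae_enorm_bound
    (Filter.Eventually.of_forall fun x => enorm_ftrans_le _ _)).trans ?_
  rw [smul_eq_mul, mul_comm, Measure.restrict_apply_univ]
  gcongr
  rw [← ENNReal.ofReal_toReal hV, ENNReal.ofReal_rpow_of_nonneg (by positivity) (by positivity)]
  refine ENNReal.ofReal_le_ofReal ?_
  simp [Measure.real]

lemma restriction_of_one_lt (hVm : MeasurableSet V) (hV : volume V ≠ ⊤) (hφ : ContinuousOn φ V)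
    {p : ℝ} (hp1 : 1 < p) (hp2 : p < 2) {C : ℝ}
    (hdecay : ∀ u w : Fin 2 → ℝ, w ≠ 0 →
      ‖∫ x in V, Complex.exp (-Complex.I * ((dot2 u x + dot2 w (φ x) : ℝ) : ℂ))‖
        ≤ C * ‖w‖ ^ (-(4 * (p - 1) / (2 - p)))) :
    ∃ C' : ℝ, 0 < C' ∧ ∀ f : SchwartzMap (Fin 4 → ℝ) ℂ,
      eLpNorm (fun x : Fin 2 → ℝ => ftrans (⇑f) (graphMap φ x)) 2 (volume.restrict V) ≤
        ENNReal.ofReal C' * eLpNorm (⇑f) (ENNReal.ofReal p) volume := by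
  have hp0 : 0 < p := by linarith
  have hψm : Measurable (V.indicator φ) := by
    classical
    rw [← piecewise_eq_indicator]
    exact ContinuousOn.measurable_piecewise hφ continuousOn_const hVm
  have hψ : ∀ x ∈ V, V.indicator φ x = φ x := fun x hx => indicator_of_mem hx φ
  obtain ⟨C', hC', h⟩ := restriction_of_decay hp1 hp2 hV hψm (C := C) fun u w hw => by
    rw [setIntegral_congr_fun (g := fun x => Complex.exp
      (-Complex.I * ((dot2 u x + dot2 w (φ x) : ℝ) : ℂ))) hVm fun x hx => by simp only [hψ x hx]]
    exact hdecay u w hw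
  refine ⟨C' ^ (1 / 2 : ℝ), by positivity, fun f => ?_⟩
  have hF := h (f ∘ joinFour) (f.continuous.comp continuous_joinFour).measurable
    ((measurePreserving_joinFour.integrable_comp_emb measurableEmbedding_joinFour).2 f.integrable)
  have e1 : ∫⁻ x in V, ‖ftrans (⇑f) (graphMap φ x)‖ₑ ^ (2 : ℝ) =
      ∫⁻ x in V, ‖graphTransform (V.indicator φ) (f ∘ joinFour) x‖ₑ ^ 2 := by
    refine setLIntegral_congr_fun hVm fun x hx => ?_
    simp only [← ftrans_graphMap_eq, graphMap, hψ x hx, ENNReal.rpow_two]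
  have e2 : ∫⁻ q, ‖(f ∘ joinFour) q‖ₑ ^ p ∂((volume : Measure (Fin 2 → ℝ)).prod volume) =
      ∫⁻ x, ‖f x‖ₑ ^ p :=
    measurePreserving_joinFour.lintegral_comp_emb measurableEmbedding_joinFour
      (fun x => ‖f x‖ₑ ^ p)
  rw [eLpNorm_eq_lintegral_rpow_enorm_toReal two_ne_zero ENNReal.ofNat_ne_top,
    eLpNorm_eq_lintegral_rpow_enorm_toReal (by simpa using hp0) ENNReal.ofReal_ne_top,
    ENNReal.toReal_ofReal hp0.le, ENNReal.toReal_ofNat, e1]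
  rw [e2] at hF
  refine (ENNReal.rpow_le_rpow hF (by norm_num : (0 : ℝ) ≤ 1 / 2)).trans_eq ?_
  rw [ENNReal.mul_rpow_of_nonneg _ _ (by norm_num), ← ENNReal.rpow_mul,
    ENNReal.ofReal_rpow_of_pos hC']
  congr 2
  field_simp

end

/-- The diagonal linear automorphism of `ℝ⁴` with entries `c`. -/
def diagEquiv (c : Fin 4 → ℝ) (hc : ∀ i, c i ≠ 0) : (Fin 4 → ℝ) ≃L[ℝ] (Fin 4 → ℝ) :=
  (LinearEquiv.piCongrRight fun i =>
    LinearEquiv.smulOfNeZero ℝ ℝ (c i) (hc i)).toContinuousLinearEquiv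

lemma diagEquiv_apply (c : Fin 4 → ℝ) (hc : ∀ i, c i ≠ 0) (x : Fin 4 → ℝ) (i : Fin 4) :
    diagEquiv c hc x i = c i * x i := rfl

lemma measurableEmbedding_diagEquiv (c : Fin 4 → ℝ) (hc : ∀ i, c i ≠ 0) :
    MeasurableEmbedding (diagEquiv c hc) :=
  (diagEquiv c hc).toHomeomorph.measurableEmbedding

section
variable {c : Fin 4 → ℝ}

lemma ofReal_smul_map_diagEquiv (hc : ∀ i, 0 < c i) :
    ENNReal.ofReal (∏ i, c i) • Measure.map (diagEquiv c fun i => (hc i).ne') volume = volume := by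
  have hP : 0 < ∏ i, c i := Finset.prod_pos fun i _ => hc i
  have h := Real.smul_map_diagonal_volume_pi (D := c) (by rw [Matrix.det_diagonal]; exact hP.ne')
  have e : ⇑(Matrix.toLin' (Matrix.diagonal c)) = diagEquiv c fun i => (hc i).ne' := by
    funext x i
    simp [Matrix.mulVec_diagonal, diagEquiv_apply]
  rwa [Matrix.det_diagonal, e, abs_of_pos hP] at h

lemma eLpNorm_comp_diagEquiv (hc : ∀ i, 0 < c i) (f : (Fin 4 → ℝ) → ℂ) (p : ℝ≥0∞) :
    eLpNorm f p volume = ENNReal.ofReal (∏ i, c i) ^ (1 / p).toReal *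
      eLpNorm (f ∘ diagEquiv c fun i => (hc i).ne') p volume := by
  have hP : 0 < ∏ i, c i := Finset.prod_pos fun i _ => hc i
  conv_lhs => rw [← ofReal_smul_map_diagEquiv hc]
  rw [eLpNorm_smul_measure_of_ne_zero (by simpa using hP),
    (measurableEmbedding_diagEquiv c fun i => (hc i).ne').eLpNorm_map_measure,
    smul_eq_mul]

lemma ftrans_comp_diagEquiv (hc : ∀ i, 0 < c i) (f : (Fin 4 → ℝ) → ℂ) (η : Fin 4 → ℝ) :
    ftrans f η = ((∏ i, c i : ℝ) : ℂ) * ftrans (f ∘ diagEquiv c fun i => (hc i).ne')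
      (diagEquiv c (fun i => (hc i).ne') η) := by
  have hP : 0 < ∏ i, c i := Finset.prod_pos fun i _ => hc i
  rw [ftrans]
  conv_lhs => rw [← ofReal_smul_map_diagEquiv hc]
  rw [integral_smul_measure, ENNReal.toReal_ofReal hP.le, Complex.real_smul,
    (measurableEmbedding_diagEquiv c fun i => (hc i).ne').integral_map, ftrans]
  refine congrArg _ (integral_congr_ae (Filter.Eventually.of_forall fun x => ?_))
  have : dot4 (diagEquiv c (fun i => (hc i).ne') x) η
      = dot4 x (diagEquiv c (fun i => (hc i).ne') η) := by
    simp only [dot4, diagEquiv_apply]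
    ring
  simp [this]

end

lemma continuous_ftrans (f : SchwartzMap (Fin 4 → ℝ) ℂ) : Continuous (ftrans f) := by
  refine continuous_of_dominated (bound := fun x => ‖f x‖) (fun ξ => ?_) (fun ξ => ?_)
    f.integrable.norm ?_
  · have : Continuous fun x : Fin 4 → ℝ => Complex.exp (-Complex.I * (dot4 x ξ : ℂ)) * f x := by
      unfold dot4
      have := f.continuous
      fun_prop
    exact this.aestronglyMeasurable
  · refine Filter.Eventually.of_forall fun x => ?_
    rw [norm_mul, norm_cexp_neg_I_mul, one_mul]
  · refine Filter.Eventually.of_forall fun x => ?_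
    unfold dot4
    fun_prop

/-- Some Schwartz function has nonvanishing Fourier transform at a prescribed point. -/
lemma exists_ftrans_ne_zero (ξ : Fin 4 → ℝ) :
    ∃ f : SchwartzMap (Fin 4 → ℝ) ℂ, ftrans f ξ ≠ 0 := by
  let b : ContDiffBump (0 : Fin 4 → ℝ) := default
  have hsm : ContDiff ℝ (⊤ : ℕ∞)
      fun x : Fin 4 → ℝ => Complex.exp (Complex.I * (dot4 x ξ : ℂ)) * (b x : ℂ) := by
    have h1 : ContDiff ℝ (⊤ : ℕ∞) fun x : Fin 4 → ℝ => dot4 x ξ := by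
      unfold dot4
      fun_prop
    exact (contDiff_const.mul (Complex.ofRealCLM.contDiff.comp h1)).cexp.mul
      (Complex.ofRealCLM.contDiff.comp b.contDiff)
  have hcs : HasCompactSupport
      fun x : Fin 4 → ℝ => Complex.exp (Complex.I * (dot4 x ξ : ℂ)) * (b x : ℂ) :=
    (b.hasCompactSupport.comp_left (g := fun t : ℝ => (t : ℂ)) Complex.ofReal_zero).mul_left
  refine ⟨hcs.toSchwartzMap hsm, ?_⟩
  have e : ftrans (hcs.toSchwartzMap hsm) ξ = ((∫ x, b x : ℝ) : ℂ) := by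
    rw [ftrans, ← integral_complex_ofReal]
    refine integral_congr_ae (Filter.Eventually.of_forall fun x => ?_)
    change Complex.exp _ * (Complex.exp _ * (b x : ℂ)) = (b x : ℂ)
    rw [← mul_assoc, ← Complex.exp_add, neg_mul, neg_add_cancel, Complex.exp_zero, one_mul]
  rw [e]
  exact_mod_cast (b.integral_pos (μ := volume)).ne'

section
variable {α₁ α₂ a b c d m : ℝ} {φ : (Fin 2 → ℝ) → Fin 2 → ℝ}

lemma dil_eq_scaleMap (t : ℝ) : dil α₁ α₂ t = scaleMap (t ^ α₁) (t ^ α₂) := rfl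

lemma dil_dil {s t : ℝ} (hs : 0 ≤ s) (ht : 0 ≤ t) (x : Fin 2 → ℝ) :
    dil α₁ α₂ s (dil α₁ α₂ t x) = dil α₁ α₂ (s * t) x := by
  ext i
  fin_cases i <;> simp [dil, Real.mul_rpow hs ht, mul_assoc]

lemma V1_subset_preimage_dil {t : ℝ} (ht : 0 < t) (ht1 : t ≤ 1) :
    V1 α₁ α₂ c d ⊆ dil α₁ α₂ t ⁻¹' V1 α₁ α₂ c d := by
  rintro x ⟨s, τ, h1, h2, hτ, hτ1, rfl⟩
  exact ⟨s, t * τ, h1, h2, mul_pos ht hτ, mul_lt_one_of_nonneg_of_lt_one_right ht1 hτ.le hτ1,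
    dil_dil ht.le hτ.le _⟩

lemma continuousOn_V1 (H1 : AnalyticOnNhd ℝ φ (Vab α₁ α₂ a b)) (hac : a < c) (hdb : d < b) :
    ContinuousOn φ (V1 α₁ α₂ c d) :=
  H1.continuousOn.mono (V1_subset_Vab hac.le hdb.le)

lemma isOpen_V1 (hα₁ : 0 < α₁) : IsOpen (V1 α₁ α₂ c d) := by
  have hc : ContinuousOn (fun x : Fin 2 → ℝ => x 1 * x 0 ^ (-(α₂ / α₁))) {x | x 0 ∈ Ioo 0 1} :=
    fun x hx => ((continuous_apply 1).continuousAt.mul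
      ((continuous_apply (0 : Fin 2)).continuousAt.rpow_const (x := x)
        (Or.inl hx.1.ne'))).continuousWithinAt
  rw [V1_eq_wedge hα₁]
  exact hc.isOpen_inter_preimage (isOpen_Ioo.preimage (continuous_apply 0)) isOpen_Ioo

lemma volume_V1_ne_top (hα₁ : 0 < α₁) (hα₂ : 0 < α₂) : volume (V1 α₁ α₂ c d) ≠ ⊤ := by
  rw [V1_eq_wedge hα₁]
  exact volume_wedge_Ioo_ne_top (M := max |c| |d|) (div_pos hα₂ hα₁)
    fun s hs => abs_le_max_abs_abs hs.1.le hs.2.le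

lemma continuousOn_graphMap {V : Set (Fin 2 → ℝ)} (hφ : ContinuousOn φ V) :
    ContinuousOn (graphMap φ) V := by
  have h := continuousOn_pi.1 hφ
  refine continuousOn_pi.2 fun i => ?_
  fin_cases i
  · exact (continuous_apply 0).continuousOn
  · exact (continuous_apply 1).continuousOn
  · exact h 0
  · exact h 1

/-- Scaling a restriction estimate. -/
lemma rpow_mul_lintegral_le (hα₁ : 0 < α₁) (hac : a < c) (hdb : d < b)
    (H2 : ∀ x ∈ Vab α₁ α₂ a b, ∀ t : ℝ, 0 < t → φ (dil α₁ α₂ t x) = t ^ m • φ x)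
    {p : ℝ≥0∞} {C : ℝ} (hC : ∀ f : SchwartzMap (Fin 4 → ℝ) ℂ,
      eLpNorm (fun x : Fin 2 → ℝ => ftrans (⇑f) (graphMap φ x)) 2
          (volume.restrict (V1 α₁ α₂ c d)) ≤ ENNReal.ofReal C * eLpNorm (⇑f) p volume)
    (f : SchwartzMap (Fin 4 → ℝ) ℂ) {t : ℝ} (ht : 0 < t) (ht1 : t < 1) :
    ENNReal.ofReal (t ^ ((α₁ + α₂) / 2)) *
        eLpNorm (fun x : Fin 2 → ℝ => ftrans (⇑f) (graphMap φ x)) 2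
          (volume.restrict (V1 α₁ α₂ c d)) ≤
      ENNReal.ofReal (t ^ ((α₁ + α₂ + 2 * m) * (1 - (1 / p).toReal))) *
        (ENNReal.ofReal C * eLpNorm (⇑f) p volume) := by
  set V := V1 α₁ α₂ c d with hVdef
  have hVm : MeasurableSet V := (isOpen_V1 hα₁).measurableSet
  have hcpos : ∀ i, 0 < (![t ^ α₁, t ^ α₂, t ^ m, t ^ m] : Fin 4 → ℝ) i := fun i => by
    fin_cases i <;> exact Real.rpow_pos_of_pos ht _
  have hprod : ∏ i, (![t ^ α₁, t ^ α₂, t ^ m, t ^ m] : Fin 4 → ℝ) i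
      = t ^ (α₁ + α₂ + 2 * m) := by
    rw [Fin.prod_univ_four, two_mul, ← add_assoc, Real.rpow_add ht, Real.rpow_add ht,
      Real.rpow_add ht]
    rfl
  set S := diagEquiv _ fun i => (hcpos i).ne' with hS
  set ft : SchwartzMap (Fin 4 → ℝ) ℂ := SchwartzMap.compCLMOfContinuousLinearEquiv ℝ S f with hft
  have hftc : (ft : (Fin 4 → ℝ) → ℂ) = f ∘ S := rfl
  set B := α₁ + α₂ + 2 * m with hB
  have hP : 0 < t ^ B := Real.rpow_pos_of_pos ht _
  have hgraph : ∀ x ∈ V, graphMap φ (dil α₁ α₂ t x) = S (graphMap φ x) := fun x hx => by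
    have h2 := H2 x (V1_subset_Vab hac.le hdb.le hx) t ht
    ext i
    fin_cases i <;> simp [graphMap, hS, diagEquiv_apply, h2] <;> simp [dil]
  have hval : ∀ x ∈ V, ‖ftrans f (graphMap φ x)‖ₑ
      = ENNReal.ofReal (t ^ B) * ‖ftrans ft (graphMap φ (dil α₁ α₂ t x))‖ₑ := fun x hx => by
    rw [ftrans_comp_diagEquiv hcpos f, hgraph x hx, hftc, hprod, enorm_mul, ← ofReal_norm,
      Complex.norm_real, Real.norm_of_nonneg hP.le]
  have hI : ENNReal.ofReal (t ^ (α₁ + α₂)) * ∫⁻ x in V, ‖ftrans f (graphMap φ x)‖ₑ ^ (2 : ℝ) ≤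
      ENNReal.ofReal (t ^ B) ^ (2 : ℝ) * ∫⁻ x in V, ‖ftrans ft (graphMap φ x)‖ₑ ^ (2 : ℝ) := by
    rw [lintegral_scaleMap (Real.rpow_pos_of_pos ht α₁) (Real.rpow_pos_of_pos ht α₂) V
      (fun x => ‖ftrans ft (graphMap φ x)‖ₑ ^ (2 : ℝ)), ← Real.rpow_add ht, mul_left_comm,
      ← lintegral_const_mul' _ _ (ENNReal.rpow_ne_top_of_nonneg zero_le_two ENNReal.ofReal_ne_top)]
    refine mul_le_mul_right ?_ _
    refine le_trans (le_of_eq ?_) (lintegral_mono_set (V1_subset_preimage_dil ht ht1.le))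
    refine setLIntegral_congr_fun hVm fun x hx => ?_
    simp only [hval x hx, ENNReal.mul_rpow_of_nonneg _ _ zero_le_two, dil_eq_scaleMap]
  have hN : ENNReal.ofReal (t ^ ((α₁ + α₂) / 2)) *
      eLpNorm (fun x : Fin 2 → ℝ => ftrans (⇑f) (graphMap φ x)) 2 (volume.restrict V) ≤
      ENNReal.ofReal (t ^ B) *
        eLpNorm (fun x : Fin 2 → ℝ => ftrans (⇑ft) (graphMap φ x)) 2 (volume.restrict V) := by
    have := ENNReal.rpow_le_rpow hI (by norm_num : (0 : ℝ) ≤ 1 / 2)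
    rw [ENNReal.mul_rpow_of_nonneg _ _ (by norm_num), ENNReal.mul_rpow_of_nonneg _ _ (by norm_num),
      ← ENNReal.rpow_mul, ENNReal.ofReal_rpow_of_pos (Real.rpow_pos_of_pos ht _),
      ← Real.rpow_mul ht.le] at this
    simpa [eLpNorm_eq_lintegral_rpow_enorm_toReal, div_eq_mul_inv] using this
  refine hN.trans ((mul_le_mul_right (hC ft) _).trans_eq ?_)
  have e : ENNReal.ofReal (t ^ B) = ENNReal.ofReal (t ^ (B * (1 - (1 / p).toReal))) *
      ENNReal.ofReal (t ^ B) ^ (1 / p).toReal := by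
    rw [ENNReal.ofReal_rpow_of_pos hP, ← ENNReal.ofReal_mul (by positivity), ← Real.rpow_mul ht.le,
      ← Real.rpow_add ht]
    congr 2
    ring
  rw [eLpNorm_comp_diagEquiv hcpos f p, hprod, hftc]
  conv_lhs => rw [e]
  ring

lemma exponent_le_of_forall_rpow_le {A K u v : ℝ} (hA : 0 < A)
    (h : ∀ t ∈ Ioo (0 : ℝ) 1, t ^ u * A ≤ t ^ v * K) : v ≤ u := by
  by_contra! huv
  have hlim : Filter.Tendsto (fun t : ℝ => t ^ (v - u) * K) (nhdsWithin 0 (Ioi 0)) (nhds 0) := by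
    have := (Real.continuousAt_rpow_const 0 (v - u) (Or.inr (sub_pos.2 huv).le)).tendsto
    rw [Real.zero_rpow (sub_pos.2 huv).ne'] at this
    simpa using (this.mono_left nhdsWithin_le_nhds).mul_const K
  refine hA.not_ge (ge_of_tendsto hlim ?_)
  filter_upwards [Ioo_mem_nhdsGT (zero_lt_one' ℝ)] with t ht
  have hu := Real.rpow_pos_of_pos ht.1 u
  have := h t ht
  rw [← mul_le_mul_iff_right₀ hu, ← mul_assoc, ← Real.rpow_add ht.1, add_sub_cancel]
  exact this

/-- Necessity of the exponent condition. -/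
lemma exponent_le_of_restriction (hα₁ : 0 < α₁) (hα₂ : 0 < α₂) (hm : 0 < m)
    (H1 : AnalyticOnNhd ℝ φ (Vab α₁ α₂ a b))
    (H2 : ∀ x ∈ Vab α₁ α₂ a b, ∀ t : ℝ, 0 < t → φ (dil α₁ α₂ t x) = t ^ m • φ x)
    (hac : a < c) (hcd : c < d) (hdb : d < b) {p : ℝ≥0∞} {C : ℝ}
    (hC : ∀ f : SchwartzMap (Fin 4 → ℝ) ℂ,
      eLpNorm (fun x : Fin 2 → ℝ => ftrans (⇑f) (graphMap φ x)) 2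
          (volume.restrict (V1 α₁ α₂ c d)) ≤ ENNReal.ofReal C * eLpNorm (⇑f) p volume) :
    (α₁ + α₂ + 4 * m) / (2 * (α₁ + α₂ + 2 * m)) ≤ (1 / p).toReal := by
  set y : Fin 2 → ℝ := dil α₁ α₂ (1 / 2) ![1, (c + d) / 2] with hy
  have hyV : y ∈ V1 α₁ α₂ c d :=
    ⟨_, _, by linarith, by linarith, by norm_num, by norm_num, rfl⟩
  obtain ⟨f, hf⟩ := exists_ftrans_ne_zero (graphMap φ y)
  have hcont : ContinuousOn (fun x => ftrans f (graphMap φ x)) (V1 α₁ α₂ c d) :=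
    (continuous_ftrans f).comp_continuousOn (continuousOn_graphMap (continuousOn_V1 H1 hac hdb))
  have hpos : eLpNorm (fun x : Fin 2 → ℝ => ftrans (⇑f) (graphMap φ x)) 2
      (volume.restrict (V1 α₁ α₂ c d)) ≠ 0 := fun h0 => by
    rw [eLpNorm_eq_zero_iff
      (hcont.aestronglyMeasurable (isOpen_V1 hα₁).measurableSet) two_ne_zero] at h0
    exact hf (Measure.eqOn_open_of_ae_eq h0 (isOpen_V1 hα₁) hcont continuousOn_const hyV)
  have hfin : ENNReal.ofReal C * eLpNorm (⇑f) p volume ≠ ⊤ :=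
    ENNReal.mul_ne_top ENNReal.ofReal_ne_top (f.eLpNorm_lt_top p volume).ne
  have hfin' := ne_top_of_le_ne_top hfin (hC f)
  have hle := exponent_le_of_forall_rpow_le
    (K := (ENNReal.ofReal C * eLpNorm (⇑f) p volume).toReal)
    (u := (α₁ + α₂) / 2) (v := (α₁ + α₂ + 2 * m) * (1 - (1 / p).toReal))
    (ENNReal.toReal_pos hpos hfin') fun t ht => by
      have h := ENNReal.toReal_mono (ENNReal.mul_ne_top ENNReal.ofReal_ne_top hfin)
        (rpow_mul_lintegral_le hα₁ hac hdb H2 hC f ht.1 ht.2)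
      rwa [ENNReal.toReal_mul, ENNReal.toReal_mul,
        ENNReal.toReal_ofReal (Real.rpow_nonneg ht.1.le _),
        ENNReal.toReal_ofReal (Real.rpow_nonneg ht.1.le _)] at h
  rw [div_le_iff₀ (by positivity)]
  linarith

end

/-- Sharp `L²(Σ)` restriction theorem: the estimate
`‖f̂|_Σ‖_{L²(Σ,dμ)} ≤ C ‖f‖_{L^p(ℝ⁴)}` holds iff
`(α₁+α₂+4m)/(2(α₁+α₂+2m)) ≤ 1/p ≤ 1`. -/
theorem stmt_15 (α₁ α₂ m a b : ℝ) (φ : (Fin 2 → ℝ) → Fin 2 → ℝ)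
    (hα₁ : 0 < α₁) (hα₂ : 0 < α₂) (hαne : α₁ ≠ α₂) (hab : a < b)
    (hm : 3 * (α₁ + α₂) ≤ m)
    (H1 : AnalyticOnNhd ℝ φ (Vab α₁ α₂ a b))
    (H2 : ∀ x ∈ Vab α₁ α₂ a b, ∀ t : ℝ, 0 < t → φ (dil α₁ α₂ t x) = t ^ m • φ x)
    (c d σ : ℝ) (hac : a < c) (hcd : c < d) (hdb : d < b) (hσ : σ ∈ Set.Icc c d)
    (H3 : {x | x ∈ closure (Vab α₁ α₂ c d) ∧ x ≠ 0 ∧ ¬ Elliptic φ x}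
        = {x | ∃ t : ℝ, 0 < t ∧ x = dil α₁ α₂ t ![1, σ]})
    (n₁ n₂ : ℕ) (hn₁ : 0 < n₁) (hn₂ : 0 < n₂)
    (hn : ((max n₁ n₂ : ℕ) : ℝ) < 2 * m / (α₁ + α₂) - 3)
    (D δ : ℝ) (hD : 0 < D) (hδ : 0 < δ)
    (H4a : σ ∈ Set.Ioc c d → ∀ s ∈ Set.Ioo (σ - δ) σ, ∀ t : ℝ, 0 < t →
      ∀ ζ : Fin 2 → ℝ, onS1 ζ →
        D * t ^ (2 * (m - α₁ - α₂)) * |s - σ| ^ n₁ ≤ |Qform φ (dil α₁ α₂ t ![1, s]) ζ|)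
    (H4b : σ ∈ Set.Ico c d → ∀ s ∈ Set.Ioo σ (σ + δ), ∀ t : ℝ, 0 < t →
      ∀ ζ : Fin 2 → ℝ, onS1 ζ →
        D * t ^ (2 * (m - α₁ - α₂)) * |s - σ| ^ n₂ ≤ |Qform φ (dil α₁ α₂ t ![1, s]) ζ|)
    (p : ℝ≥0∞) (hp : 1 ≤ p) :
    (∃ C : ℝ, 0 < C ∧ ∀ f : SchwartzMap (Fin 4 → ℝ) ℂ,
      eLpNorm (fun x : Fin 2 → ℝ => ftrans (⇑f) (graphMap φ x)) 2
          ((volume : Measure (Fin 2 → ℝ)).restrict (V1 α₁ α₂ c d)) ≤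
        ENNReal.ofReal C * eLpNorm (⇑f) p (volume : Measure (Fin 4 → ℝ))) ↔
    (ENNReal.ofReal ((α₁ + α₂ + 4 * m) / (2 * (α₁ + α₂ + 2 * m))) ≤ 1 / p ∧ 1 / p ≤ 1) := by
  have hα : 0 < α₁ + α₂ := add_pos hα₁ hα₂
  have hm0 : 0 < m := by linarith
  have hp1 : 1 / p ≤ 1 := by simpa using hp
  constructor
  · rintro ⟨C, -, hC⟩
    exact ⟨ENNReal.ofReal_le_of_le_toReal
      (exponent_le_of_restriction hα₁ hα₂ hm0 H1 H2 hac hcd hdb hC), hp1⟩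
  · rintro ⟨h, -⟩
    have hV := volume_V1_ne_top (c := c) (d := d) hα₁ hα₂
    rcases hp.eq_or_lt with rfl | hp1'
    · exact restriction_one hV
    have hptop : p ≠ ⊤ := by
      rintro rfl
      have : 0 < (α₁ + α₂ + 4 * m) / (2 * (α₁ + α₂ + 2 * m)) := by positivity
      simp only [one_div, ENNReal.inv_top, nonpos_iff_eq_zero, ENNReal.ofReal_eq_zero] at h
      exact this.not_ge h
    lift p to NNReal using hptop
    have hq1 : 1 < (p : ℝ) := by exact_mod_cast hp1'
    have hq : (p : ℝ) * (α₁ + α₂ + 4 * m) ≤ 2 * (α₁ + α₂ + 2 * m) := by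
      have h' := ENNReal.toReal_mono (ne_top_of_le_ne_top ENNReal.one_ne_top hp1) h
      rw [ENNReal.toReal_ofReal (by positivity), ENNReal.toReal_div, ENNReal.toReal_one,
        ENNReal.coe_toReal, div_le_div_iff₀ (by positivity) (by linarith)] at h'
      linarith
    have hq2 : (p : ℝ) < 2 := by nlinarith
    have hγ : 4 * ((p : ℝ) - 1) / (2 - p) ≤ (α₁ + α₂) / m := by
      rw [div_le_div_iff₀ (by linarith) hm0]
      linarith
    obtain ⟨C, hC⟩ := exists_fourier_decay hα₁ hα₂ hm H1 H2 hac hcd hdb hσ H3 hn hD hδ H4a H4b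
      (div_nonneg (by linarith) (by linarith)) hγ
    have := restriction_of_one_lt (isOpen_V1 hα₁).measurableSet hV (continuousOn_V1 H1 hac hdb)
      hq1 hq2 hC
    rwa [ENNReal.ofReal_coe_nnreal] at this

end
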